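/- arXiv:1111.6160 — 3 statements merged into one kernel-verified Lean document; each statement's English description precedes it below -/
import Mathlib

section
/- There exist constants d>0 and c>0 depending only on r, α, C_M, B such that, with λ_n = d·n^{−(1+α)/(2+α+r)}, the minimax accuracy confidence function satisfies AC_n(𝓜(r,α), λ) = inf over all classifiers f̂_n of sup over P∈𝓜(r,α) of ℙ( R(f̂_n) − R* ≥ λ ) ≤ 2·exp(−c·n·λ^{(2+α)/(1+α)}) for all λ ≥ λ_n. -/
open MeasureTheory Set
open scoped ENNReal

noncomputable section

/-- The margin condition with exponent `α` and constant `C`: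
`μ_X(0 < |η(X) - 1/2| ≤ t) ≤ C t^α` for all `0 ≤ t < 1`. -/
def MarginCond {𝒳 : Type*} [MeasurableSpace 𝒳] (μ : Measure 𝒳) (η : 𝒳 → ℝ) (α C : ℝ) : Prop :=
  ∀ t : ℝ, 0 ≤ t → t < 1 →
    (μ {x | 0 < |η x - 1/2| ∧ |η x - 1/2| ≤ t}).toReal ≤ C * t ^ α

/-- The plug-in (Bayes) rule `x ↦ 1{η(x) ≥ 1/2}` associated with a function `η`. -/
def bayes {𝒳 : Type*} (η : 𝒳 → ℝ) : 𝒳 → Bool := fun x => decide ((1:ℝ)/2 ≤ η x)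

/-- `η` is the regression function of the joint distribution `P` of `(X,Y)` on `𝒳 × {0,1}`:
`η` is Borel with values in `[0,1]` and `P(A × {1}) = ∫_A η dμ_X` for every measurable `A`,
where `μ_X = P ∘ (proj₁)⁻¹` is the marginal of `X`. -/
def IsRegFun {𝒳 : Type*} [MeasurableSpace 𝒳] (P : Measure (𝒳 × Bool)) (η : 𝒳 → ℝ) : Prop :=
  Measurable η ∧ (∀ x, η x ∈ Icc (0:ℝ) 1) ∧
    ∀ A : Set 𝒳, MeasurableSet A →
      P (A ×ˢ ({true} : Set Bool)) = ∫⁻ x in A, ENNReal.ofReal (η x) ∂(P.map Prod.fst)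

/-- Classification error `R(f) = P(Y ≠ f(X))` of a prediction rule `f`. -/
def risk {𝒳 : Type*} [MeasurableSpace 𝒳] (P : Measure (𝒳 × Bool)) (f : 𝒳 → Bool) : ℝ :=
  (P {p : 𝒳 × Bool | p.2 ≠ f p.1}).toReal

/-- Real-valued indicator of a prediction rule. -/
def bInd {𝒳 : Type*} (f : 𝒳 → Bool) (x : 𝒳) : ℝ := if f x then 1 else 0

/-- `L¹(μ)`-distance `‖f - g‖_{L¹(μ)}` between two prediction rules. -/
def distL1 {𝒳 : Type*} [MeasurableSpace 𝒳] (μ : Measure 𝒳) (f g : 𝒳 → Bool) : ℝ :=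
  ∫ x, |bInd f x - bInd g x| ∂μ

/-- Empirical risk `R_n(f) = n⁻¹ Σᵢ 1{f(Xᵢ) ≠ Yᵢ}` over a training sample `D`. -/
def empRisk {𝒳 : Type*} (n : ℕ) (D : Fin n → 𝒳 × Bool) (f : 𝒳 → Bool) : ℝ :=
  (n : ℝ)⁻¹ * ∑ i, (if f (D i).1 ≠ (D i).2 then (1:ℝ) else 0)

/-- Sup-norm distance `‖g - g'‖_∞` between two real-valued functions. -/
def supDist {𝒳 : Type*} (g g' : 𝒳 → ℝ) : ℝ := ⨆ x, |g x - g' x|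

universe u


def tern (τ G : ℝ) : ℝ := if τ < G then 1 else if G < -τ then -1 else 0
def sgB (y : Bool) : ℝ := if y then 1 else -1
def tloss {𝒳 : Type*} (τ : ℝ) (g : 𝒳 → ℝ) (p : 𝒳 × Bool) : ℝ :=
  -(sgB p.2 * tern τ (2 * g p.1 - 1)) + τ * |tern τ (2 * g p.1 - 1)|
def ml (τ h φ : ℝ) : ℝ := -(h * φ) + τ * |φ|

lemma pw1 (τ h G Gb I : ℝ) (hτ : 0 < τ) (hG : |Gb - h| ≤ τ / 2)
    (hI0 : 0 ≤ I) (hI : 0 < |h| → |h| ≤ 2 * τ → I = 1) :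
    0 ≤ (ml τ h (tern τ G) - ml τ h (tern τ Gb)) + τ * I ∧
    (tern τ G ≠ tern τ Gb → τ / 2 ≤ (ml τ h (tern τ G) - ml τ h (tern τ Gb)) + τ * I) := by
  have hI' : |h| ≤ τ/2 ∨ 2 * τ < |h| ∨ (I = 1 ∧ τ/2 < |h| ∧ |h| ≤ 2 * τ) := by
    by_cases h1 : |h| ≤ τ/2
    · exact Or.inl h1
    · by_cases h2 : 2 * τ < |h|
      · exact Or.inr (Or.inl h2)
      · refine Or.inr (Or.inr ⟨hI (by linarith) (by linarith), by linarith, by linarith⟩)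
  have hτI : 0 ≤ τ * I := by positivity
  rw [abs_le] at hG
  obtain ⟨hG1, hG2⟩ := hG
  unfold ml tern
  rcases hI' with h1 | h1 | ⟨h0, h1, h2⟩
  · rw [abs_le] at h1
    split_ifs <;> norm_num <;> (try constructor) <;> linarith
  · rcases lt_abs.1 h1 with h1 | h1 <;> split_ifs <;> norm_num <;> (try constructor) <;> linarith
  · subst h0
    rcases abs_cases h with ⟨h3, h4⟩ | ⟨h3, h4⟩ <;> rw [h3] at h1 h2 <;>
    split_ifs <;> norm_num <;> (try constructor) <;> linarith

lemma pw2 (τ e g Gb I : ℝ) (hτ : 0 < τ) (hG : |Gb - (2 * e - 1)| ≤ τ / 2)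
    (hI0 : 0 ≤ I) (hI : 0 < |2 * e - 1| → |2 * e - 1| ≤ 2 * τ → I = 1) :
    (if decide ((1:ℝ)/2 ≤ g) then 1 - e else e) - (if decide ((1:ℝ)/2 ≤ e) then 1 - e else e)
      ≤ 2 * (ml τ (2 * e - 1) (tern τ (2 * g - 1)) - ml τ (2 * e - 1) (tern τ Gb)) + 4 * (τ * I) := by
  have key := (pw1 τ (2*e-1) (2*g-1) Gb I hτ hG hI0 hI).1
  have hτI : 0 ≤ τ * I := by positivity
  by_cases h2 : 2 * τ < |2 * e - 1|
  · rw [abs_le] at hG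
    obtain ⟨hG1, hG2⟩ := hG
    unfold ml tern
    simp only [decide_eq_true_eq]
    rcases lt_abs.1 h2 with h1 | h1 <;> split_ifs <;> norm_num <;> linarith
  · push Not at h2
    by_cases h0 : 0 < |2 * e - 1|
    · rw [hI h0 h2] at key ⊢
      rw [abs_le] at h2
      obtain ⟨h3, h4⟩ := h2
      simp only [decide_eq_true_eq]
      split_ifs <;> linarith
    · have : 2 * e - 1 = 0 := by simpa using h0
      simp only [decide_eq_true_eq]
      split_ifs <;> linarith

lemma pwV (τ e φ φb : ℝ) (hτ : 0 < τ) (hτ1 : τ ≤ 1) (he : e ∈ Icc (0:ℝ) 1) (A : ℝ)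
    (hφ : φ = 1 ∨ φ = 0 ∨ φ = -1) (hφb : φb = 1 ∨ φb = 0 ∨ φb = -1)
    (hA : 0 ≤ A) (hA2 : φ ≠ φb → τ / 2 ≤ A) :
    e * ((-(1 * φ) + τ * |φ|) - (-(1 * φb) + τ * |φb|))^2
      + (1 - e) * ((-(-1 * φ) + τ * |φ|) - (-(-1 * φb) + τ * |φb|))^2 ≤ 18 / τ * A := by
  obtain ⟨he0, he1⟩ := he
  by_cases h : φ = φb
  · subst h; simp; positivity
  · have h1 := hA2 h
    have h9 : (9:ℝ) ≤ 18 / τ * A := by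
      rw [div_mul_eq_mul_div, le_div_iff₀ hτ]; linarith
    have b1 : ((-(1 * φ) + τ * |φ|) - (-(1 * φb) + τ * |φb|))^2 ≤ 9 := by
      rcases hφ with rfl | rfl | rfl <;> rcases hφb with rfl | rfl | rfl <;> norm_num <;> nlinarith
    have b2 : ((-(-1 * φ) + τ * |φ|) - (-(-1 * φb) + τ * |φb|))^2 ≤ 9 := by
      rcases hφ with rfl | rfl | rfl <;> rcases hφb with rfl | rfl | rfl <;> norm_num <;> nlinarith
    have := mul_le_mul_of_nonneg_left b1 he0
    have := mul_le_mul_of_nonneg_left b2 (sub_nonneg.2 he1)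
    linarith

lemma P_decomp {𝒳 : Type*} [MeasurableSpace 𝒳] (P : Measure (𝒳 × Bool)) [IsProbabilityMeasure P]
    (η : 𝒳 → ℝ) (h : IsRegFun P η) :
    P = ((P.map Prod.fst).withDensity (fun x => ENNReal.ofReal (η x))).map (fun x => (x, true))
      + ((P.map Prod.fst).withDensity (fun x => ENNReal.ofReal (1 - η x))).map (fun x => (x, false)) := by
  obtain ⟨hm, h01, hA⟩ := h
  have mt : Measurable (fun x : 𝒳 => (x, true)) := by fun_prop
  have mf : Measurable (fun x : 𝒳 => (x, false)) := by fun_prop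
  have : IsProbabilityMeasure (P.map Prod.fst) := Measure.isProbabilityMeasure_map (by fun_prop)
  have hF : ∀ A : Set 𝒳, MeasurableSet A →
      P (A ×ˢ ({false} : Set Bool)) = ∫⁻ x in A, ENNReal.ofReal (1 - η x) ∂(P.map Prod.fst) := by
    intro A hAm
    have e1 : P (A ×ˢ ({true} : Set Bool)) + P (A ×ˢ ({false} : Set Bool)) = (P.map Prod.fst) A := by
      rw [Measure.map_apply measurable_fst hAm, ← measure_union]
      · congr 1; ext ⟨x, y⟩; cases y <;> simp
      · rw [Set.disjoint_left]; rintro ⟨x, y⟩ h1 h2; simp at h1 h2; simp_all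
      · exact hAm.prod (measurableSet_singleton _)
    have e2 : ∫⁻ x in A, ENNReal.ofReal (η x) ∂(P.map Prod.fst)
        + ∫⁻ x in A, ENNReal.ofReal (1 - η x) ∂(P.map Prod.fst) = (P.map Prod.fst) A := by
      rw [← lintegral_add_left (by fun_prop)]
      rw [← setLIntegral_one]
      refine lintegral_congr fun x => ?_
      rw [← ENNReal.ofReal_add (h01 x).1 (by linarith [(h01 x).2])]
      simp
    rw [← e2, hA A hAm] at e1
    refine (ENNReal.add_right_inj ?_).1 e1
    rw [← hA A hAm]
    exact measure_ne_top _ _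
  ext s hs
  rw [Measure.add_apply, Measure.map_apply mt hs, Measure.map_apply mf hs,
    withDensity_apply _ (mt hs), withDensity_apply _ (mf hs), ← hA _ (mt hs), ← hF _ (mf hs),
    ← measure_union]
  · congr 1; ext ⟨x, y⟩; cases y <;> simp
  · rw [Set.disjoint_left]; rintro ⟨x, y⟩ h1 h2; simp at h1 h2; simp_all
  · exact (mf hs).prod (measurableSet_singleton _)

lemma bdd_int {Ω : Type*} [MeasurableSpace Ω] (μ : Measure Ω) [IsFiniteMeasure μ] (F : Ω → ℝ)
    (hF : Measurable F) (C : ℝ) (hC : ∀ p, |F p| ≤ C) : Integrable F μ :=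
  Integrable.of_bound hF.aestronglyMeasurable C (Filter.Eventually.of_forall hC)

lemma int_P {𝒳 : Type*} [MeasurableSpace 𝒳] (P : Measure (𝒳 × Bool)) [IsProbabilityMeasure P]
    (η : 𝒳 → ℝ) (h : IsRegFun P η) (F : 𝒳 × Bool → ℝ) (hF : Measurable F) (C : ℝ)
    (hC : ∀ p, |F p| ≤ C) :
    ∫ p, F p ∂P = ∫ x, (η x * F (x, true) + (1 - η x) * F (x, false)) ∂(P.map Prod.fst) := by
  have hd := P_decomp P η h
  obtain ⟨hm, h01, hA⟩ := h
  have mt : Measurable (fun x : 𝒳 => (x, true)) := by fun_prop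
  have mf : Measurable (fun x : 𝒳 => (x, false)) := by fun_prop
  have hpr : IsProbabilityMeasure (P.map Prod.fst) := Measure.isProbabilityMeasure_map (by fun_prop)
  have hC0 : 0 ≤ C := by
    have : Nonempty (𝒳 × Bool) := P.nonempty_of_neZero
    exact (abs_nonneg _).trans (hC (Classical.arbitrary _))
  have hi : Integrable F P := bdd_int P F hF C hC
  rw [hd] at hi
  have hi1 := hi.left_of_add_measure
  have hi2 := hi.right_of_add_measure
  generalize hμ : P.map Prod.fst = μ at *
  rw [hd, integral_add_measure hi1 hi2, integral_map mt.aemeasurable hF.aestronglyMeasurable,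
    integral_map mf.aemeasurable hF.aestronglyMeasurable,
    integral_withDensity_eq_integral_toReal_smul (by fun_prop) (by simp),
    integral_withDensity_eq_integral_toReal_smul (by fun_prop) (by simp), integral_add]
  · congr 1 <;> refine integral_congr_ae (Filter.Eventually.of_forall fun x => ?_)
    · simp [ENNReal.toReal_ofReal (h01 x).1]
    · simp [ENNReal.toReal_ofReal (sub_nonneg.2 (h01 x).2)]
  · refine bdd_int _ _ (hm.mul (hF.comp mt)) C fun x => ?_
    rw [abs_mul]
    have : |η x| ≤ 1 := abs_le.2 ⟨by linarith [(h01 x).1], (h01 x).2⟩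
    nlinarith [hC (x, true), abs_nonneg (F (x,true)), abs_nonneg (η x)]
  · refine bdd_int _ _ ((measurable_const.sub hm).mul (hF.comp mf)) C fun x => ?_
    rw [abs_mul]
    have : |1 - η x| ≤ 1 := abs_le.2 ⟨by linarith [(h01 x).2], by linarith [(h01 x).1]⟩
    nlinarith [hC (x, false), abs_nonneg (F (x,false)), abs_nonneg (1 - η x)]

lemma chern {Ω : Type*} [MeasurableSpace Ω] (P : Measure Ω) [IsProbabilityMeasure P] (n : ℕ)
    (W : Ω → ℝ) (hW : Measurable W) (hb : ∀ p, |W p| ≤ 3) (u : ℝ) (hu : 0 ≤ u) (hu1 : u ≤ 1/3)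
    (s : ℝ) :
    (Measure.pi (fun _ : Fin n => P)) {D | ∑ i, W (D i) ≤ s} ≤
      ENNReal.ofReal (Real.exp (u * s + n * (-(u * ∫ p, W p ∂P) + u^2 * ∫ p, (W p)^2 ∂P))) := by
  have h1 := ProbabilityTheory.measure_le_le_exp_mul_mgf (μ := Measure.pi (fun _ : Fin n => P))
    (X := fun D => ∑ i, W (D i)) (t := -u) s (by linarith) (by
      refine bdd_int _ _ (by fun_prop) (Real.exp (n * 1)) fun D => ?_
      rw [abs_of_pos (Real.exp_pos _), Real.exp_le_exp, Finset.mul_sum]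
      calc ∑ i, -u * W (D i) ≤ ∑ i : Fin n, (1:ℝ) := by
            refine Finset.sum_le_sum fun i _ => ?_
            have := abs_le.1 (hb (D i))
            nlinarith
        _ = n * 1 := by simp)
  have hWi : Integrable W P := bdd_int _ _ hW 3 hb
  have hW2i : Integrable (fun p => (W p)^2) P := bdd_int _ _ (hW.pow_const 2) 9 fun p => by
    rw [abs_of_nonneg (sq_nonneg _), ← sq_abs]; nlinarith [hb p, abs_nonneg (W p)]
  have h2 : ProbabilityTheory.mgf (fun D : Fin n → Ω => ∑ i, W (D i))
      (Measure.pi (fun _ : Fin n => P)) (-u) = (∫ p, Real.exp (-u * W p) ∂P) ^ n := by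
    unfold ProbabilityTheory.mgf
    simp_rw [Finset.mul_sum, Real.exp_sum]
    rw [integral_fintype_prod_eq_prod (f := fun _ p => Real.exp (-u * W p))]
    simp
  have h3 : ∫ p, Real.exp (-u * W p) ∂P ≤
      Real.exp (-(u * ∫ p, W p ∂P) + u^2 * ∫ p, (W p)^2 ∂P) := by
    calc ∫ p, Real.exp (-u * W p) ∂P ≤ ∫ p, (1 + (-u * W p + u^2 * (W p)^2)) ∂P := by
          refine integral_mono (bdd_int _ _ (by fun_prop) (Real.exp 1) fun p => ?_) ?_ fun p => ?_
          · rw [abs_of_pos (Real.exp_pos _), Real.exp_le_exp]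
            have := abs_le.1 (hb p)
            nlinarith
          · exact (integrable_const _).add ((hWi.const_mul _).add (hW2i.const_mul _))
          · have h4 : |-u * W p| ≤ 1 := by
              rw [abs_mul, abs_neg, abs_of_nonneg hu]; nlinarith [hb p, abs_nonneg (W p)]
            have := (abs_le.1 (Real.abs_exp_sub_one_sub_id_le h4)).2
            simp only
            nlinarith
      _ = 1 + (-(u * ∫ p, W p ∂P) + u^2 * ∫ p, (W p)^2 ∂P) := by
          have hs : Integrable (fun p => -u * W p + u^2 * (W p)^2) P :=
            (hWi.const_mul _).add (hW2i.const_mul _)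
          rw [integral_add (integrable_const _) hs,
            integral_add (hWi.const_mul _) (hW2i.const_mul _), integral_const_mul, integral_const_mul]
          simp
      _ ≤ _ := by rw [add_comm]; exact Real.add_one_le_exp _
  have h5 : 0 ≤ ∫ p, Real.exp (-u * W p) ∂P := integral_nonneg fun p => (Real.exp_pos _).le
  rw [← ofReal_measureReal]
  refine ENNReal.ofReal_le_ofReal (h1.trans ?_)
  rw [h2, Real.exp_add, Real.exp_nat_mul]
  simp only [neg_neg]
  gcongr

lemma meas_tern (τ : ℝ) : Measurable (tern τ) := by
  unfold tern
  refine Measurable.ite measurableSet_Ioi measurable_const ?_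
  exact Measurable.ite measurableSet_Iio measurable_const measurable_const

lemma meas_tloss {𝒳 : Type*} [MeasurableSpace 𝒳] (τ : ℝ) (g : 𝒳 → ℝ) (hg : Measurable g) :
    Measurable (tloss τ g) := by
  unfold tloss
  have h1 := meas_tern τ
  have h2 : Measurable sgB := measurable_of_finite _
  fun_prop

lemma tern_cases (τ G : ℝ) : tern τ G = 1 ∨ tern τ G = 0 ∨ tern τ G = -1 := by
  unfold tern; split_ifs <;> simp

lemma tloss_bd {𝒳 : Type*} (τ : ℝ) (hτ : 0 < τ) (hτ1 : τ ≤ 1) (g g' : 𝒳 → ℝ) (p : 𝒳 × Bool) :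
    |tloss τ g p - tloss τ g' p| ≤ 3 := by
  unfold tloss sgB
  rw [abs_le]
  rcases tern_cases τ (2 * g p.1 - 1) with h | h | h <;>
  rcases tern_cases τ (2 * g' p.1 - 1) with h' | h' | h' <;> rw [h, h'] <;> split_ifs <;>
    norm_num <;> (try constructor) <;> linarith

/-- All means in one package. -/
lemma means {𝒳 : Type*} [MeasurableSpace 𝒳] (P : Measure (𝒳 × Bool)) [IsProbabilityMeasure P]
    (η : 𝒳 → ℝ) (h : IsRegFun P η) (τ : ℝ) (hτ : 0 < τ) (hτ1 : τ ≤ 1) (g gb : 𝒳 → ℝ)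
    (hg : Measurable g) (hgb : Measurable gb) (hcl : ∀ x, |gb x - η x| ≤ τ / 4) (Λ : ℝ)
    (hΛ : τ * (P.map Prod.fst {x | 0 < |η x - 1/2| ∧ |η x - 1/2| ≤ τ}).toReal ≤ Λ) :
    (-Λ ≤ ∫ p, (tloss τ g p - tloss τ gb p) ∂P) ∧
    (∫ p, (tloss τ g p - tloss τ gb p)^2 ∂P ≤
      18 / τ * (∫ p, (tloss τ g p - tloss τ gb p) ∂P + Λ)) ∧
    (risk P (bayes g) - risk P (bayes η) ≤ 2 * ∫ p, (tloss τ g p - tloss τ gb p) ∂P + 4 * Λ) := by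
  have hpr : IsProbabilityMeasure (P.map Prod.fst) := Measure.isProbabilityMeasure_map (by fun_prop)
  have hηm := h.1
  have h01 := h.2.1
  set S : Set 𝒳 := {x | 0 < |η x - 1/2| ∧ |η x - 1/2| ≤ τ} with hS
  have hSm : MeasurableSet S := by
    have : Measurable fun x => |η x - 1/2| := by fun_prop
    exact (measurableSet_lt measurable_const this).inter (measurableSet_le this measurable_const)
  have hml := meas_tloss τ g hg
  have hmb := meas_tloss τ gb hgb
  have hbd := tloss_bd τ hτ hτ1 g gb
  have hWm : Measurable fun p => tloss τ g p - tloss τ gb p := hml.sub hmb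
  set I : 𝒳 → ℝ := S.indicator 1 with hI
  have hIm : Measurable I := measurable_one.indicator hSm
  have hI0 : ∀ x, 0 ≤ I x := fun x => Set.indicator_nonneg (fun _ _ => zero_le_one) x
  have hIi : Integrable I (P.map Prod.fst) := (integrable_const (1:ℝ)).indicator hSm
  have hIint : ∫ x, I x ∂(P.map Prod.fst) = (P.map Prod.fst S).toReal := by
    rw [hI, integral_indicator_one hSm]; rfl
  have hI1 : ∀ x, 0 < |2 * η x - 1| → |2 * η x - 1| ≤ 2 * τ → I x = 1 := by
    intro x h1 h2
    have e : |2 * η x - 1| = 2 * |η x - 1/2| := by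
      rw [show 2 * η x - 1 = 2 * (η x - 1/2) by ring, abs_mul]; simp
    rw [e] at h1 h2
    exact Set.indicator_of_mem (show x ∈ S from ⟨by linarith, by linarith⟩) _
  have hcl' : ∀ x, |(2 * gb x - 1) - (2 * η x - 1)| ≤ τ / 2 := by
    intro x
    rw [show (2 * gb x - 1) - (2 * η x - 1) = 2 * (gb x - η x) by ring, abs_mul]
    have := hcl x
    simp; linarith
  set m : 𝒳 → ℝ := fun x => ml τ (2 * η x - 1) (tern τ (2 * g x - 1))
      - ml τ (2 * η x - 1) (tern τ (2 * gb x - 1)) with hm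
  have key : ∫ p, (tloss τ g p - tloss τ gb p) ∂P = ∫ x, m x ∂(P.map Prod.fst) := by
    rw [int_P P η h _ hWm 3 hbd]
    congr 1; ext x
    simp only [tloss, sgB, hm, ml]; simp; ring
  have hmm : Measurable m := by
    have := meas_tern τ
    simp only [hm, ml]; fun_prop
  have hmi : Integrable m (P.map Prod.fst) := by
    refine bdd_int _ _ hmm 4 fun x => ?_
    simp only [hm, ml]
    have := h01 x
    rw [abs_le]
    rcases tern_cases τ (2 * g x - 1) with h | h | h <;>
    rcases tern_cases τ (2 * gb x - 1) with h' | h' | h' <;> rw [h, h'] <;>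
      norm_num <;> (try constructor) <;> linarith [this.1, this.2]
  have hsum : ∫ x, (m x + τ * I x) ∂(P.map Prod.fst) ≤
      ∫ p, (tloss τ g p - tloss τ gb p) ∂P + Λ := by
    rw [integral_add hmi (hIi.const_mul _), integral_const_mul, hIint, key]; linarith
  have hsi : Integrable (fun x => m x + τ * I x) (P.map Prod.fst) := hmi.add (hIi.const_mul _)
  have pw := fun x => pw1 τ (2 * η x - 1) (2 * g x - 1) (2 * gb x - 1) (I x) hτ (hcl' x) (hI0 x) (hI1 x)
  refine ⟨?_, ?_, ?_⟩
  · have : 0 ≤ ∫ x, (m x + τ * I x) ∂(P.map Prod.fst) := integral_nonneg fun x => (pw x).1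
    linarith
  · refine le_trans ?_ (mul_le_mul_of_nonneg_left hsum (by positivity))
    have b9 : ∀ p, |(tloss τ g p - tloss τ gb p)^2| ≤ 9 := fun p => by
      rw [abs_of_nonneg (sq_nonneg _), ← sq_abs]
      nlinarith [hbd p, abs_nonneg (tloss τ g p - tloss τ gb p)]
    rw [int_P P η h _ (hWm.pow_const 2) 9 b9, ← integral_const_mul]
    refine integral_mono_of_nonneg (Filter.Eventually.of_forall fun x => ?_)
      (hsi.const_mul _) (Filter.Eventually.of_forall fun x => ?_)
    · have := h01 x
      have h1 := this.1
      have h2 := sub_nonneg.2 this.2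
      simp only [Pi.zero_apply]; positivity
    · have := pwV τ (η x) _ _ hτ hτ1 (h01 x) (m x + τ * I x) (tern_cases τ (2 * g x - 1))
        (tern_cases τ (2 * gb x - 1)) (pw x).1 (pw x).2
      simpa [tloss, sgB] using this
  · have hrisk : ∀ q : 𝒳 → ℝ, Measurable q → risk P (bayes q) =
        ∫ x, (if decide ((1:ℝ)/2 ≤ q x) then 1 - η x else η x) ∂(P.map Prod.fst) := by
      intro q hq
      have hbm : Measurable (bayes q) := by
        unfold bayes
        refine measurable_to_bool ?_
        have : (fun x => decide ((1:ℝ)/2 ≤ q x)) ⁻¹' {true} = {x | (1:ℝ)/2 ≤ q x} := by ext; simp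
        rw [this]
        exact measurableSet_le measurable_const hq
      have hsm : MeasurableSet {p : 𝒳 × Bool | p.2 ≠ bayes q p.1} :=
        (measurableSet_eq_fun measurable_snd (hbm.comp measurable_fst)).compl
      have e1 : risk P (bayes q) =
          ∫ p, ({p : 𝒳 × Bool | p.2 ≠ bayes q p.1}.indicator 1 : 𝒳 × Bool → ℝ) p ∂P := by
        rw [integral_indicator_one hsm]; rfl
      rw [e1, int_P P η h _ (measurable_one.indicator hsm) 1]
      · congr 1; ext x
        simp only [Set.indicator, bayes]
        simp
        split_ifs <;> linarith
      · intro p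
        by_cases hp : p ∈ {p : 𝒳 × Bool | p.2 ≠ bayes q p.1} <;> simp [Set.indicator] <;> split_ifs <;> simp
    have hri : ∀ q : 𝒳 → ℝ, Measurable q → Integrable (fun x =>
        (if decide ((1:ℝ)/2 ≤ q x) then 1 - η x else η x)) (P.map Prod.fst) := by
      intro q hq
      refine bdd_int _ _ ?_ 1 fun x => ?_
      · simp only [decide_eq_true_eq]
        exact Measurable.ite (measurableSet_le measurable_const hq) (by fun_prop) hηm
      · have := h01 x
        rw [abs_le]
        split_ifs <;> constructor <;> linarith [this.1, this.2]
    rw [hrisk g hg, hrisk η hηm, ← integral_sub (hri g hg) (hri η hηm)]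
    have : ∫ x, (2 * m x + 4 * (τ * I x)) ∂(P.map Prod.fst) ≤
        2 * ∫ p, (tloss τ g p - tloss τ gb p) ∂P + 4 * Λ := by
      rw [integral_add (hmi.const_mul _) ((hIi.const_mul _).const_mul _), integral_const_mul,
        integral_const_mul, integral_const_mul, hIint, key]
      linarith
    refine le_trans (integral_mono ((hri g hg).sub (hri η hηm))
      ((hmi.const_mul _).add ((hIi.const_mul _).const_mul _)) fun x => ?_) this
    exact pw2 τ (η x) (g x) (2 * gb x - 1) (I x) hτ (hcl' x) (hI0 x) (hI1 x)

lemma level1 {𝒳 : Type*} [MeasurableSpace 𝒳] (P : Measure (𝒳 × Bool)) [IsProbabilityMeasure P]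
    (η : 𝒳 → ℝ) (h : IsRegFun P η) (τ : ℝ) (hτ : 0 < τ) (hτ1 : τ ≤ 1) (g gb : 𝒳 → ℝ)
    (hg : Measurable g) (hgb : Measurable gb) (hcl : ∀ x, |gb x - η x| ≤ τ / 4) (Λ : ℝ)
    (hΛ : τ * (P.map Prod.fst {x | 0 < |η x - 1/2| ∧ |η x - 1/2| ≤ τ}).toReal ≤ Λ) (n : ℕ) :
    Measure.pi (fun _ : Fin n => P) {D | ∑ i, (tloss τ g (D i) - tloss τ gb (D i)) ≤
        n * ((∫ p, (tloss τ g p - tloss τ gb p) ∂P) / 2 - Λ)} ≤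
      ENNReal.ofReal (Real.exp (-(n * τ * Λ / 144))) := by
  obtain ⟨h1, h2, -⟩ := means P η h τ hτ hτ1 g gb hg hgb hcl Λ hΛ
  refine (chern P n (fun p => tloss τ g p - tloss τ gb p)
    ((meas_tloss τ g hg).sub (meas_tloss τ gb hgb)) (tloss_bd τ hτ hτ1 g gb) (τ / 72)
    (by positivity) (by linarith) _).trans (ENNReal.ofReal_le_ofReal (Real.exp_le_exp.2 ?_))
  set M := ∫ p, (tloss τ g p - tloss τ gb p) ∂P
  set V := ∫ p, (tloss τ g p - tloss τ gb p)^2 ∂P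
  have h3 : (τ/72)^2 * V ≤ τ / 72 * ((M + Λ) / 4) := by
    refine (mul_le_mul_of_nonneg_left h2 (by positivity)).trans (le_of_eq ?_)
    field_simp; ring
  have hn : (0:ℝ) ≤ n := Nat.cast_nonneg n
  have h4 : τ / 72 * (M / 2 - Λ) + (-(τ / 72 * M) + (τ/72)^2 * V) ≤ -(τ * Λ / 144) := by
    nlinarith [mul_nonneg hτ.le (by linarith : 0 ≤ M + Λ)]
  have := mul_le_mul_of_nonneg_left h4 hn
  linarith

lemma level {𝒳 : Type*} [MeasurableSpace 𝒳] (P : Measure (𝒳 × Bool)) [IsProbabilityMeasure P]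
    (η : 𝒳 → ℝ) (h : IsRegFun P η) (τ : ℝ) (hτ : 0 < τ) (hτ1 : τ ≤ 1) (T : Finset (𝒳 → ℝ))
    (hT : ∀ g ∈ T, Measurable g) (gb : 𝒳 → ℝ)
    (hgb : Measurable gb) (hcl : ∀ x, |gb x - η x| ≤ τ / 4) (Λ : ℝ)
    (hΛ : τ * (P.map Prod.fst {x | 0 < |η x - 1/2| ∧ |η x - 1/2| ≤ τ}).toReal ≤ Λ) (n : ℕ)
    (a : ℝ) (hcard : (T.card : ℝ) ≤ Real.exp a) (ha : 2 * a ≤ n * τ * Λ / 144) :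
    Measure.pi (fun _ : Fin n => P) {D | ∃ g ∈ T, ∑ i, (tloss τ g (D i) - tloss τ gb (D i)) ≤
        n * ((∫ p, (tloss τ g p - tloss τ gb p) ∂P) / 2 - Λ)} ≤
      ENNReal.ofReal (Real.exp (-(n * τ * Λ / 288))) := by
  have e : {D : Fin n → 𝒳 × Bool | ∃ g ∈ T, ∑ i, (tloss τ g (D i) - tloss τ gb (D i)) ≤
        n * ((∫ p, (tloss τ g p - tloss τ gb p) ∂P) / 2 - Λ)} =
      ⋃ g ∈ T, {D | ∑ i, (tloss τ g (D i) - tloss τ gb (D i)) ≤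
        n * ((∫ p, (tloss τ g p - tloss τ gb p) ∂P) / 2 - Λ)} := by ext; simp
  rw [e]
  refine (measure_biUnion_finset_le _ _).trans ?_
  refine (Finset.sum_le_sum fun g hg => level1 P η h τ hτ hτ1 g gb (hT g hg) hgb hcl Λ hΛ n).trans ?_
  rw [Finset.sum_const, nsmul_eq_mul, ← ENNReal.ofReal_natCast, ← ENNReal.ofReal_mul (by positivity)]
  refine ENNReal.ofReal_le_ofReal ?_
  calc (T.card : ℝ) * Real.exp (-(n * τ * Λ / 144))
      ≤ Real.exp a * Real.exp (-(n * τ * Λ / 144)) := by gcongr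
    _ ≤ _ := by rw [← Real.exp_add, Real.exp_le_exp]; linarith

def Sel {𝒳 : Type*} (n : ℕ) (T : Finset (𝒳 → ℝ)) (τ Λ : ℝ) (D : Fin n → 𝒳 × Bool) (g : 𝒳 → ℝ) : Prop :=
  ∀ g' ∈ T, ∑ i, tloss τ g (D i) ≤ ∑ i, tloss τ g' (D i) + n * (3 / 2 * Λ)

lemma sel_exists {𝒳 : Type*} (n : ℕ) (T : Finset (𝒳 → ℝ)) (τ Λ : ℕ → ℝ) (D : Fin n → 𝒳 × Bool) :
    ∃ g : 𝒳 → ℝ, ∀ j : ℕ, (∃ g' ∈ T, ∀ i, j ≤ i → τ i < 1 → Sel n T (τ i) (Λ i) D g') →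
      g ∈ T ∧ ∀ i, j ≤ i → τ i < 1 → Sel n T (τ i) (Λ i) D g := by
  classical
  by_cases h : ∃ j : ℕ, ∃ g' ∈ T, ∀ i, j ≤ i → τ i < 1 → Sel n T (τ i) (Λ i) D g'
  · obtain ⟨g, hg, hg2⟩ := Nat.find_spec h
    refine ⟨g, fun j hj => ⟨hg, fun i hi => hg2 i ((Nat.find_min' h hj).trans hi)⟩⟩
  · exact ⟨fun _ => 0, fun j hj => absurd ⟨j, hj⟩ h⟩

lemma sub_bad {𝒳 : Type*} [MeasurableSpace 𝒳] (P : Measure (𝒳 × Bool)) [IsProbabilityMeasure P]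
    (η : 𝒳 → ℝ) (h : IsRegFun P η) (n : ℕ) (hn : 0 < n) (T : Finset (𝒳 → ℝ))
    (hT : ∀ g ∈ T, Measurable g) (gb : 𝒳 → ℝ) (hgb : gb ∈ T) (τ Λ : ℕ → ℝ)
    (hτ : ∀ i, 0 < τ i) (hcl : ∀ i x, |gb x - η x| ≤ τ i / 4)
    (hΛ : ∀ i, τ i < 1 →
      τ i * (P.map Prod.fst {x | 0 < |η x - 1/2| ∧ |η x - 1/2| ≤ τ i}).toReal ≤ Λ i)
    (D : Fin n → 𝒳 × Bool) (g : 𝒳 → ℝ) (j : ℕ) (hj1 : τ j < 1)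
    (hsel : (∃ g' ∈ T, ∀ i, j ≤ i → τ i < 1 → Sel n T (τ i) (Λ i) D g') →
      g ∈ T ∧ ∀ i, j ≤ i → τ i < 1 → Sel n T (τ i) (Λ i) D g)
    (hD : ∀ i, j ≤ i → τ i < 1 → ∀ g ∈ T,
      n * ((∫ p, (tloss (τ i) g p - tloss (τ i) gb p) ∂P) / 2 - Λ i) <
      ∑ k, (tloss (τ i) g (D k) - tloss (τ i) gb (D k))) :
    risk P (bayes g) - risk P (bayes η) ≤ 14 * Λ j := by
  have hn' : (0:ℝ) < n := by exact_mod_cast hn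
  obtain ⟨hgT, hS⟩ := hsel ⟨gb, hgb, fun i hi hi1 g' hg' => by
    have h1 := hD i hi hi1 g' hg'
    obtain ⟨h2, -, -⟩ := means P η h (τ i) (hτ i) hi1.le g' gb (hT _ hg') (hT _ hgb) (hcl i) (Λ i) (hΛ i hi1)
    rw [Finset.sum_sub_distrib] at h1
    have := mul_le_mul_of_nonneg_left h2 hn'.le
    linarith⟩
  obtain ⟨-, -, h3⟩ := means P η h (τ j) (hτ j) hj1.le g gb (hT _ hgT) (hT _ hgb) (hcl j) (Λ j) (hΛ j hj1)
  have h1 := hD j le_rfl hj1 g hgT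
  have h4 := hS j le_rfl hj1 gb hgb
  rw [Finset.sum_sub_distrib] at h1
  have h5 : n * ((∫ p, (tloss (τ j) g p - tloss (τ j) gb p) ∂P) / 2 - Λ j) < n * (3 / 2 * Λ j) := by
    linarith
  have h6 := lt_of_mul_lt_mul_left h5 hn'.le
  linarith

lemma tail_sum {Ω : Type*} [MeasurableSpace Ω] (μ : Measure Ω) (Bd : ℕ → Set Ω) (a : ℝ) (ha : 1 ≤ a)
    (hB : ∀ k : ℕ, μ (Bd k) ≤ ENNReal.ofReal (Real.exp (-((1 + k) * a)))) :
    μ (⋃ k, Bd k) ≤ ENNReal.ofReal (2 * Real.exp (-a)) := by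
  refine (measure_iUnion_le _).trans ?_
  have hs : HasSum (fun k : ℕ => (1/2:ℝ)^k * Real.exp (-a)) (2 * Real.exp (-a)) :=
    hasSum_geometric_two.mul_right _
  rw [← hs.tsum_eq, ENNReal.ofReal_tsum_of_nonneg (fun k => by positivity) hs.summable]
  refine ENNReal.tsum_le_tsum fun k => (hB k).trans (ENNReal.ofReal_le_ofReal ?_)
  have h1 : Real.exp (-a) ≤ 1/2 := by
    have : Real.exp (-a) ≤ Real.exp (-1) := Real.exp_le_exp.2 (by linarith)
    linarith [Real.exp_neg_one_lt_half]
  calc Real.exp (-((1 + k) * a)) = Real.exp (-a) ^ k * Real.exp (-a) := by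
        rw [← Real.exp_nat_mul, ← Real.exp_add]; ring_nf
    _ ≤ _ := by gcongr

lemma supD {𝒳 : Type*} (g g' : 𝒳 → ℝ) (hg : ∀ x, g x ∈ Icc (0:ℝ) 1) (hg' : ∀ x, g' x ∈ Icc (0:ℝ) 1)
    (ε : ℝ) (h : supDist g g' ≤ ε) (x : 𝒳) : |g' x - g x| ≤ ε := by
  rw [abs_sub_comm]
  refine le_trans (le_ciSup (f := fun x => |g x - g' x|) ⟨1, ?_⟩ x) h
  rintro _ ⟨y, rfl⟩
  rw [abs_le]
  constructor <;> linarith [(hg y).1, (hg y).2, (hg' y).1, (hg' y).2]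

/-- Corollary to Theorem 3.1: there exist `d, c > 0` depending only on `r, α, C_M, B` such
that, with `λₙ = d n^{-(1+α)/(2+α+r)}`, the minimax accuracy confidence function satisfies
`AC_n(𝓜(r,α), λ) = inf_{f̂ₙ} sup_{P ∈ 𝓜(r,α)} ℙ(R(f̂ₙ) - R* ≥ λ) ≤ 2 exp(-c n λ^{(2+α)/(1+α)})`
for all `λ ≥ λₙ`; i.e. there is a single classifier `f̂ₙ` whose accuracy confidence function is
bounded by `2 exp(-c n λ^{(2+α)/(1+α)})` simultaneously over all `P` in the class. -/
theorem statement9 (r α Cm B : ℝ) (hr : 0 < r) (hα : 0 < α) (hCm : 0 < Cm) (hB : 0 < B) :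
    ∃ d : ℝ, 0 < d ∧ ∃ c : ℝ, 0 < c ∧
    ∀ (𝒳 : Type u) [MeasurableSpace 𝒳] (U : Set (𝒳 → ℝ)),
      (∀ g ∈ U, Measurable g ∧ ∀ x, g x ∈ Icc (0:ℝ) 1) →
      -- the ε-entropy bound 𝓗(ε, 𝓤, ‖·‖_∞) ≤ B ε^{-r} for all ε > 0
      (∀ ε : ℝ, 0 < ε → ∃ T : Finset (𝒳 → ℝ), ↑T ⊆ U ∧
        (∀ g ∈ U, ∃ g' ∈ T, supDist g g' ≤ ε) ∧
        (T.card : ℝ) ≤ Real.exp (B * ε ^ (-r))) →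
      ∀ n : ℕ, 0 < n →
      ∃ fhat : (Fin n → 𝒳 × Bool) → 𝒳 → Bool,
      ∀ (P : Measure (𝒳 × Bool)) [IsProbabilityMeasure P] (η : 𝒳 → ℝ),
        IsRegFun P η → η ∈ U → MarginCond (P.map Prod.fst) η α Cm →
      ∀ lam : ℝ, d * (n : ℝ) ^ (-((1 + α) / (2 + α + r))) ≤ lam →
        Measure.pi (fun _ : Fin n => P)
            {D | lam ≤ risk P (fhat D) - risk P (bayes η)}
          ≤ ENNReal.ofReal (2 * Real.exp (-(c * n * lam ^ ((2 + α) / (1 + α))))) := by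
  set K : ℝ := 14 * Cm + 1 with hK
  set b : ℝ := 4 + 288 * (B + 1) / Cm with hb
  have hKpos : 0 < K := by positivity
  have hbq : 0 < 288 * (B + 1) / Cm := by positivity
  have hb4 : 4 ≤ b := by linarith
  have hbpos : 0 < b := by linarith
  refine ⟨K * b ^ (1 + α), by positivity,
    Cm / 288 / (2 * K ^ (1 / (1 + α))) ^ (2 + α), by positivity, ?_⟩
  intro 𝒳 _ U hU hent n hn
  have hn' : (0:ℝ) < n := by exact_mod_cast hn
  have hn1 : (1:ℝ) ≤ n := by exact_mod_cast hn
  have hθ : 0 < 2 + α + r := by positivity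
  set ν : ℝ := (n:ℝ) ^ (-(1 / (2 + α + r))) with hν
  have hνpos : 0 < ν := by positivity
  have hν1 : ν ≤ 1 := Real.rpow_le_one_of_one_le_of_nonpos hn1 (by
    have : 0 < 1 / (2 + α + r) := by positivity
    linarith)
  have hνn : n * ν ^ (2 + α) = ν ^ (-r) := by
    have : (n:ℝ) = ν ^ (-(2 + α + r)) := by
      rw [hν, ← Real.rpow_mul hn'.le]
      rw [show -(1 / (2 + α + r)) * -(2 + α + r) = 1 by field_simp]; simp
    conv_lhs => rw [this]
    rw [← Real.rpow_add hνpos]; congr 1; ring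
  have hνr : 1 ≤ ν ^ (-r) := Real.one_le_rpow_of_pos_of_le_one_of_nonpos hνpos hν1 (by linarith)
  obtain ⟨T, hTU, hTnet, hTcard⟩ := hent ν hνpos
  set τ : ℕ → ℝ := fun i => 2 ^ i * (b * ν) with hτd
  set Λ : ℕ → ℝ := fun i => Cm * τ i ^ (1 + α) with hΛd
  have hτpos : ∀ i, 0 < τ i := fun i => by simp only [hτd]; positivity
  have hτge : ∀ i, b * ν ≤ τ i := fun i => by
    have : (1:ℝ) ≤ 2 ^ i := one_le_pow₀ (by norm_num)
    have h2 : 0 < b * ν := by positivity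
    simp only [hτd]; nlinarith
  have hτΛ : ∀ i, τ i * Λ i = Cm * τ i ^ (2 + α) := fun i => by
    simp only [hΛd]
    have e : τ i ^ (2 + α) = τ i * τ i ^ (1 + α) := by
      rw [show 2 + α = 1 + (1 + α) by ring, Real.rpow_add (hτpos i) 1 (1 + α), Real.rpow_one]
    rw [e]; ring
  have ha0 : ∀ i, (B + 1) * ν ^ (-r) ≤ n * τ i * Λ i / 288 := fun i => by
    have h1 : (b * ν) ^ (2 + α) ≤ τ i ^ (2 + α) :=
      Real.rpow_le_rpow (by positivity) (hτge i) (by positivity)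
    have h2 : b ≤ b ^ (2 + α) := by
      conv_lhs => rw [← Real.rpow_one b]
      exact Real.rpow_le_rpow_of_exponent_le (by linarith) (by linarith)
    have h3 : 288 * (B + 1) ≤ Cm * b ^ (2 + α) := by
      calc 288 * (B + 1) = Cm * (288 * (B + 1) / Cm) := by field_simp
        _ ≤ Cm * b ^ (2 + α) := by gcongr; linarith
    rw [mul_assoc, hτΛ, ← hνn]
    rw [Real.mul_rpow hbpos.le hνpos.le] at h1
    calc (B + 1) * (n * ν ^ (2 + α)) = (288 * (B + 1)) * (n * ν ^ (2 + α)) / 288 := by ring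
      _ ≤ (Cm * b ^ (2 + α)) * (n * ν ^ (2 + α)) / 288 := by gcongr
      _ = n * (Cm * (b ^ (2 + α) * ν ^ (2 + α))) / 288 := by ring
      _ ≤ _ := by gcongr
  choose sel hsel using sel_exists n T τ Λ
  refine ⟨fun D => bayes (sel D), ?_⟩
  intro P _ η hη hηU hmar lam hlam
  obtain ⟨gb, hgbT, hgb⟩ := hTnet η hηU
  have hgb' : ∀ x, |gb x - η x| ≤ ν := supD η gb (hU η hηU).2 (hU gb (hTU hgbT)).2 ν hgb
  have hcl : ∀ i x, |gb x - η x| ≤ τ i / 4 := fun i x => by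
    have := hτge i
    have := hgb' x
    nlinarith
  have hTm : ∀ g ∈ T, Measurable g := fun g hg => (hU g (hTU hg)).1
  have hΛm : ∀ i, τ i < 1 →
      τ i * (P.map Prod.fst {x | 0 < |η x - 1/2| ∧ |η x - 1/2| ≤ τ i}).toReal ≤ Λ i := fun i hi => by
    have := mul_le_mul_of_nonneg_left (hmar (τ i) (hτpos i).le hi) (hτpos i).le
    refine this.trans (le_of_eq ?_)
    simp only [hΛd]
    rw [Real.rpow_add (hτpos i), Real.rpow_one]; ring
  by_cases hl1 : 1 < lam
  · have : {D : Fin n → 𝒳 × Bool | lam ≤ risk P (bayes (sel D)) - risk P (bayes η)} = ∅ := by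
      ext D
      simp only [mem_ofPred_eq, mem_empty_iff_false, iff_false, not_le]
      have h1 : risk P (bayes (sel D)) ≤ 1 := measureReal_le_one
      have h2 : 0 ≤ risk P (bayes η) := ENNReal.toReal_nonneg
      linarith
    rw [this]; simp
  push Not at hl1
  have hlpos : 0 < lam := lt_of_lt_of_le (by positivity) hlam
  set t : ℝ := (lam / K) ^ (1 / (1 + α)) with ht
  have htpos : 0 < t := by positivity
  have hα1 : 0 < 1 + α := by positivity
  have hK1 : 1 < K := by rw [hK]; linarith
  have htα : t ^ (1 + α) = lam / K := by
    rw [ht, ← Real.rpow_mul (by positivity), one_div_mul_cancel hα1.ne', Real.rpow_one]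
  have ht1 : t < 1 := by
    refine Real.rpow_lt_one (by positivity) ?_ (by positivity)
    rw [div_lt_one hKpos]; linarith
  have ht0 : b * ν ≤ t := by
    have h1 : (b * ν) ^ (1 + α) ≤ lam / K := by
      rw [le_div_iff₀ hKpos, Real.mul_rpow hbpos.le hνpos.le]
      refine le_trans (le_of_eq ?_) hlam
      rw [hν, ← Real.rpow_mul hn'.le]
      rw [show -(1 / (2 + α + r)) * (1 + α) = -((1 + α) / (2 + α + r)) by ring]; ring
    rw [← htα] at h1
    exact (Real.rpow_le_rpow_iff (by positivity) htpos.le hα1).1 h1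
  obtain ⟨j, hj1, hj2⟩ := exists_nat_pow_near (x := t / (b * ν)) (y := 2)
    ((one_le_div (by positivity)).2 ht0) (by norm_num)
  rw [le_div_iff₀ (by positivity)] at hj1
  rw [div_lt_iff₀ (by positivity), pow_succ] at hj2
  have hj1' : τ j ≤ t := hj1
  have hj2' : t ≤ 2 * τ j := by simp only [hτd]; linarith
  have hτj1 : τ j < 1 := by linarith
  set Bd : ℕ → Set (Fin n → 𝒳 × Bool) := fun k => {D | τ (j + k) < 1 ∧ ∃ g ∈ T,
    ∑ i, (tloss (τ (j + k)) g (D i) - tloss (τ (j + k)) gb (D i)) ≤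
      n * ((∫ p, (tloss (τ (j + k)) g p - tloss (τ (j + k)) gb p) ∂P) / 2 - Λ (j + k))} with hBd
  have hsub : {D : Fin n → 𝒳 × Bool | lam ≤ risk P (bayes (sel D)) - risk P (bayes η)} ⊆
      ⋃ k, Bd k := by
    intro D hD
    by_contra hno
    have h14 := sub_bad P η hη n hn T hTm gb hgbT τ Λ hτpos hcl hΛm D (sel D) j hτj1 (hsel D j) (by
      intro i hi hi1 g hg
      by_contra hcon
      refine hno (mem_iUnion.2 ⟨i - j, ?_⟩)
      simp only [hBd, mem_ofPred_eq]
      rw [Nat.add_sub_cancel' hi]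
      exact ⟨hi1, g, hg, not_lt.1 hcon⟩)
    have h1 : τ j ^ (1 + α) ≤ lam / K := by
      rw [← htα]; exact Real.rpow_le_rpow (hτpos j).le hj1' hα1.le
    have h2 : 14 * Λ j < lam := by
      calc 14 * Λ j = 14 * Cm * τ j ^ (1 + α) := by simp only [hΛd]; ring
        _ ≤ 14 * Cm * (lam / K) := by gcongr
        _ = lam * (14 * Cm / K) := by ring
        _ < lam * 1 := by
            refine mul_lt_mul_of_pos_left ?_ hlpos
            rw [div_lt_one hKpos]; linarith
        _ = lam := mul_one _
    have hD' : lam ≤ risk P (bayes (sel D)) - risk P (bayes η) := hD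
    linarith
  have haj : 1 ≤ n * τ j * Λ j / 288 := by
    have := ha0 j
    nlinarith
  refine (measure_mono hsub).trans ((tail_sum _ Bd (n * τ j * Λ j / 288) haj ?_).trans ?_)
  · intro k
    by_cases hk : τ (j + k) < 1
    · refine (measure_mono (fun D hD => hD.2)).trans
        ((level P η hη (τ (j + k)) (hτpos _) hk.le T hTm gb (hTm _ hgbT) (hcl _) (Λ (j + k))
          (hΛm _ hk) n (B * ν ^ (-r)) hTcard ?_).trans (ENNReal.ofReal_le_ofReal
            (Real.exp_le_exp.2 (neg_le_neg ?_))))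
      · have := ha0 (j + k)
        linarith
      · have e : τ (j + k) = 2 ^ k * τ j := by simp only [hτd]; ring
        rw [mul_assoc (n:ℝ) (τ j) (Λ j), mul_assoc (n:ℝ) (τ (j + k)) (Λ (j + k)), hτΛ, hτΛ, e, Real.mul_rpow (by positivity) (hτpos j).le]
        have h1 : (1 + k : ℝ) ≤ ((2:ℝ) ^ k) ^ (2 + α) := by
          have h3 : (1:ℝ) ≤ 2 ^ k := one_le_pow₀ (by norm_num)
          have h4 : (1 + k : ℝ) ≤ 2 ^ k := by
            have := Nat.lt_two_pow_self (n := k)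
            have : k + 1 ≤ 2 ^ k := this
            have : ((k + 1 : ℕ) : ℝ) ≤ ((2 ^ k : ℕ) : ℝ) := by exact_mod_cast this
            push_cast at this
            linarith
          refine h4.trans ?_
          conv_lhs => rw [← Real.rpow_one ((2:ℝ) ^ k)]
          exact Real.rpow_le_rpow_of_exponent_le h3 (by linarith)
        have h5 : 0 ≤ n * (Cm * τ j ^ (2 + α)) / 288 := by
          have := hτpos j
          positivity
        have := mul_le_mul_of_nonneg_right h1 h5
        linarith
    · have : Bd k = ∅ := by
        ext D; simp only [hBd, mem_ofPred_eq, mem_empty_iff_false, iff_false]; tauto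
      rw [this]; simp
  · refine ENNReal.ofReal_le_ofReal ?_
    have hfin : Cm / 288 / (2 * K ^ (1 / (1 + α))) ^ (2 + α) * n * lam ^ ((2 + α) / (1 + α))
        ≤ n * τ j * Λ j / 288 := by
      rw [mul_assoc (n:ℝ), hτΛ]
      have e1 : lam ^ ((2 + α) / (1 + α)) = (K ^ (1 / (1 + α)) * t) ^ (2 + α) := by
        rw [ht, ← Real.mul_rpow hKpos.le (by positivity), mul_div_cancel₀ _ hKpos.ne',
          ← Real.rpow_mul hlpos.le]
        congr 1; ring
      have e2 : (K ^ (1 / (1 + α)) * t) ^ (2 + α) ≤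
          (2 * K ^ (1 / (1 + α))) ^ (2 + α) * τ j ^ (2 + α) := by
        rw [← Real.mul_rpow (by positivity) (hτpos j).le]
        refine Real.rpow_le_rpow (by positivity) ?_ (by positivity)
        have : 0 < K ^ (1 / (1 + α)) := by positivity
        nlinarith
      rw [e1]
      have hQ : 0 < (2 * K ^ (1 / (1 + α))) ^ (2 + α) := by positivity
      generalize (2 * K ^ (1 / (1 + α))) ^ (2 + α) = Q at *
      calc _ ≤ Cm / 288 / Q * n * (Q * τ j ^ (2 + α)) := by gcongr
        _ = _ := by field_simp
    have := Real.exp_le_exp.2 (neg_le_neg hfin)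
    linarith

end
end

section
/- Let (𝒳,𝒜) be a measurable space and let A_i ∈ 𝒜, i ∈ {0,1,…,M} with M ≥ 2, be pairwise disjoint sets. Let Q_0, Q_1, …, Q_M be probability measures on (𝒳,𝒜) such that (1/M)·Σ_{j=1}^M 𝓚(Q_j, Q_0) ≤ χ < ∞, where 𝓚 denotes Kullback–Leibler divergence. Then p_* := max_{0≤i≤M} Q_i(𝒳 \ A_i) ≥ (1/12)·min(1, M·e^{−3χ}). -/
open MeasureTheory Set
open scoped ENNReal

noncomputable section

open Classical in
/-- The Kullback–Leibler divergence `𝓚(μ,ν) = ∫ (dμ/dν) ln(dμ/dν) dν = ∫ ln(dμ/dν) dμ` when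
`μ ≪ ν` (and the integral is well defined), and `+∞` otherwise. -/
def klDiv {𝒳 : Type*} [MeasurableSpace 𝒳] (μ ν : Measure 𝒳) : ℝ≥0∞ :=
  if μ ≪ ν ∧ Integrable (llr μ ν) μ then ENNReal.ofReal (∫ x, llr μ ν x ∂μ) else ⊤

open Classical in
/-- The chi-square divergence `χ²(μ,ν) = ∫ (dμ/dν - 1)² dν` when `μ ≪ ν`, `+∞` otherwise. -/
def chiSqDiv {𝒳 : Type*} [MeasurableSpace 𝒳] (μ ν : Measure 𝒳) : ℝ≥0∞ :=
  if μ ≪ ν then ∫⁻ x, ENNReal.ofReal (((μ.rnDeriv ν x).toReal - 1) ^ 2) ∂ν else ⊤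

theorem kl_fy (g l : ℝ) (hg : 0 ≤ g) :
    l * g - (Real.exp l - 1) ≤ InformationTheory.klFun g := by
  unfold InformationTheory.klFun
  rcases hg.eq_or_lt with rfl | hg
  · simp; positivity
  · have h := Real.add_one_le_exp (l - Real.log g)
    rw [Real.exp_sub, Real.exp_log hg, le_div_iff₀ hg] at h
    nlinarith

theorem kl_var {𝒳 : Type*} [MeasurableSpace 𝒳] (μ ν : Measure 𝒳) [IsProbabilityMeasure μ]
    [IsProbabilityMeasure ν] (A : Set 𝒳) (hA : MeasurableSet A) (l : ℝ) (h : klDiv μ ν ≠ ⊤) :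
    l * μ.real A ≤ (klDiv μ ν).toReal + (Real.exp l - 1) * ν.real A := by
  unfold klDiv at h ⊢
  split_ifs at h ⊢ with hc
  swap
  · exact absurd rfl h
  obtain ⟨hac, hint⟩ := hc
  have e := InformationTheory.integral_klFun_rnDeriv hac hint
  simp only [probReal_univ, add_sub_cancel_right] at e
  have hk := (InformationTheory.integrable_klFun_rnDeriv_iff hac).2 hint
  have hr : Integrable (fun x => (μ.rnDeriv ν x).toReal) ν := Measure.integrable_toReal_rnDeriv
  have h1 : ∫ x in A, (l * (μ.rnDeriv ν x).toReal - (Real.exp l - 1)) ∂ν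
      ≤ ∫ x in A, InformationTheory.klFun (μ.rnDeriv ν x).toReal ∂ν :=
    integral_mono ((hr.integrableOn.const_mul l).sub (integrable_const _)) hk.integrableOn
      (fun x => kl_fy _ l ENNReal.toReal_nonneg)
  have h2 : ∫ x in A, InformationTheory.klFun (μ.rnDeriv ν x).toReal ∂ν
      ≤ ∫ x, InformationTheory.klFun (μ.rnDeriv ν x).toReal ∂ν :=
    setIntegral_le_integral hk
      (ae_of_all _ fun x => InformationTheory.klFun_nonneg ENNReal.toReal_nonneg)
  rw [integral_sub (hr.integrableOn.const_mul l) (integrable_const _), integral_const_mul,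
    Measure.setIntegral_toReal_rnDeriv hac, integral_const] at h1
  simp only [measureReal_restrict_apply_univ, smul_eq_mul] at h1
  have h3 := le_max_left (∫ x, llr μ ν x ∂μ) 0
  rw [ENNReal.toReal_ofReal']
  linarith

/-- Lemma 5.1: if `A₀, …, A_M` (`M ≥ 2`) are pairwise disjoint measurable sets and
`Q₀, …, Q_M` are probability measures with `(1/M) Σ_{j=1}^M 𝓚(Q_j, Q₀) ≤ χ < ∞`, then
`p_* = max_{0 ≤ i ≤ M} Q_i(𝒳 ∖ A_i) ≥ (1/12) min(1, M e^{-3χ})`. -/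
theorem statement12 {𝒳 : Type*} [MeasurableSpace 𝒳] (M : ℕ) (hM : 2 ≤ M)
    (A : Fin (M + 1) → Set 𝒳) (hA : ∀ i, MeasurableSet (A i))
    (hdisj : Pairwise (Function.onFun Disjoint A))
    (Q : Fin (M + 1) → Measure 𝒳) [∀ i, IsProbabilityMeasure (Q i)]
    (χ : ℝ)
    (hχ : ∑ j ∈ Finset.univ.erase (0 : Fin (M + 1)), klDiv (Q j) (Q 0)
      ≤ ENNReal.ofReal ((M : ℝ) * χ)) :
    ∃ i, ENNReal.ofReal ((1 / 12) * min 1 ((M : ℝ) * Real.exp (-(3 * χ))))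
      ≤ Q i ((A i)ᶜ) := by
  by_contra! hcon
  set p : ℝ := (1 / 12) * min 1 ((M : ℝ) * Real.exp (-(3 * χ))) with hp
  have hM' : (2 : ℝ) ≤ M := by exact_mod_cast hM
  set c : ℝ := max χ 0 with hc
  have hc0 : 0 ≤ c := le_max_right _ _
  have hcχ : χ ≤ c := le_max_left _ _
  have hp0 : 0 < p := by positivity
  have hp1 : p ≤ 1 / 12 := by
    have := min_le_left 1 ((M : ℝ) * Real.exp (-(3 * χ)))
    linarith
  have hp2 : p * Real.exp (3 * c) ≤ M / 12 := by
    rcases le_total χ 0 with h | h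
    · rw [hc, max_eq_right h]
      simp; linarith
    · rw [hc, max_eq_left h]
      have h1 := min_le_right 1 ((M : ℝ) * Real.exp (-(3 * χ)))
      have h2 : Real.exp (-(3 * χ)) * Real.exp (3 * χ) = 1 := by rw [← Real.exp_add]; simp
      have h3 : p ≤ 1 / 12 * (M * Real.exp (-(3 * χ))) := by linarith
      calc p * Real.exp (3 * χ) ≤ 1 / 12 * (M * Real.exp (-(3 * χ))) * Real.exp (3 * χ) := by
            gcongr
        _ = M / 12 * (Real.exp (-(3 * χ)) * Real.exp (3 * χ)) := by ring
        _ = M / 12 := by rw [h2, mul_one]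
  have hcon' : ∀ i, (Q i).real (A i)ᶜ < p := fun i => by
    have := (ENNReal.toReal_lt_toReal (measure_ne_top _ _) ENNReal.ofReal_ne_top).2 (hcon i)
    rwa [ENNReal.toReal_ofReal hp0.le] at this
  have htop : ∀ j ∈ Finset.univ.erase (0 : Fin (M + 1)), klDiv (Q j) (Q 0) ≠ ⊤ :=
    fun j hj => ne_top_of_le_ne_top ENNReal.ofReal_ne_top
      ((Finset.single_le_sum (f := fun j => klDiv (Q j) (Q 0)) (fun _ _ => zero_le) hj).trans hχ)
  have hsum : ∑ j ∈ Finset.univ.erase (0 : Fin (M + 1)), (klDiv (Q j) (Q 0)).toReal ≤ M * c := by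
    rw [← ENNReal.toReal_sum htop]
    refine ENNReal.toReal_le_of_le_ofReal (by positivity) (hχ.trans ?_)
    exact ENNReal.ofReal_le_ofReal (by gcongr)
  have hQ0 : ∑ j ∈ Finset.univ.erase (0 : Fin (M + 1)), (Q 0).real (A j) ≤ p := by
    rw [← measureReal_biUnion_finset (fun i _ j _ hij => hdisj hij) (fun i _ => hA i)]
    refine (measureReal_mono ?_).trans (hcon' 0).le
    refine iUnion₂_subset fun j hj => ?_
    exact (hdisj (Finset.ne_of_mem_erase hj)).subset_compl_right
  have hmain : ∑ j ∈ Finset.univ.erase (0 : Fin (M + 1)), (3 * c + 1) * (1 - p) ≤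
      ∑ j ∈ Finset.univ.erase (0 : Fin (M + 1)), ((klDiv (Q j) (Q 0)).toReal
        + (Real.exp (3 * c + 1) - 1) * (Q 0).real (A j)) := by
    refine Finset.sum_le_sum fun j hj => le_trans ?_ (kl_var (Q j) (Q 0) (A j) (hA j) _ (htop j hj))
    have h1 := hcon' j
    rw [probReal_compl_eq_one_sub (hA j)] at h1
    gcongr
    linarith
  rw [Finset.sum_add_distrib, ← Finset.mul_sum, Finset.sum_const,
    Finset.card_erase_of_mem (Finset.mem_univ _), Finset.card_univ, Fintype.card_fin,
    Nat.add_sub_cancel, nsmul_eq_mul] at hmain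
  have he : (Real.exp (3 * c + 1) - 1) *
      ∑ j ∈ Finset.univ.erase (0 : Fin (M + 1)), (Q 0).real (A j) ≤ M / 4 := by
    have h1 : 0 ≤ Real.exp (3 * c + 1) - 1 := by
      have := Real.add_one_le_exp (3 * c + 1)
      linarith
    refine (mul_le_mul_of_nonneg_left hQ0 h1).trans ?_
    rw [Real.exp_add]
    have h3 : Real.exp 1 ≤ 3 := by linarith [Real.exp_one_lt_d9]
    have h4 : p * Real.exp (3 * c) * Real.exp 1 ≤ M / 12 * 3 := by gcongr
    nlinarith
  have hl : (M : ℝ) * ((3 * c + 1) * (11 / 12)) ≤ M * ((3 * c + 1) * (1 - p)) := by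
    gcongr; linarith
  rw [Finset.mul_sum] at he
  have hMc : 0 ≤ (M : ℝ) * c := by positivity
  linarith

end
end

section
/- Fix α>0, β>0, L>0, d∈ℕ. There exists a probability distribution μ_X* on [0,1]^d (the marginal from the construction of Section 5.2) and positive constants C'₁, C'₂, c', d'₁, d'₂, λ'₀, depending only on α, β, L, d and C_M, such that for any classifier f̂_n: (a) sup over P ∈ 𝓜'(μ_X*,α,β) of ℙ( R(f̂_n) − R* ≥ λ ) ≥ C'₁ for every 0 < λ ≤ d'₁·n^{−(1+α)/(2+α+d/β)}; and (b) sup over P ∈ 𝓜'(μ_X*,α,β) of ℙ( R(f̂_n) − R* ≥ λ ) ≥ C'₂·exp(−c'·n·λ^{(2+α)/(1+α)}) for every d'₂·n^{−(1+α)/(2+α+d/β)} ≤ λ ≤ λ'₀. -/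
open MeasureTheory Set
open scoped ENNReal

noncomputable section

/-- the closed unit cube `[0,1]^d` in `ℝ^d` (with the Euclidean norm) -/
def unitCube (d : ℕ) : Set (EuclideanSpace ℝ (Fin d)) := {x | ∀ i, x i ∈ Icc (0:ℝ) 1}

/-- The Hölder class `Σ(β, L, [0,1]^d)`: functions that are `⌊β⌋` times continuously
differentiable on `[0,1]^d` (`⌊β⌋` = the maximal integer strictly less than `β`) and satisfy
`|g(x') - g_x(x')| ≤ L ‖x' - x‖^β` where `g_x` is the Taylor polynomial of degree `⌊β⌋`
of `g` at `x`. -/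
def holderClass (d : ℕ) (β L : ℝ) : Set (EuclideanSpace ℝ (Fin d) → ℝ) :=
  {g | ContDiffOn ℝ ((⌈β⌉₊ - 1 : ℕ) : ℕ∞) g (unitCube d) ∧
    ∀ x ∈ unitCube d, ∀ x' ∈ unitCube d,
      |g x' - ∑ k ∈ Finset.range (⌈β⌉₊ - 1 + 1),
          ((k.factorial : ℝ))⁻¹ *
            iteratedFDerivWithin ℝ k g (unitCube d) x (fun _ => x' - x)|
        ≤ L * ‖x' - x‖ ^ β}

lemma lint_pi_prod {n : ℕ} {Z : Type*} [MeasurableSpace Z] (Q : Measure Z) [IsProbabilityMeasure Q]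
    (f : Fin n → Z → ℝ≥0∞) (hf : ∀ i, Measurable (f i)) :
    ∫⁻ D, ∏ i, f i (D i) ∂(Measure.pi (fun _ : Fin n => Q)) = ∏ i, ∫⁻ z, f i z ∂Q := by
  have h := ProbabilityTheory.lintegral_prod_eq_prod_lintegral_of_indepFun
    (μ := Measure.pi (fun _ : Fin n => Q)) Finset.univ (fun i (D : Fin n → Z) => f i (D i))
    (ProbabilityTheory.iIndepFun_pi (fun i => (hf i).aemeasurable))
    (fun i => (hf i).comp (measurable_pi_apply i))
  rw [h]
  refine Finset.prod_congr rfl fun i _ => ?_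
  exact (measurePreserving_eval (fun _ : Fin n => Q) i).lintegral_comp (hf i)

lemma pi_withDens {n : ℕ} {Z : Type*} [MeasurableSpace Z] (Q : Measure Z) [IsProbabilityMeasure Q]
    (f : Z → ℝ≥0∞) (hf : Measurable f) [IsProbabilityMeasure (Q.withDensity f)] :
    Measure.pi (fun _ : Fin n => Q.withDensity f)
      = (Measure.pi (fun _ : Fin n => Q)).withDensity (fun D => ∏ i, f (D i)) := by
  refine Measure.pi_eq (fun s hs => ?_)
  rw [withDensity_apply _ (MeasurableSet.univ_pi hs), ← lintegral_indicator (MeasurableSet.univ_pi hs)]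
  have : ∀ D : Fin n → Z, (Set.univ.pi s).indicator (fun D => ∏ i, f (D i)) D
      = ∏ i, (s i).indicator f (D i) := by
    intro D
    by_cases hD : D ∈ Set.univ.pi s
    · rw [Set.indicator_of_mem hD]
      refine Finset.prod_congr rfl fun i _ => ?_
      rw [Set.indicator_of_mem (hD i (mem_univ i))]
    · rw [Set.indicator_of_notMem hD]
      simp only [Set.mem_pi, mem_univ, true_imp_iff, not_forall] at hD
      obtain ⟨i, hi⟩ := hD
      exact (Finset.prod_eq_zero (Finset.mem_univ i) (Set.indicator_of_notMem hi f)).symm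
  simp_rw [this]
  rw [lint_pi_prod Q (fun i => (s i).indicator f) (fun i => hf.indicator (hs i))]
  refine Finset.prod_congr rfl fun i _ => ?_
  rw [lintegral_indicator (hs i), withDensity_apply _ (hs i)]

lemma affinity_min {Ω : Type*} [MeasurableSpace Ω] (Q : Measure Ω) (p q r : Ω → ℝ≥0∞)
    (hp : Measurable p) (hq : Measurable q) (hr : ∀ x, r x ^ 2 ≤ p x * q x)
    (hp1 : ∫⁻ x, p x ∂Q = 1) (hq1 : ∫⁻ x, q x ∂Q = 1) :
    (∫⁻ x, r x ∂Q) ^ 2 ≤ 2 * ∫⁻ x, min (p x) (q x) ∂Q := by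
  have key : ∀ x, r x ≤ (min (p x) (q x)) ^ (1/2 : ℝ) * (max (p x) (q x)) ^ (1/2 : ℝ) := by
    intro x
    rw [← ENNReal.mul_rpow_of_nonneg _ _ (by norm_num), min_mul_max]
    calc r x = ((r x) ^ 2) ^ (1/2 : ℝ) := by
          rw [← ENNReal.rpow_natCast, ← ENNReal.rpow_mul]; norm_num
      _ ≤ _ := ENNReal.rpow_le_rpow (hr x) (by norm_num)
  have h2 := ENNReal.lintegral_mul_le_Lp_mul_Lq Q (Real.HolderConjugate.two_two)
    (f := fun x => (min (p x) (q x)) ^ (1/2 : ℝ)) (g := fun x => (max (p x) (q x)) ^ (1/2 : ℝ))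
    ((hp.min hq).pow_const _).aemeasurable ((hp.max hq).pow_const _).aemeasurable
  have e : ∀ y : ℝ≥0∞, (y ^ (1/2 : ℝ)) ^ (2:ℝ) = y := by
    intro y; rw [← ENNReal.rpow_mul]; norm_num
  simp only [e, Pi.mul_apply] at h2
  have h3 : ∫⁻ x, max (p x) (q x) ∂Q ≤ 2 := by
    calc _ ≤ ∫⁻ x, (p x + q x) ∂Q := lintegral_mono fun x => max_le (by simp) (by simp)
      _ = 2 := by rw [lintegral_add_left hp, hp1, hq1]; norm_num
  have h4 : ∫⁻ x, r x ∂Q ≤ (∫⁻ x, min (p x) (q x) ∂Q) ^ (1/2:ℝ) * (2:ℝ≥0∞) ^ (1/2:ℝ) :=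
    (lintegral_mono key).trans (h2.trans (by gcongr))
  calc (∫⁻ x, r x ∂Q) ^ 2 ≤ ((∫⁻ x, min (p x) (q x) ∂Q) ^ (1/2:ℝ) * (2:ℝ≥0∞) ^ (1/2:ℝ)) ^ 2 := by gcongr
    _ = _ := by
      rw [mul_pow, ← ENNReal.rpow_natCast, ← ENNReal.rpow_natCast]
      have := e
      push_cast
      rw [e, e, mul_comm]

/-- flipC coordinate c -/
def flipC {ι : Type*} [DecidableEq ι] (c : ι) (σ : ι → Bool) : ι → Bool := Function.update σ c (!σ c)

lemma flipC_flipC {ι : Type*} [DecidableEq ι] (c : ι) (σ : ι → Bool) : flipC c (flipC c σ) = σ := by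
  simp [flipC]

lemma assouad {Ω ι : Type*} [MeasurableSpace Ω] [Fintype ι] [DecidableEq ι] (Q : Measure Ω)
    (p : (ι → Bool) → Ω → ℝ≥0∞) (hp : ∀ σ, Measurable (p σ)) (hp1 : ∀ σ, ∫⁻ x, p σ x ∂Q = 1)
    (g : Ω → ι → Bool) (A : (ι → Bool) → Set Ω) (T K : ℝ≥0∞)
    (hA : ∀ σ D, T ≤ ((Finset.univ.filter fun c => g D c ≠ σ c).card : ℝ≥0∞) → D ∈ A σ)
    (hK : ∀ σ, K ≤ ∑ c, ∫⁻ x, min (p σ x) (p (flipC c σ) x) ∂Q) :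
    ∃ σ, K ≤ 2 * (T + Fintype.card ι * (Q.withDensity (p σ)) (A σ)) := by
  by_contra! hcon
  set B : (ι → Bool) → Set Ω := fun σ => toMeasurable (Q.withDensity (p σ)) (A σ)
  have hB : ∀ σ, MeasurableSet (B σ) := fun σ => measurableSet_toMeasurable _ _
  have hAB : ∀ σ, A σ ⊆ B σ := fun σ => subset_toMeasurable _ _
  -- pointwise bound
  have h1 : ∀ D, ∑ σ, ∑ c, min (p σ D) (p (flipC c σ) D)
      ≤ 2 * ∑ σ, p σ D * ((Finset.univ.filter fun c => g D c ≠ σ c).card : ℝ≥0∞) := by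
    intro D
    have e1 : ∀ σ : ι → Bool, p σ D * ((Finset.univ.filter fun c => g D c ≠ σ c).card : ℝ≥0∞)
        = ∑ c, (if g D c ≠ σ c then p σ D else 0) := by
      intro σ
      rw [← Finset.sum_filter, Finset.sum_const, nsmul_eq_mul, mul_comm]
    simp_rw [e1]
    rw [Finset.sum_comm, Finset.sum_comm (f := fun σ c => (if g D c ≠ σ c then p σ D else 0)), Finset.mul_sum]
    refine Finset.sum_le_sum fun c _ => ?_
    have e2 : ∑ σ : ι → Bool, (if g D c ≠ σ c then p σ D else 0)
        = ∑ σ : ι → Bool, (if g D c ≠ (flipC c σ) c then p (flipC c σ) D else 0) :=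
      (Equiv.sum_comp (Function.Involutive.toPerm (flipC c) (flipC_flipC c)) _).symm
    rw [two_mul]
    nth_rewrite 2 [e2]
    rw [← Finset.sum_add_distrib]
    refine Finset.sum_le_sum fun σ _ => ?_
    by_cases h : g D c = σ c
    · simp [h, flipC]
    · simp [h]
  have h2 : ∀ D, ∑ σ, p σ D * ((Finset.univ.filter fun c => g D c ≠ σ c).card : ℝ≥0∞)
      ≤ ∑ σ, (T * p σ D + Fintype.card ι * (B σ).indicator (p σ) D) := by
    intro D
    refine Finset.sum_le_sum fun σ _ => ?_
    by_cases h : T ≤ ((Finset.univ.filter fun c => g D c ≠ σ c).card : ℝ≥0∞)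
    · rw [Set.indicator_of_mem (hAB σ (hA σ D h)), mul_comm]
      refine le_trans ?_ le_add_self
      gcongr
      exact_mod_cast Finset.card_le_univ _
    · refine le_trans ?_ le_self_add
      rw [mul_comm]
      gcongr
      exact (not_le.1 h).le
  have h3 : ∑ σ, ∑ c, ∫⁻ D, min (p σ D) (p (flipC c σ) D) ∂Q
      ≤ 2 * ∑ σ, (T + Fintype.card ι * (Q.withDensity (p σ)) (A σ)) := by
    have m1 : ∀ σ c, Measurable fun D => min (p σ D) (p (flipC c σ) D) :=
      fun σ c => (hp _).min (hp _)
    calc _ = ∫⁻ D, ∑ σ, ∑ c, min (p σ D) (p (flipC c σ) D) ∂Q := by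
          rw [lintegral_finsetSum _ (fun σ _ => Finset.measurable_sum _ fun c _ => m1 σ c)]
          refine Finset.sum_congr rfl fun σ _ => ?_
          rw [lintegral_finsetSum _ (fun c _ => m1 σ c)]
      _ ≤ ∫⁻ D, 2 * ∑ σ, (T * p σ D + Fintype.card ι * (B σ).indicator (p σ) D) ∂Q :=
          lintegral_mono fun D => (h1 D).trans (mul_le_mul_right (h2 D) 2)
      _ = _ := by
          have m2 : ∀ σ, Measurable fun D => (B σ).indicator (p σ) D := fun σ => (hp σ).indicator (hB σ)
          have m3 : ∀ σ, Measurable fun D => T * p σ D + Fintype.card ι * (B σ).indicator (p σ) D :=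
            fun σ => ((hp σ).const_mul _).add ((m2 σ).const_mul _)
          rw [lintegral_const_mul _ (Finset.measurable_sum _ fun σ _ => m3 σ)]
          rw [lintegral_finsetSum _ (fun σ _ => m3 σ)]
          congr 1
          refine Finset.sum_congr rfl fun σ _ => ?_
          rw [lintegral_add_left ((hp σ).const_mul _), lintegral_const_mul _ (hp σ), hp1,
            lintegral_const_mul _ (m2 σ), lintegral_indicator (hB σ), mul_one,
            ← withDensity_apply _ (hB σ), measure_toMeasurable]
  have h4 : ∑ σ : ι → Bool, K ≤ 2 * ∑ σ, (T + Fintype.card ι * (Q.withDensity (p σ)) (A σ)) :=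
    (Finset.sum_le_sum fun σ _ => hK σ).trans h3
  rw [Finset.mul_sum] at h4
  exact absurd h4 (not_le.2 (ENNReal.sum_lt_sum_of_nonempty Finset.univ_nonempty fun σ _ => hcon σ))


def refQ {𝒳 : Type*} [MeasurableSpace 𝒳] (μ : Measure 𝒳) : Measure (𝒳 × Bool) :=
  μ.prod ((2:ℝ≥0∞)⁻¹ • (Measure.dirac true + Measure.dirac false))

instance {𝒳 : Type*} [MeasurableSpace 𝒳] (μ : Measure 𝒳) [IsProbabilityMeasure μ] :
    IsProbabilityMeasure (refQ μ) := by
  have : IsProbabilityMeasure ((2:ℝ≥0∞)⁻¹ • (Measure.dirac true + Measure.dirac false) : Measure Bool) := by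
    constructor
    simp [ENNReal.inv_two_add_inv_two]
  unfold refQ; infer_instance

lemma lint_refQ {𝒳 : Type*} [MeasurableSpace 𝒳] (μ : Measure 𝒳) [IsProbabilityMeasure μ]
    (F : 𝒳 × Bool → ℝ≥0∞) (hF : Measurable F) :
    ∫⁻ z, F z ∂(refQ μ) = ∫⁻ x, 2⁻¹ * (F (x, true) + F (x, false)) ∂μ := by
  have : SFinite ((2:ℝ≥0∞)⁻¹ • (Measure.dirac true + Measure.dirac false) : Measure Bool) := by
    infer_instance
  unfold refQ
  rw [lintegral_prod _ hF.aemeasurable]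
  simp [lintegral_add_measure, lintegral_smul_measure, mul_add]

def dens {𝒳 : Type*} (η : 𝒳 → ℝ) (z : 𝒳 × Bool) : ℝ≥0∞ :=
  if z.2 = true then 2 * ENNReal.ofReal (η z.1) else 2 * ENNReal.ofReal (1 - η z.1)

lemma meas_dens {𝒳 : Type*} [MeasurableSpace 𝒳] {η : 𝒳 → ℝ} (hη : Measurable η) :
    Measurable (dens η) := by
  unfold dens
  refine Measurable.ite (measurable_snd (measurableSet_singleton true)) ?_ ?_
  · exact ((hη.comp measurable_fst).ennreal_ofReal).const_mul _
  · exact (((hη.comp measurable_fst).const_sub 1).ennreal_ofReal).const_mul _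

def PP {𝒳 : Type*} [MeasurableSpace 𝒳] (μ : Measure 𝒳) (η : 𝒳 → ℝ) : Measure (𝒳 × Bool) :=
  (refQ μ).withDensity (dens η)

lemma lint_PP {𝒳 : Type*} [MeasurableSpace 𝒳] (μ : Measure 𝒳) [IsProbabilityMeasure μ]
    {η : 𝒳 → ℝ} (hη : Measurable η) (F : 𝒳 × Bool → ℝ≥0∞) (hF : Measurable F) :
    ∫⁻ z, F z ∂(PP μ η)
      = ∫⁻ x, (ENNReal.ofReal (η x) * F (x, true) + ENNReal.ofReal (1 - η x) * F (x, false)) ∂μ := by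
  unfold PP
  rw [lintegral_withDensity_eq_lintegral_mul _ (meas_dens hη) hF, lint_refQ _ _ ((meas_dens hη).mul hF)]
  refine lintegral_congr fun x => ?_
  simp only [Pi.mul_apply, dens, if_true, Bool.false_eq_true, if_false]
  rw [mul_assoc, mul_assoc, ← mul_add, ← mul_assoc, ENNReal.inv_mul_cancel (by norm_num) (by norm_num), one_mul]

lemma ofReal_add_compl {a : ℝ} (h : a ∈ Icc (0:ℝ) 1) : ENNReal.ofReal a + ENNReal.ofReal (1 - a) = 1 := by
  rw [← ENNReal.ofReal_add h.1 (by linarith [h.2])]; simp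

lemma PP_prob {𝒳 : Type*} [MeasurableSpace 𝒳] (μ : Measure 𝒳) [IsProbabilityMeasure μ]
    {η : 𝒳 → ℝ} (hη : Measurable η) (h01 : ∀ x, η x ∈ Icc (0:ℝ) 1) : IsProbabilityMeasure (PP μ η) := by
  constructor
  have h := lint_PP μ hη (fun _ => 1) measurable_const
  rw [lintegral_one] at h
  rw [h]
  simp [ofReal_add_compl (h01 _)]

lemma PP_apply {𝒳 : Type*} [MeasurableSpace 𝒳] (μ : Measure 𝒳) [IsProbabilityMeasure μ]
    {η : 𝒳 → ℝ} (hη : Measurable η) {S : Set (𝒳 × Bool)} (hS : MeasurableSet S) :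
    PP μ η S = ∫⁻ x, (ENNReal.ofReal (η x) * S.indicator 1 (x, true)
      + ENNReal.ofReal (1 - η x) * S.indicator 1 (x, false)) ∂μ := by
  rw [← lint_PP μ hη (S.indicator 1) (measurable_one.indicator hS), lintegral_indicator_one hS]

lemma PP_map {𝒳 : Type*} [MeasurableSpace 𝒳] (μ : Measure 𝒳) [IsProbabilityMeasure μ]
    {η : 𝒳 → ℝ} (hη : Measurable η) (h01 : ∀ x, η x ∈ Icc (0:ℝ) 1) : (PP μ η).map Prod.fst = μ := by
  ext A hA
  rw [Measure.map_apply measurable_fst hA, PP_apply μ hη (measurable_fst hA), ← lintegral_indicator_one hA]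
  refine lintegral_congr fun x => ?_
  by_cases hx : x ∈ A
  · simp [Set.indicator, hx, ofReal_add_compl (h01 x)]
  · simp [Set.indicator, hx]

lemma PP_reg {𝒳 : Type*} [MeasurableSpace 𝒳] (μ : Measure 𝒳) [IsProbabilityMeasure μ]
    {η : 𝒳 → ℝ} (hη : Measurable η) (h01 : ∀ x, η x ∈ Icc (0:ℝ) 1) : IsRegFun (PP μ η) η := by
  refine ⟨hη, h01, fun A hA => ?_⟩
  rw [PP_map μ hη h01, PP_apply μ hη (hA.prod (measurableSet_singleton true)), ← lintegral_indicator hA]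
  refine lintegral_congr fun x => ?_
  by_cases hx : x ∈ A
  · simp [Set.indicator, hx]
  · simp [Set.indicator, hx]

lemma PP_excess {𝒳 : Type*} [MeasurableSpace 𝒳] (μ : Measure 𝒳) [IsProbabilityMeasure μ]
    {η : 𝒳 → ℝ} (hη : Measurable η) (h01 : ∀ x, η x ∈ Icc (0:ℝ) 1) (f : 𝒳 → Bool)
    (V : Set 𝒳) (hV : MeasurableSet V) (v : ℝ) (hv : 0 ≤ v)
    (hVv : ∀ x ∈ V, f x ≠ bayes η x ∧ v ≤ |2 * η x - 1|) :
    v * (μ V).toReal ≤ risk (PP μ η) f - risk (PP μ η) (bayes η) := by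
  have hP := PP_prob μ hη h01
  have hbm : MeasurableSet {p : 𝒳 × Bool | p.2 ≠ bayes η p.1} := by
    have h1 : Measurable (bayes η) := by
      apply measurable_to_bool
      have : bayes η ⁻¹' {true} = {x | (1:ℝ)/2 ≤ η x} := by
        ext x; simp [bayes]
      rw [this]
      exact measurableSet_le measurable_const hη
    exact (measurableSet_eq_fun measurable_snd (h1.comp measurable_fst)).compl
  set P := PP μ η with hPdef
  set S := {p : 𝒳 × Bool | p.2 ≠ f p.1} with hS
  set T := toMeasurable P S
  have hT : MeasurableSet T := measurableSet_toMeasurable _ _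
  have key : P {p : 𝒳 × Bool | p.2 ≠ bayes η p.1} + ENNReal.ofReal v * μ V ≤ P S := by
    rw [← measure_toMeasurable S, hPdef, PP_apply μ hη hbm, PP_apply μ hη hT,
      ← lintegral_indicator_one hV, ← lintegral_const_mul _ (measurable_one.indicator hV)]
    rw [← lintegral_add_right _ ((measurable_one.indicator hV).const_mul _)]
    refine lintegral_mono fun x => ?_
    have hxT : (x, !f x) ∈ T := subset_toMeasurable P S (by simp [hS])
    have hl : ENNReal.ofReal (η x) * T.indicator 1 (x, true)
      + ENNReal.ofReal (1 - η x) * T.indicator 1 (x, false) ≥ if f x = true then ENNReal.ofReal (1 - η x) else ENNReal.ofReal (η x) := by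
      cases hfx : f x
      · rw [hfx] at hxT
        simp only [Bool.not_false] at hxT
        rw [Set.indicator_of_mem hxT]; simp
      · rw [hfx] at hxT
        simp only [Bool.not_true] at hxT
        rw [Set.indicator_of_mem hxT]; simp
    refine le_trans ?_ hl
    have h0 := (h01 x).1
    have h1 := (h01 x).2
    have hvx : x ∈ V → f x ≠ bayes η x ∧ v ≤ |2 * η x - 1| := hVv x
    by_cases hb : (1:ℝ)/2 ≤ η x
    · have hbx : bayes η x = true := by simp only [bayes, hb, decide_true]
      rw [abs_of_nonneg (by linarith), hbx] at hvx
      have e1 : ({p : 𝒳 × Bool | p.2 ≠ bayes η p.1}).indicator (1 : 𝒳 × Bool → ℝ≥0∞) (x, true) = 0 := by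
        simp [hbx]
      have e2 : ({p : 𝒳 × Bool | p.2 ≠ bayes η p.1}).indicator (1 : 𝒳 × Bool → ℝ≥0∞) (x, false) = 1 := by
        simp [hbx]
      rw [e1, e2]
      by_cases hx : x ∈ V
      · obtain ⟨ha, hb'⟩ := hvx hx
        rw [if_neg ha, Set.indicator_of_mem hx]
        simp only [mul_zero, zero_add, mul_one, Pi.one_apply]
        rw [← ENNReal.ofReal_add (by linarith) hv]
        exact ENNReal.ofReal_le_ofReal (by linarith)
      · rw [Set.indicator_of_notMem hx]
        simp only [mul_zero, zero_add, mul_one, add_zero]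
        split_ifs
        · exact le_rfl
        · exact ENNReal.ofReal_le_ofReal (by linarith)
    · have hbx : bayes η x = false := by simp only [bayes, hb, decide_false]
      push Not at hb
      rw [abs_of_nonpos (by linarith), hbx] at hvx
      have e1 : ({p : 𝒳 × Bool | p.2 ≠ bayes η p.1}).indicator (1 : 𝒳 × Bool → ℝ≥0∞) (x, true) = 1 := by
        simp [hbx]
      have e2 : ({p : 𝒳 × Bool | p.2 ≠ bayes η p.1}).indicator (1 : 𝒳 × Bool → ℝ≥0∞) (x, false) = 0 := by
        simp [hbx]
      rw [e1, e2]
      by_cases hx : x ∈ V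
      · obtain ⟨ha, hb'⟩ := hvx hx
        rw [if_pos (by simpa using ha), Set.indicator_of_mem hx]
        simp only [mul_zero, add_zero, mul_one, Pi.one_apply]
        rw [← ENNReal.ofReal_add (by linarith) hv]
        exact ENNReal.ofReal_le_ofReal (by linarith)
      · rw [Set.indicator_of_notMem hx]
        simp only [mul_zero, mul_one, add_zero]
        split_ifs
        · exact ENNReal.ofReal_le_ofReal (by linarith)
        · exact le_rfl
  have := ENNReal.toReal_mono (measure_ne_top P S) key
  rw [ENNReal.toReal_add (measure_ne_top _ _) (ENNReal.mul_ne_top ENNReal.ofReal_ne_top (measure_ne_top _ _)),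
    ENNReal.toReal_mul, ENNReal.toReal_ofReal hv] at this
  unfold risk
  linarith

lemma stat_lower {𝒳 ι : Type*} [MeasurableSpace 𝒳] [Fintype ι] [DecidableEq ι] (μ : Measure 𝒳)
    [IsProbabilityMeasure μ] (η : (ι → Bool) → 𝒳 → ℝ) (hη : ∀ σ, Measurable (η σ))
    (h01 : ∀ σ x, η σ x ∈ Icc (0:ℝ) 1) (Cell : ι → Set 𝒳) (hC : ∀ c, MeasurableSet (Cell c))
    (ε : ℝ) (hε : 0 ≤ ε) (hε1 : ε ≤ 1) (hb : ∀ σ x, |2 * η σ x - 1| ≤ ε)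
    (hin : ∀ σ c, ∀ x ∈ Cell c, η (flipC c σ) x = 1 - η σ x)
    (hout : ∀ σ c, ∀ x, x ∉ Cell c → η (flipC c σ) x = η σ x)
    (n : ℕ) (g : (Fin n → 𝒳 × Bool) → ι → Bool) (A : (ι → Bool) → Set (Fin n → 𝒳 × Bool)) (T : ℝ≥0∞)
    (hA : ∀ σ D, T ≤ ((Finset.univ.filter fun c => g D c ≠ σ c).card : ℝ≥0∞) → D ∈ A σ) :
    ∃ σ, ∑ c, ENNReal.ofReal (1 - ε ^ 2 * (μ (Cell c)).toReal) ^ (2 * n)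
      ≤ 4 * (T + Fintype.card ι * Measure.pi (fun _ : Fin n => PP μ (η σ)) (A σ)) := by
  have hpp := fun σ => PP_prob μ (hη σ) (h01 σ)
  set Q := Measure.pi (fun _ : Fin n => refQ μ) with hQ
  set p : (ι → Bool) → (Fin n → 𝒳 × Bool) → ℝ≥0∞ := fun σ D => ∏ i, dens (η σ) (D i)
  have hpi : ∀ σ, Measure.pi (fun _ : Fin n => PP μ (η σ)) = Q.withDensity (p σ) := by
    intro σ
    have : IsProbabilityMeasure ((refQ μ).withDensity (dens (η σ))) := hpp σ
    exact pi_withDens (refQ μ) (dens (η σ)) (meas_dens (hη σ))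
  have hpm : ∀ σ, Measurable (p σ) := fun σ =>
    Finset.measurable_prod _ fun i _ => (meas_dens (hη σ)).comp (measurable_pi_apply i)
  have hd1 : ∀ σ, ∫⁻ z, dens (η σ) z ∂(refQ μ) = 1 := by
    intro σ
    have := (hpp σ).measure_univ
    unfold PP at this
    rwa [withDensity_apply _ MeasurableSet.univ, setLIntegral_univ] at this
  have hp1 : ∀ σ, ∫⁻ D, p σ D ∂Q = 1 := by
    intro σ
    rw [hQ, lint_pi_prod (refQ μ) (fun _ => dens (η σ)) (fun _ => meas_dens (hη σ))]
    simp [hd1]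
  have hε2 : ε ^ 2 ≤ 1 := by nlinarith
  have hmin : ∀ σ c, ENNReal.ofReal (1 - ε ^ 2 * (μ (Cell c)).toReal) ^ (2 * n)
      ≤ 2 * ∫⁻ D, min (p σ D) (p (flipC c σ) D) ∂Q := by
    intro σ c
    classical
    set r : 𝒳 × Bool → ℝ≥0∞ := fun z => if z.1 ∈ Cell c then ENNReal.ofReal (1 - ε ^ 2) else dens (η σ) z
      with hr
    have hrm : Measurable r :=
      Measurable.ite (measurable_fst (hC c)) measurable_const (meas_dens (hη σ))
    have hr2 : ∀ z, r z ^ 2 ≤ dens (η σ) z * dens (η (flipC c σ)) z := by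
      rintro ⟨x, y⟩
      have h0 := (h01 σ x).1
      have h1 := (h01 σ x).2
      by_cases hx : x ∈ Cell c
      · have e : dens (η σ) (x, y) * dens (η (flipC c σ)) (x, y)
            = ENNReal.ofReal (4 * (η σ x * (1 - η σ x))) := by
          have e4 : (2:ℝ≥0∞) * 2 = ENNReal.ofReal 4 := by norm_num
          cases y
          · simp only [dens, hin σ c x hx, Bool.false_eq_true, if_false, sub_sub_cancel]
            rw [mul_mul_mul_comm, e4, ← ENNReal.ofReal_mul (by linarith), ← ENNReal.ofReal_mul (by norm_num)]
            ring_nf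
          · simp only [dens, hin σ c x hx, if_true]
            rw [mul_mul_mul_comm, e4, ← ENNReal.ofReal_mul (by linarith), ← ENNReal.ofReal_mul (by norm_num)]
        rw [e]
        simp only [hr, hx, if_true]
        rw [← ENNReal.ofReal_pow (by linarith)]
        refine ENNReal.ofReal_le_ofReal ?_
        have hbb := hb σ x
        have : (2 * η σ x - 1) ^ 2 ≤ ε ^ 2 := sq_le_sq' (by linarith [neg_abs_le (2 * η σ x - 1)]) (by linarith [le_abs_self (2 * η σ x - 1)])
        nlinarith [sq_nonneg ε]
      · simp only [hr, hx, if_false, dens, hout σ c x hx]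
        rw [sq]
    have hrint : ENNReal.ofReal (1 - ε ^ 2 * (μ (Cell c)).toReal) ≤ ∫⁻ z, r z ∂(refQ μ) := by
      rw [lint_refQ μ r hrm]
      have e : ∀ x, 2⁻¹ * (r (x, true) + r (x, false))
          = (Cell c).indicator (fun _ => ENNReal.ofReal (1 - ε ^ 2)) x + (Cell c)ᶜ.indicator 1 x := by
        intro x
        have e2 : ∀ y : ℝ≥0∞, 2⁻¹ * (2 * y) = y := by
          intro y; rw [← mul_assoc, ENNReal.inv_mul_cancel (by norm_num) (by norm_num), one_mul]
        by_cases hx : x ∈ Cell c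
        · simp [hr, hx, ← two_mul, e2]
        · simp [hr, hx, dens, ← mul_add, ofReal_add_compl (h01 σ x), ENNReal.inv_mul_cancel]
      simp_rw [e]
      rw [lintegral_add_left (measurable_const.indicator (hC c)), lintegral_indicator (hC c),
        lintegral_indicator_one (hC c).compl, setLIntegral_const, prob_compl_eq_one_sub (hC c)]
      have hm : μ (Cell c) = ENNReal.ofReal (μ (Cell c)).toReal := (ENNReal.ofReal_toReal (measure_ne_top _ _)).symm
      have hm0 : 0 ≤ (μ (Cell c)).toReal := ENNReal.toReal_nonneg
      have hm1 : (μ (Cell c)).toReal ≤ 1 := by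
        have := ENNReal.toReal_mono ENNReal.one_ne_top (prob_le_one (μ := μ) (s := Cell c))
        simpa using this
      set m := (μ (Cell c)).toReal
      rw [hm, ← ENNReal.ofReal_mul (by linarith), ← ENNReal.ofReal_one, ← ENNReal.ofReal_sub _ hm0,
        ← ENNReal.ofReal_add (by nlinarith) (by linarith)]
      refine ENNReal.ofReal_le_ofReal (by nlinarith)
    have h := affinity_min Q (p σ) (p (flipC c σ)) (fun D => ∏ i, r (D i)) (hpm _) (hpm _)
      (fun D => by
        rw [← Finset.prod_pow, ← Finset.prod_mul_distrib]
        exact Finset.prod_le_prod' fun i _ => hr2 (D i)) (hp1 _) (hp1 _)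
    rw [hQ, lint_pi_prod (refQ μ) (fun _ => r) (fun _ => hrm)] at h
    simp only [Finset.prod_const, Finset.card_univ, Fintype.card_fin] at h
    refine le_trans ?_ h
    rw [mul_comm 2 n, pow_mul]
    gcongr
  obtain ⟨σ, hσ⟩ := assouad Q p hpm hp1 g A T
    (∑ c, 2⁻¹ * ENNReal.ofReal (1 - ε ^ 2 * (μ (Cell c)).toReal) ^ (2 * n)) hA (fun σ =>
      Finset.sum_le_sum fun c _ => by
        rw [ENNReal.inv_mul_le_iff (by norm_num) (by norm_num)]
        exact hmin σ c)
  refine ⟨σ, ?_⟩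
  rw [hpi σ]
  rw [← Finset.mul_sum, ENNReal.inv_mul_le_iff (by norm_num) (by norm_num), ← mul_assoc] at hσ
  convert hσ using 2
  norm_num


lemma contDiff_posPow (k : ℕ) : ContDiff ℝ k (fun x : ℝ => (max x 0) ^ (k+1)) := by
  induction k with
  | zero =>
    have : Continuous (fun x : ℝ => (max x 0) ^ (0+1)) := by fun_prop
    exact_mod_cast contDiff_zero.2 this
  | succ k ih =>
    have hd : ∀ x : ℝ, HasDerivAt (fun x : ℝ => (max x 0) ^ (k+1+1)) ((k+2 : ℝ) * (max x 0) ^ (k+1)) x := by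
      intro x
      rcases lt_trichotomy x 0 with hx | hx | hx
      · have e : (fun x : ℝ => (max x 0) ^ (k+1+1)) =ᶠ[nhds x] fun _ => 0 := by
          filter_upwards [Iio_mem_nhds hx] with y hy
          rw [max_eq_right (le_of_lt hy)]; simp
        rw [max_eq_right hx.le]
        simpa using (hasDerivAt_const x (0:ℝ)).congr_of_eventuallyEq e
      · subst hx
        rw [hasDerivAt_iff_isLittleO_nhds_zero]
        simp only [zero_add, max_self, ne_eq, Nat.add_eq_zero_iff, one_ne_zero, and_false, not_false_eq_true, zero_pow, sub_zero, mul_zero, smul_zero]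
        have h1 : (fun x : ℝ => (max x 0) ^ (k+1+1)) =O[nhds 0] fun x : ℝ => x ^ (k+1+1) := by
          refine Asymptotics.isBigO_of_le _ fun x => ?_
          rw [norm_pow, norm_pow]
          refine pow_le_pow_left₀ (norm_nonneg _) ?_ _
          rw [Real.norm_eq_abs, Real.norm_eq_abs, abs_of_nonneg (le_max_right x 0)]
          exact max_le (le_abs_self x) (abs_nonneg x)
        refine h1.trans_isLittleO ?_
        have := Asymptotics.isLittleO_pow_pow (𝕜 := ℝ) (m := 1) (n := k+1+1) (by omega)
        simpa using this
      · have e : (fun x : ℝ => (max x 0) ^ (k+1+1)) =ᶠ[nhds x] fun x => x ^ (k+1+1) := by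
          filter_upwards [Ioi_mem_nhds hx] with y hy
          rw [max_eq_left (le_of_lt hy)]
        rw [max_eq_left hx.le]
        have := (hasDerivAt_pow (k+1+1) x).congr_of_eventuallyEq e
        have e2 : (k+2 : ℝ) * x ^ (k+1) = ((k+1+1 : ℕ) : ℝ) * x ^ (k+1+1-1) := by
          simp only [Nat.add_sub_cancel]; push_cast; ring
        rw [e2]; exact this
    have h2 := contDiff_succ_iff_deriv (𝕜 := ℝ) (n := (k : WithTop ℕ∞)) (f := fun x : ℝ => (max x 0) ^ (k+1+1))
    push_cast
    rw [h2]
    refine ⟨fun x => (hd x).differentiableAt, by simp, ?_⟩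
    rw [show deriv (fun x : ℝ => (max x 0) ^ (k+1+1)) = fun x => (k+2 : ℝ) * (max x 0) ^ (k+1) from
      funext fun x => (hd x).deriv]
    exact contDiff_const.mul ih

def s1 (p : ℕ) (x : ℝ) : ℝ := (4 * max x 0 * max (1 - x) 0) ^ p

lemma s1_contDiff (m : ℕ) : ContDiff ℝ (m+1 : ℕ) (s1 (m+2)) := by
  have e : s1 (m+2) = fun x => 4 ^ (m+2) * (max x 0) ^ (m+1+1) * (max (1 - x) 0) ^ (m+1+1) := by
    ext x; simp only [s1]; ring
  rw [e]
  have h := contDiff_posPow (m+1)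
  exact (contDiff_const.mul h).mul (h.comp (contDiff_const.sub contDiff_id))

lemma s1_nonneg (p : ℕ) (x : ℝ) : 0 ≤ s1 p x := by unfold s1; positivity

lemma s1_le_one (p : ℕ) (x : ℝ) : s1 p x ≤ 1 := by
  unfold s1
  refine pow_le_one₀ (by positivity) ?_
  rcases le_total x 0 with h | h
  · simp [h]
  · rcases le_total 1 x with h' | h'
    · simp [h']
    · rw [max_eq_left h, max_eq_left (by linarith)]
      nlinarith [sq_nonneg (2*x-1)]

lemma s1_zero (p : ℕ) (hp : p ≠ 0) (x : ℝ) (hx : ¬ (0 < x ∧ x < 1)) : s1 p x = 0 := by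
  unfold s1
  rcases le_or_gt x 0 with h | h
  · rw [max_eq_right h]; simp [hp]
  · have : 1 ≤ x := by by_contra! h'; exact hx ⟨h, h'⟩
    rw [max_eq_right (a := 1 - x) (by linarith)]; simp [hp]

lemma s1_half (p : ℕ) : s1 p (1/2) = 1 := by
  unfold s1
  rw [max_eq_left (by norm_num), max_eq_left (by norm_num)]; norm_num

lemma s1_lower (p : ℕ) (θ x : ℝ) (hθ : 0 ≤ θ) (h1 : θ ≤ x) (h2 : x ≤ 1 - θ) : θ ^ p ≤ s1 p x := by
  unfold s1
  refine pow_le_pow_left₀ hθ ?_ _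
  rw [max_eq_left (by linarith), max_eq_left (by linarith)]
  nlinarith [mul_nonneg (sub_nonneg.2 h1) (sub_nonneg.2 h2)]

abbrev EE (d : ℕ) := EuclideanSpace ℝ (Fin d)

def phi (d p : ℕ) (y : EE d) : ℝ := ∏ i, s1 p (y i)

def oc (d : ℕ) : Set (EE d) := {y | ∀ i, 0 < y i ∧ y i < 1}

lemma phi_contDiff (d m : ℕ) : ContDiff ℝ (m+1 : ℕ) (phi d (m+2)) := by
  unfold phi
  refine contDiff_prod fun i _ => ?_
  exact (s1_contDiff m).comp (by fun_prop)

lemma phi_nonneg (d p : ℕ) (y) : 0 ≤ phi d p y := Finset.prod_nonneg fun i _ => s1_nonneg _ _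
lemma phi_le_one (d p : ℕ) (y) : phi d p y ≤ 1 :=
  Finset.prod_le_one (fun i _ => s1_nonneg _ _) fun i _ => s1_le_one _ _
lemma phi_zero (d p : ℕ) (hp : p ≠ 0) (y : EE d) (hy : y ∉ oc d) : phi d p y = 0 := by
  simp only [oc, mem_setOf_eq, not_forall] at hy
  obtain ⟨i, hi⟩ := hy
  exact Finset.prod_eq_zero (Finset.mem_univ i) (s1_zero p hp _ hi)
lemma phi_lower (d p : ℕ) (θ : ℝ) (y : EE d) (hθ : 0 ≤ θ) (h : ∀ i, θ ≤ y i ∧ y i ≤ 1 - θ) :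
    (θ ^ p) ^ d ≤ phi d p y := by
  have : (θ ^ p) ^ d = ∏ _i : Fin d, θ ^ p := by simp
  rw [this]
  exact Finset.prod_le_prod (fun i _ => by positivity) fun i _ => s1_lower p θ _ hθ (h i).1 (h i).2
lemma phi_half (d p : ℕ) (y : EE d) (h : ∀ i, y i = 1/2) : phi d p y = 1 := by
  unfold phi; simp_rw [h, s1_half]; simp

lemma isClosed_cube (d : ℕ) : IsClosed (unitCube d) := by
  have : unitCube d = ⋂ i, {x : EE d | x i ∈ Icc (0:ℝ) 1} := by ext; simp [unitCube]
  rw [this]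
  exact isClosed_iInter fun i => isClosed_Icc.preimage (by fun_prop)

lemma isCompact_cube (d : ℕ) : IsCompact (unitCube d) := by
  refine Metric.isCompact_of_isClosed_isBounded (isClosed_cube d) ?_
  refine Metric.isBounded_iff_subset_closedBall 0 |>.2 ⟨Real.sqrt d, fun x hx => ?_⟩
  rw [mem_closedBall_zero_iff, EuclideanSpace.norm_eq]
  refine Real.sqrt_le_sqrt ?_
  calc ∑ i, ‖x i‖ ^ 2 ≤ ∑ _i : Fin d, (1:ℝ) := Finset.sum_le_sum fun i _ => by
        have := hx i
        rw [Real.norm_eq_abs, sq_abs]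
        nlinarith [this.1, this.2]
    _ = d := by simp

lemma oc_subset (d : ℕ) : oc d ⊆ unitCube d := fun _ hx i => ⟨(hx i).1.le, (hx i).2.le⟩

lemma isOpen_oc (d : ℕ) : IsOpen (oc d) := by
  have : oc d = ⋂ i, {x : EE d | x i ∈ Ioo (0:ℝ) 1} := by ext; simp [oc]
  rw [this]
  exact isOpen_iInter_of_finite fun i => isOpen_Ioo.preimage (by fun_prop)

lemma uniqueDiff_cube (d : ℕ) : UniqueDiffOn ℝ (unitCube d) := by
  refine uniqueDiffOn_convex ?_ ?_
  · have : unitCube d = ⋂ i, {x : EE d | x i ∈ Icc (0:ℝ) 1} := by ext; simp [unitCube]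
    rw [this]
    refine convex_iInter fun i => ?_
    exact (convex_Icc (0:ℝ) 1).linear_preimage (EuclideanSpace.proj i : EE d →L[ℝ] ℝ).toLinearMap
  · refine ⟨WithLp.toLp 2 (fun _ => 1/2), interior_maximal (oc_subset d) (isOpen_oc d) ?_⟩
    intro i; norm_num

lemma tsupport_phi (d p : ℕ) (hp : p ≠ 0) : tsupport (phi d p) ⊆ unitCube d := by
  refine closure_minimal ?_ (isClosed_cube d)
  intro x hx
  by_contra h
  exact hx (phi_zero d p hp x fun h' => h (oc_subset d h'))

lemma phi_deriv_zero (d m k : ℕ) (hk : k ≤ m + 1) (y : EE d) (hy : y ∉ oc d) :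
    iteratedFDeriv ℝ k (phi d (m+2)) y = 0 := by
  have hcont : Continuous (iteratedFDeriv ℝ k (phi d (m+2))) :=
    (phi_contDiff d m).continuous_iteratedFDeriv (by exact_mod_cast hk)
  have hz : ∀ x ∉ unitCube d, iteratedFDeriv ℝ k (phi d (m+2)) x = 0 := by
    intro x hx
    by_contra h
    exact hx (tsupport_phi d (m+2) (by omega) (support_iteratedFDeriv_subset k h))
  have hy' := hy
  simp only [oc, mem_setOf_eq, not_forall] at hy
  obtain ⟨i, hi⟩ := hy
  -- direction
  obtain ⟨e, he⟩ : ∃ e : ℝ, ∀ t > 0, y i + t * e ∉ Icc (0:ℝ) 1 := by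
    rcases le_or_gt (y i) 0 with h | h
    · exact ⟨-1, fun t ht h' => by linarith [h'.1]⟩
    · have : 1 ≤ y i := by by_contra! h'; exact hi ⟨h, h'⟩
      exact ⟨1, fun t ht h' => by linarith [h'.2]⟩
  have hlim : Filter.Tendsto (fun t : ℝ => iteratedFDeriv ℝ k (phi d (m+2)) (y + t • EuclideanSpace.single i e))
      (nhdsWithin 0 (Ioi 0)) (nhds (iteratedFDeriv ℝ k (phi d (m+2)) y)) := by
    have : Continuous (fun t : ℝ => iteratedFDeriv ℝ k (phi d (m+2)) (y + t • EuclideanSpace.single i e)) :=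
      hcont.comp (by fun_prop)
    have h := this.tendsto 0
    simp only [zero_smul, add_zero] at h
    exact h.mono_left nhdsWithin_le_nhds
  refine tendsto_nhds_unique hlim ?_
  refine tendsto_const_nhds.congr' ?_
  filter_upwards [self_mem_nhdsWithin] with t ht
  refine (hz _ fun h => ?_).symm
  have := h i
  simp at this
  exact he t ht (by simpa using this)

def rem {d : ℕ} (m : ℕ) (f : EE d → ℝ) (x v : EE d) : ℝ :=
  f (x + v) - ∑ k ∈ Finset.range (m+1), ((k.factorial : ℝ))⁻¹ * iteratedFDeriv ℝ k f x (fun _ => v)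

lemma rem_zero (d m : ℕ) (y v : EE d) (hy : y ∉ oc d) (hv : y + v ∉ oc d) :
    rem m (phi d (m+2)) y v = 0 := by
  unfold rem
  rw [phi_zero d _ (by omega) _ hv, Finset.sum_eq_zero, sub_zero]
  intro k hk
  rw [phi_deriv_zero d m k (by simp at hk; omega) y hy]
  simp

lemma phi_bdd (d m k : ℕ) (hk : k ≤ m + 1) : ∃ B : ℝ, 0 ≤ B ∧ ∀ y, ‖iteratedFDeriv ℝ k (phi d (m+2)) y‖ ≤ B := by
  have hcont : Continuous (iteratedFDeriv ℝ k (phi d (m+2))) :=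
    (phi_contDiff d m).continuous_iteratedFDeriv (by exact_mod_cast hk)
  have hc : HasCompactSupport (phi d (m+2)) :=
    (isCompact_cube d).of_isClosed_subset (isClosed_tsupport _) (tsupport_phi d _ (by omega))
  obtain ⟨B, hB⟩ := hcont.bounded_above_of_compact_support (hc.iteratedFDeriv k)
  exact ⟨B, (norm_nonneg _).trans (hB 0), hB⟩

lemma rem_bound (d m : ℕ) (β : ℝ) (h1 : m ≤ β) (h2 : β ≤ m + 1) :
    ∃ C : ℝ, 0 ≤ C ∧ ∀ y v, |rem m (phi d (m+2)) y v| ≤ C * ‖v‖ ^ β := by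
  choose! B hB0 hB using fun k => phi_bdd d m k
  have hS0 : 0 ≤ ∑ k ∈ Finset.range (m+1), B k := Finset.sum_nonneg fun k hk => hB0 k (by simp at hk; omega)
  refine ⟨B (m+1) + 1 + ∑ k ∈ Finset.range (m+1), B k, by linarith [hB0 (m+1) le_rfl], fun y v => ?_⟩
  rcases le_total ‖v‖ 1 with hv | hv
  · have hT := map_add_eq_sum_add_integral_iteratedFDeriv (f := phi d (m+2)) (x := y) (y := v) (n := m)
      (fun t _ => by exact_mod_cast (phi_contDiff d m).contDiffAt)
    have e : rem m (phi d (m+2)) y v = ((m.factorial : ℝ))⁻¹ • ∫ t in (0:ℝ)..1, (1 - t)^m • iteratedFDeriv ℝ (m + 1) (phi d (m+2)) (y + t • v) (fun _ ↦ v) := by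
      unfold rem
      rw [hT]
      simp only [smul_eq_mul]
      ring
    rw [e]
    have hI : ‖∫ t in (0:ℝ)..1, (1 - t)^m • iteratedFDeriv ℝ (m + 1) (phi d (m+2)) (y + t • v) (fun _ ↦ v)‖
        ≤ (B (m+1) * ‖v‖ ^ (m+1)) * |(1:ℝ) - 0| := by
      refine intervalIntegral.norm_integral_le_of_norm_le_const fun t ht => ?_
      rw [uIoc_of_le zero_le_one] at ht
      rw [norm_smul]
      have a1 : ‖(1 - t) ^ m‖ ≤ 1 := by
        rw [norm_pow, Real.norm_eq_abs, abs_of_nonneg (by linarith [ht.2])]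
        exact pow_le_one₀ (by linarith [ht.2]) (by linarith [ht.1])
      have a2 : ‖iteratedFDeriv ℝ (m + 1) (phi d (m+2)) (y + t • v) (fun _ ↦ v)‖ ≤ B (m+1) * ‖v‖ ^ (m+1) := by
        refine (ContinuousMultilinearMap.le_opNorm _ _).trans ?_
        simp only [Finset.prod_const, Finset.card_univ, Fintype.card_fin]
        gcongr
        exact hB (m+1) le_rfl _
      calc _ ≤ 1 * (B (m+1) * ‖v‖ ^ (m+1)) := mul_le_mul a1 a2 (norm_nonneg _) zero_le_one
        _ = _ := one_mul _
    have hpow : ‖v‖ ^ (m+1) ≤ ‖v‖ ^ β := by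
      rcases eq_or_lt_of_le (norm_nonneg v) with h | h
      · rw [← h]; simp; positivity
      · rw [← Real.rpow_natCast]
        exact Real.rpow_le_rpow_of_exponent_ge h hv (by push_cast; exact h2)
    have hf : ((m.factorial : ℝ))⁻¹ ≤ 1 := inv_le_one_of_one_le₀ (by exact_mod_cast Nat.one_le_iff_ne_zero.2 (Nat.factorial_ne_zero m))
    rw [smul_eq_mul, abs_mul, abs_of_nonneg (by positivity)]
    rw [Real.norm_eq_abs] at hI
    calc _ ≤ 1 * (B (m+1) * ‖v‖ ^ (m+1)) := by
          refine mul_le_mul hf (by simpa using hI) (abs_nonneg _) zero_le_one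
      _ ≤ B (m+1) * ‖v‖ ^ β := by rw [one_mul]; exact mul_le_mul_of_nonneg_left hpow (hB0 _ le_rfl)
      _ ≤ _ := by gcongr; linarith
  · have hone : 1 ≤ ‖v‖ ^ β := Real.one_le_rpow hv (by have : (0:ℝ) ≤ m := by positivity
                                                       linarith)
    have hk : ∀ k ∈ Finset.range (m+1), |((k.factorial : ℝ))⁻¹ * iteratedFDeriv ℝ k (phi d (m+2)) y (fun _ => v)|
        ≤ B k * ‖v‖ ^ β := by
      intro k hk
      simp only [Finset.mem_range] at hk
      have hf : ((k.factorial : ℝ))⁻¹ ≤ 1 := inv_le_one_of_one_le₀ (by exact_mod_cast Nat.one_le_iff_ne_zero.2 (Nat.factorial_ne_zero k))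
      have a2 : |iteratedFDeriv ℝ k (phi d (m+2)) y (fun _ ↦ v)| ≤ B k * ‖v‖ ^ k := by
        rw [← Real.norm_eq_abs]
        refine (ContinuousMultilinearMap.le_opNorm _ _).trans ?_
        simp only [Finset.prod_const, Finset.card_univ, Fintype.card_fin]
        gcongr
        exact hB k (by omega) _
      have hpow : ‖v‖ ^ k ≤ ‖v‖ ^ β := by
        rw [← Real.rpow_natCast]
        refine Real.rpow_le_rpow_of_exponent_le hv ?_
        have : (k:ℝ) ≤ m := by exact_mod_cast Nat.lt_succ_iff.1 hk
        linarith
      rw [abs_mul, abs_of_nonneg (by positivity : (0:ℝ) ≤ ((k.factorial : ℝ))⁻¹)]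
      calc _ ≤ 1 * (B k * ‖v‖ ^ k) := mul_le_mul hf a2 (abs_nonneg _) zero_le_one
        _ ≤ _ := by rw [one_mul]; exact mul_le_mul_of_nonneg_left hpow (hB0 _ (by omega))
    have hphi : |phi d (m+2) (y+v)| ≤ 1 * ‖v‖ ^ β := by
      rw [abs_of_nonneg (phi_nonneg _ _ _), one_mul]; exact (phi_le_one _ _ _).trans hone
    unfold rem
    calc _ ≤ |phi d (m+2) (y+v)| + |∑ k ∈ Finset.range (m+1), ((k.factorial : ℝ))⁻¹ * iteratedFDeriv ℝ k (phi d (m+2)) y (fun _ => v)| := abs_sub _ _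
      _ ≤ 1 * ‖v‖ ^ β + ∑ k ∈ Finset.range (m+1), B k * ‖v‖ ^ β :=
        add_le_add hphi ((Finset.abs_sum_le_sum_abs _ _).trans (Finset.sum_le_sum hk))
      _ = (0 + 1 + ∑ k ∈ Finset.range (m+1), B k) * ‖v‖ ^ β := by rw [← Finset.sum_mul]; ring
      _ ≤ _ := by gcongr; exact hB0 _ le_rfl


def cv {d : ℕ} (c : Fin d → ℕ) : EE d := WithLp.toLp 2 (fun i => (c i : ℝ))

lemma cv_apply {d : ℕ} (c : Fin d → ℕ) (i : Fin d) : (cv c) i = c i := rfl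

def GG (d p : ℕ) (N : ℝ) (I : Finset (Fin d → ℕ)) (s : (Fin d → ℕ) → ℝ) (x : EE d) : ℝ :=
  ∑ c ∈ I, s c * phi d p (N • x - cv c)

lemma bump_contDiff (d m : ℕ) (N : ℝ) (c : Fin d → ℕ) :
    ContDiff ℝ (m+1 : ℕ) (fun x : EE d => phi d (m+2) (N • x - cv c)) :=
  (phi_contDiff d m).comp (by fun_prop)

lemma bump_iter (d m : ℕ) (N : ℝ) (c : Fin d → ℕ) (k : ℕ) (hk : k ≤ m + 1) (x v : EE d) :
    iteratedFDeriv ℝ k (fun x : EE d => phi d (m+2) (N • x - cv c)) x (fun _ => v)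
      = iteratedFDeriv ℝ k (phi d (m+2)) (N • x - cv c) (fun _ => N • v) := by
  have e : (fun x : EE d => phi d (m+2) (N • x - cv c))
      = (fun y => phi d (m+2) (y - cv c)) ∘ (N • ContinuousLinearMap.id ℝ (EE d)) := by
    ext x; simp
  have hc : ContDiff ℝ (m+1 : ℕ) (fun y : EE d => phi d (m+2) (y - cv c)) :=
    (phi_contDiff d m).comp (by fun_prop)
  rw [e, ContinuousLinearMap.iteratedFDeriv_comp_right _ hc x (by exact_mod_cast hk)]
  rw [iteratedFDeriv_comp_sub]
  simp [Function.comp_def]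

lemma bump_rem (d m : ℕ) (N : ℝ) (c : Fin d → ℕ) (x v : EE d) :
    rem m (fun x : EE d => phi d (m+2) (N • x - cv c)) x v
      = rem m (phi d (m+2)) (N • x - cv c) (N • v) := by
  have e : N • (x + v) - cv c = N • x - cv c + N • v := by rw [smul_add, add_sub_right_comm]
  unfold rem
  rw [← e]
  rw [Finset.sum_congr rfl fun k hk => by
    rw [bump_iter d m N c k (by simp only [Finset.mem_range] at hk; omega)]]

lemma GG_contDiff (d m : ℕ) (N : ℝ) (I) (s) : ContDiff ℝ (m+1 : ℕ) (GG d (m+2) N I s) := by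
  unfold GG
  exact ContDiff.sum fun c _ => contDiff_const.mul (bump_contDiff d m N c)

lemma GG_iter (d m : ℕ) (N : ℝ) (I) (s) (b a : ℝ) (k : ℕ) (hk : k ≤ m + 1) (x v : EE d) :
    iteratedFDeriv ℝ k (fun x => b + a * GG d (m+2) N I s x) x (fun _ => v)
      = (if k = 0 then b else 0) + a * ∑ c ∈ I, s c *
        iteratedFDeriv ℝ k (fun x : EE d => phi d (m+2) (N • x - cv c)) x (fun _ => v) := by
  have hk' : (k : WithTop ℕ∞) ≤ (m + 1 : ℕ) := by exact_mod_cast hk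
  have hb : ∀ c, ContDiff ℝ k (fun x : EE d => phi d (m+2) (N • x - cv c)) := fun c =>
    (bump_contDiff d m N c).of_le hk'
  have hb' : ∀ c, ContDiff ℝ k ((a * s c) • fun x : EE d => phi d (m+2) (N • x - cv c)) := fun c =>
    contDiff_const.smul (hb c)
  have e : (fun x => b + a * GG d (m+2) N I s x)
      = (fun _ => b) + ∑ c ∈ I, (a * s c) • (fun x : EE d => phi d (m+2) (N • x - cv c)) := by
    ext x; simp [GG, Finset.mul_sum, mul_assoc]
  rw [e, iteratedFDeriv_add_apply contDiff_const.contDiffAt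
    (by apply ContDiff.contDiffAt; rw [Finset.sum_fn]; exact ContDiff.sum fun c _ => hb' c)]
  rw [ContinuousMultilinearMap.add_apply]
  congr 1
  · split_ifs with h
    · subst h; simp
    · rw [iteratedFDeriv_const_of_ne h]; rfl
  · rw [Finset.sum_fn, iteratedFDeriv_fun_sum_apply (fun c _ => (hb' c).contDiffAt)]
    rw [ContinuousMultilinearMap.sum_apply, Finset.mul_sum]
    refine Finset.sum_congr rfl fun c _ => ?_
    rw [iteratedFDeriv_const_smul_apply (hb c).contDiffAt]
    simp [mul_assoc]

lemma GG_rem (d m : ℕ) (N : ℝ) (I) (s) (b a : ℝ) (x v : EE d) :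
    rem m (fun x => b + a * GG d (m+2) N I s x) x v
      = a * ∑ c ∈ I, s c * rem m (phi d (m+2)) (N • x - cv c) (N • v) := by
  simp_rw [← bump_rem]
  unfold rem
  rw [Finset.sum_congr rfl fun k hk => by rw [GG_iter d m N I s b a k (by simp at hk; omega)]]
  simp_rw [mul_add, mul_sub, Finset.sum_add_distrib, Finset.sum_sub_distrib, mul_sub]
  have : ∑ k ∈ Finset.range (m+1), ((k.factorial : ℝ))⁻¹ * (if k = 0 then b else 0) = b := by
    rw [Finset.sum_eq_single 0] <;> simp +contextual
  rw [this]
  simp only [GG]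
  have : ∑ k ∈ Finset.range (m+1), ((k.factorial : ℝ))⁻¹ * (a * ∑ c ∈ I, s c *
        iteratedFDeriv ℝ k (fun x : EE d => phi d (m+2) (N • x - cv c)) x (fun _ => v))
      = a * ∑ c ∈ I, s c * ∑ k ∈ Finset.range (m+1), ((k.factorial : ℝ))⁻¹ *
        iteratedFDeriv ℝ k (fun x : EE d => phi d (m+2) (N • x - cv c)) x (fun _ => v) := by
    simp_rw [Finset.mul_sum]
    rw [Finset.sum_comm]
    refine Finset.sum_congr rfl fun c _ => Finset.sum_congr rfl fun k _ => by ring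
  rw [this]; ring

lemma cell_unique {d : ℕ} (y : EE d) (c c' : Fin d → ℕ) (h : y - cv c ∈ oc d) (h' : y - cv c' ∈ oc d) :
    c = c' := by
  funext i
  have a := h i; have b := h' i
  simp only [PiLp.sub_apply, cv_apply] at a b
  have h1 : (c i : ℝ) < c' i + 1 := by linarith
  have h2 : (c' i : ℝ) < c i + 1 := by linarith
  have h1' : c i < c' i + 1 := by exact_mod_cast h1
  have h2' : c' i < c i + 1 := by exact_mod_cast h2
  omega

/-- If at most the (unique) indices satisfying one of two properties contribute. -/
lemma sum_two {ι : Type*} [DecidableEq ι] (I : Finset ι) (f : ι → ℝ) (B : ℝ) (hB : 0 ≤ B) (p q : ι → Prop)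
    (hp : ∀ c c', p c → p c' → c = c') (hq : ∀ c c', q c → q c' → c = c')
    (hf : ∀ c, |f c| ≤ B) (h0 : ∀ c, ¬ p c → ¬ q c → f c = 0) : |∑ c ∈ I, f c| ≤ 2 * B := by
  classical
  have e : ∑ c ∈ I, f c = ∑ c ∈ I.filter (fun c => p c ∨ q c), f c := by
    rw [Finset.sum_filter_of_ne]
    intro c _ hc
    by_contra! h
    exact hc (h0 c h.1 h.2)
  rw [e]
  refine (Finset.abs_sum_le_sum_abs _ _).trans ?_
  refine (Finset.sum_le_card_nsmul _ _ B fun c _ => hf c).trans ?_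
  rw [nsmul_eq_mul]
  refine mul_le_mul_of_nonneg_right ?_ hB
  have h1 : (I.filter p).card ≤ 1 := Finset.card_le_one.2 fun a ha b hb =>
    hp a b (Finset.mem_filter.1 ha).2 (Finset.mem_filter.1 hb).2
  have h2 : (I.filter q).card ≤ 1 := Finset.card_le_one.2 fun a ha b hb =>
    hq a b (Finset.mem_filter.1 ha).2 (Finset.mem_filter.1 hb).2
  rw [Finset.filter_or]
  have := Finset.card_union_le (I.filter p) (I.filter q)
  have h3 : ((I.filter p) ∪ (I.filter q)).card ≤ 2 := by omega
  exact_mod_cast h3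

lemma GG_rem_le (d m : ℕ) (β C N : ℝ) (hN : 0 < N) (hC : 0 ≤ C)
    (hrem : ∀ y v, |rem m (phi d (m+2)) y v| ≤ C * ‖v‖ ^ β) (I) (s : (Fin d → ℕ) → ℝ) (hs : ∀ c, |s c| ≤ 1)
    (b a : ℝ) (ha : 0 ≤ a) (x v : EE d) :
    |rem m (fun x => b + (a * N ^ (-β)) * GG d (m+2) N I s x) x v| ≤ (2 * a * C) * ‖v‖ ^ β := by
  rw [GG_rem, abs_mul, abs_of_nonneg (by positivity)]
  have := sum_two I (fun c => s c * rem m (phi d (m+2)) (N • x - cv c) (N • v)) (C * ‖N • v‖ ^ β) (by positivity)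
    (fun c => N • x - cv c ∈ oc d) (fun c => N • (x + v) - cv c ∈ oc d)
    (fun c c' h h' => cell_unique _ c c' h h') (fun c c' h h' => cell_unique _ c c' h h')
    (fun c => by
      rw [abs_mul]
      calc _ ≤ 1 * (C * ‖N • v‖ ^ β) := mul_le_mul (hs c) (hrem _ _) (abs_nonneg _) zero_le_one
        _ = _ := one_mul _)
    (fun c h h' => by
      rw [rem_zero d m _ _ h, mul_zero]
      convert h' using 1
      rw [smul_add, add_sub_right_comm])
  calc _ ≤ a * N ^ (-β) * (2 * (C * ‖N • v‖ ^ β)) := by gcongr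
    _ = _ := by
      rw [norm_smul, Real.norm_of_nonneg hN.le, Real.mul_rpow hN.le (norm_nonneg _), Real.rpow_neg hN.le]
      have : N ^ β ≠ 0 := (Real.rpow_pos_of_pos hN _).ne'
      field_simp

def eta (d m : ℕ) (β a N : ℝ) (I : Finset (Fin d → ℕ)) (s : (Fin d → ℕ) → ℝ) (x : EE d) : ℝ :=
  1/2 + (a * N ^ (-β)) * GG d (m+2) N I s x

lemma eta_holder (d m : ℕ) (β C N L : ℝ) (hm : ⌈β⌉₊ - 1 = m) (hN : 0 < N) (hC : 0 ≤ C)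
    (hrem : ∀ y v, |rem m (phi d (m+2)) y v| ≤ C * ‖v‖ ^ β) (I) (s : (Fin d → ℕ) → ℝ) (hs : ∀ c, |s c| ≤ 1)
    (a : ℝ) (ha : 0 ≤ a) (haL : 2 * a * C ≤ L) : eta d m β a N I s ∈ holderClass d β L := by
  have hcd : ContDiff ℝ (m+1 : ℕ) (eta d m β a N I s) :=
    contDiff_const.add (contDiff_const.mul (GG_contDiff d m N I s))
  refine ⟨?_, fun x hx x' hx' => ?_⟩
  · rw [hm]
    exact (hcd.of_le (by exact_mod_cast Nat.le_succ m)).contDiffOn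
  · rw [hm]
    have h := GG_rem_le d m β C N hN hC hrem I s hs (1/2) a ha x (x' - x)
    refine le_trans ?_ (h.trans (mul_le_mul_of_nonneg_right haL (by positivity)))
    unfold rem
    rw [add_sub_cancel]
    refine le_of_eq ?_
    congr 2
    refine Finset.sum_congr rfl fun k hk => ?_
    rw [iteratedFDerivWithin_eq_iteratedFDeriv (uniqueDiff_cube d) (hcd.contDiffAt.of_le _) hx]
    · rfl
    · simp only [Finset.mem_range] at hk
      exact_mod_cast hk.le

lemma GG_cell (d m : ℕ) (N : ℝ) (I) (s : (Fin d → ℕ) → ℝ) (x : EE d) (c) (hc : c ∈ I)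
    (h : N • x - cv c ∈ oc d) : GG d (m+2) N I s x = s c * phi d (m+2) (N • x - cv c) := by
  unfold GG
  refine Finset.sum_eq_single c (fun c' _ hne => ?_) (fun h' => absurd hc h')
  rw [phi_zero d _ (by omega), mul_zero]
  exact fun h' => hne (cell_unique _ _ _ h' h)

lemma GG_out (d m : ℕ) (N : ℝ) (I) (s : (Fin d → ℕ) → ℝ) (x : EE d)
    (h : ∀ c ∈ I, N • x - cv c ∉ oc d) : GG d (m+2) N I s x = 0 := by
  unfold GG
  refine Finset.sum_eq_zero (fun c' hc' => ?_)
  rw [phi_zero d _ (by omega) _ (h c' hc'), mul_zero]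

lemma GG_abs (d m : ℕ) (N : ℝ) (I) (s : (Fin d → ℕ) → ℝ) (hs : ∀ c, |s c| ≤ 1) (x : EE d) :
    |GG d (m+2) N I s x| ≤ 1 := by
  by_cases h : ∃ c ∈ I, N • x - cv c ∈ oc d
  · obtain ⟨c, hc, h⟩ := h
    rw [GG_cell d m N I s x c hc h, abs_mul, abs_of_nonneg (phi_nonneg _ _ _)]
    calc _ ≤ (1:ℝ) * 1 := mul_le_mul (hs c) (phi_le_one _ _ _) (phi_nonneg _ _ _) zero_le_one
      _ = 1 := one_mul _
  · push Not at h
    rw [GG_out d m N I s x h]; simp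

lemma eta_bound (d m : ℕ) (β a N : ℝ) (hN : 0 < N) (ha : 0 ≤ a) (I) (s : (Fin d → ℕ) → ℝ) (hs : ∀ c, |s c| ≤ 1)
    (x : EE d) : |2 * eta d m β a N I s x - 1| ≤ 2 * a * N ^ (-β) := by
  have h := GG_abs d m N I s hs x
  have : 2 * eta d m β a N I s x - 1 = 2 * a * N ^ (-β) * GG d (m+2) N I s x := by unfold eta; ring
  rw [this, abs_mul, abs_of_nonneg (by positivity)]
  exact mul_le_of_le_one_right (by positivity) h

lemma eta_meas (d m : ℕ) (β a N : ℝ) (I) (s : (Fin d → ℕ) → ℝ) : Measurable (eta d m β a N I s) :=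
  ((contDiff_const.add (contDiff_const.mul (GG_contDiff d m N I s)) :
    ContDiff ℝ (m+1 : ℕ) (eta d m β a N I s))).continuous.measurable

lemma eta_01 (d m : ℕ) (β a N : ℝ) (hβ : 0 < β) (hN : 1 ≤ N) (ha : 0 ≤ a) (ha4 : a ≤ 1/4) (I)
    (s : (Fin d → ℕ) → ℝ) (hs : ∀ c, |s c| ≤ 1) (x : EE d) : eta d m β a N I s x ∈ Icc (0:ℝ) 1 := by
  have h := eta_bound d m β a N (by linarith) ha I s hs x
  have h1 : N ^ (-β) ≤ 1 := Real.rpow_le_one_of_one_le_of_nonpos hN (by linarith)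
  have h0 : 0 ≤ N ^ (-β) := by positivity
  have : 2 * a * N ^ (-β) ≤ 1 := by nlinarith
  have := abs_le.1 (h.trans this)
  constructor <;> linarith [this.1, this.2]


def gcond (ρ : ℝ) (l b : ℕ) : Prop :=
  (1-ρ)/8 * ρ^l * 2^l ≤ ((b % 2^l : ℕ) : ℝ) + 1/2 ∧ ((b % 2^l : ℕ) : ℝ) + 1/2 ≤ (1 - (1-ρ)/8 * ρ^l) * 2^l

def gall (ρ : ℝ) (j b : ℕ) : Prop := ∀ l ∈ Finset.range (j+1), gcond ρ l b

open Classical in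
def Good1 (ρ : ℝ) (j : ℕ) : Finset ℕ :=
  (Finset.range (2^j)).filter fun b => gall ρ j b

lemma card_small (M : ℕ) (t : ℝ) (ht : 0 ≤ t) (R : Finset ℕ) (hR : ∀ r ∈ R, (r:ℝ) + 1/2 < t) :
    (R.card : ℝ) ≤ 2 * t := by
  rcases le_or_gt t (1/2) with h | h
  · have : R = ∅ := by
      refine Finset.eq_empty_of_forall_notMem fun r hr => ?_
      have := hR r hr
      have : (0:ℝ) ≤ r := by positivity
      linarith
    subst this; simp [ht]
  · have hs : R ⊆ Finset.range ⌈t - 1/2⌉₊ := fun r hr => by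
      rw [Finset.mem_range, Nat.lt_ceil]
      linarith [hR r hr]
    have h1 := Finset.card_le_card hs
    rw [Finset.card_range] at h1
    have h2 : ((⌈t - 1/2⌉₊ : ℕ) : ℝ) < t - 1/2 + 1 := Nat.ceil_lt_add_one (by linarith)
    have h3 : (R.card : ℝ) ≤ ⌈t - 1/2⌉₊ := by exact_mod_cast h1
    linarith

lemma card_resid (M : ℕ) (t : ℝ) (ht : 0 ≤ t) (R : Finset ℕ) (hM : ∀ r ∈ R, r < M)
    (hR : ∀ r ∈ R, (r:ℝ) + 1/2 < t ∨ (M:ℝ) - t < r + 1/2) : (R.card : ℝ) ≤ 4 * t := by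
  classical
  have h1 := card_small M t ht (R.filter fun r => (r:ℝ) + 1/2 < t) (fun r hr => (Finset.mem_filter.1 hr).2)
  have h2 := card_small M t ht ((R.filter fun r : ℕ => ¬ ((r:ℝ) + 1/2 < t)).image fun r => M - 1 - r) (by
    intro r' hr'
    obtain ⟨r, hr, rfl⟩ := Finset.mem_image.1 hr'
    obtain ⟨hr, hn⟩ := Finset.mem_filter.1 hr
    have h := (hR r hr).resolve_left hn
    have : ((M - 1 - r : ℕ) : ℝ) = M - 1 - r := by
      have := hM r hr
      rw [Nat.cast_sub (by omega), Nat.cast_sub (by omega)]; simp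
    rw [this]; linarith)
  rw [Finset.card_image_of_injOn] at h2
  · have := Finset.card_filter_add_card_filter_not (s := R) (fun r : ℕ => (r:ℝ) + 1/2 < t)
    have : ((R.filter fun r : ℕ => (r:ℝ) + 1/2 < t).card : ℝ) + (R.filter fun r : ℕ => ¬ ((r:ℝ) + 1/2 < t)).card = R.card := by
      exact_mod_cast this
    linarith
  · intro x hx y hy hxy
    have := hM x (Finset.mem_filter.1 hx).1
    have := hM y (Finset.mem_filter.1 hy).1
    simp only at hxy
    omega

open Classical in
lemma card_bad (ρ : ℝ) (h0 : 0 < ρ) (h1 : ρ < 1) (j l : ℕ) (hl : l ≤ j) :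
    (((Finset.range (2^j)).filter fun b => ¬ gcond ρ l b).card : ℝ) ≤ 4 * ((1-ρ)/8 * ρ^l) * 2^j := by
  set S := (Finset.range (2^j)).filter fun b => ¬ gcond ρ l b
  set R := S.image fun b => b % 2^l
  have hR : (R.card : ℝ) ≤ 4 * ((1-ρ)/8 * ρ^l * 2^l) := by
    refine card_resid (2^l) _ (by have : 0 < 1 - ρ := by linarith
                                  positivity) R ?_ ?_
    · intro r hr
      obtain ⟨b, _, rfl⟩ := Finset.mem_image.1 hr
      exact Nat.mod_lt _ (by positivity)
    · intro r hr
      obtain ⟨b, hb, rfl⟩ := Finset.mem_image.1 hr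
      have := (Finset.mem_filter.1 hb).2
      unfold gcond at this
      rw [not_and_or, not_le, not_le] at this
      refine this.imp id fun h => ?_
      push_cast at h ⊢
      linarith
  have hS : S.card ≤ R.card * 2^(j-l) := by
    have : S.card ≤ (R ×ˢ Finset.range (2^(j-l))).card := by
      refine Finset.card_le_card_of_injOn (fun b => (b % 2^l, b / 2^l)) ?_ ?_
      · intro b hb
        simp only [Finset.coe_product, Set.mem_prod, Finset.mem_coe]
        refine ⟨Finset.mem_image_of_mem _ hb, ?_⟩
        rw [Finset.mem_range, Nat.div_lt_iff_lt_mul (by positivity), ← pow_add, Nat.sub_add_cancel hl]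
        exact Finset.mem_range.1 (Finset.mem_filter.1 hb).1
      · intro b _ b' _ h
        simp only [Prod.mk.injEq] at h
        rw [← Nat.mod_add_div b (2^l), ← Nat.mod_add_div b' (2^l), h.1, h.2]
    rwa [Finset.card_product, Finset.card_range] at this
  have hS' : (S.card : ℝ) ≤ R.card * 2^(j-l) := by exact_mod_cast hS
  calc (S.card : ℝ) ≤ R.card * 2^(j-l) := hS'
    _ ≤ 4 * ((1-ρ)/8 * ρ^l * 2^l) * 2^(j-l) := by gcongr
    _ = 4 * ((1-ρ)/8 * ρ^l) * (2^l * 2^(j-l)) := by ring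
    _ = _ := by rw [← pow_add, Nat.add_sub_cancel' hl]

lemma card_Good1 (ρ : ℝ) (h0 : 0 < ρ) (h1 : ρ < 1) (j : ℕ) : (2:ℝ)^j / 2 ≤ (Good1 ρ j).card := by
  classical
  have hc := Finset.card_filter_add_card_filter_not (s := Finset.range (2^j))
    (fun b => gall ρ j b)
  have hsub : ((Finset.range (2^j)).filter fun b => ¬ gall ρ j b)
      ⊆ (Finset.range (j+1)).biUnion fun l => (Finset.range (2^j)).filter fun b => ¬ gcond ρ l b := by
    intro b hb
    obtain ⟨hb, hn⟩ := Finset.mem_filter.1 hb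
    unfold gall at hn
    push Not at hn
    obtain ⟨l, hl, hn⟩ := hn
    exact Finset.mem_biUnion.2 ⟨l, hl, Finset.mem_filter.2 ⟨hb, hn⟩⟩
  have h2 := (Finset.card_le_card hsub).trans Finset.card_biUnion_le
  have h3 : (((Finset.range (2^j)).filter fun b => ¬ gall ρ j b).card : ℝ)
      ≤ ∑ l ∈ Finset.range (j+1), 4 * ((1-ρ)/8 * ρ^l) * 2^j := by
    refine le_trans (b := ((∑ l ∈ Finset.range (j+1), ((Finset.range (2^j)).filter fun b => ¬ gcond ρ l b).card : ℕ) : ℝ)) (by exact_mod_cast h2) ?_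
    rw [Nat.cast_sum]
    exact Finset.sum_le_sum fun l hl => card_bad ρ h0 h1 j l (by simp only [Finset.mem_range] at hl; omega)
  have h4 : ∑ l ∈ Finset.range (j+1), 4 * ((1-ρ)/8 * ρ^l) * 2^j = (1-ρ^(j+1)) * 2^j / 2 := by
    have := mul_neg_geom_sum ρ (j+1)
    rw [← this, Finset.mul_sum, Finset.sum_mul, Finset.sum_div]
    refine Finset.sum_congr rfl fun l _ => by ring
  have h5 : ((Good1 ρ j).card : ℝ) + ((Finset.range (2^j)).filter fun b => ¬ gall ρ j b).card = 2^j := by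
    rw [Finset.card_range] at hc
    unfold Good1
    exact_mod_cast hc
  have h6 : (1-ρ^(j+1)) * 2^j / 2 ≤ 2^j / 2 := by
    have : 0 ≤ ρ^(j+1) * 2^j := by positivity
    linarith
  linarith

def Good (d : ℕ) (ρ : ℝ) (j : ℕ) : Finset (Fin d → ℕ) := Fintype.piFinset fun _ => Good1 ρ j

lemma card_Good_le (d : ℕ) (ρ : ℝ) (j : ℕ) : ((Good d ρ j).card : ℝ) ≤ (2^j)^d := by
  classical
  have : (Good1 ρ j).card ≤ 2^j := by
    have := Finset.card_filter_le (Finset.range (2^j)) (fun b => gall ρ j b)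
    unfold Good1
    rw [Finset.card_range] at this
    convert this
  unfold Good
  rw [Fintype.card_piFinset]
  simp only [Finset.prod_const, Finset.card_univ, Fintype.card_fin]
  exact_mod_cast Nat.pow_le_pow_left this d

lemma card_Good (d : ℕ) (ρ : ℝ) (h0 : 0 < ρ) (h1 : ρ < 1) (j : ℕ) :
    ((2:ℝ)^j / 2)^d ≤ (Good d ρ j).card := by
  unfold Good
  rw [Fintype.card_piFinset]
  simp only [Finset.prod_const, Finset.card_univ, Fintype.card_fin]
  push_cast
  exact pow_le_pow_left₀ (by positivity) (card_Good1 ρ h0 h1 j) d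

lemma Good_pos (d : ℕ) (ρ : ℝ) (h0 : 0 < ρ) (h1 : ρ < 1) (j : ℕ) : (0:ℝ) < (Good d ρ j).card :=
  lt_of_lt_of_le (by positivity) (card_Good d ρ h0 h1 j)

lemma mem_Good {d : ℕ} {ρ : ℝ} {j : ℕ} {c : Fin d → ℕ} (h : c ∈ Good d ρ j) (i : Fin d) :
    c i < 2^j ∧ ∀ l ≤ j, gcond ρ l (c i) := by
  have := (Fintype.mem_piFinset.1 h) i
  classical
  unfold Good1 at this
  obtain ⟨h1, h2⟩ := Finset.mem_filter.1 this
  exact ⟨Finset.mem_range.1 h1, fun l hl => h2 l (Finset.mem_range.2 (by omega))⟩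

/-- atom -/
def atm {d : ℕ} (j : ℕ) (c : Fin d → ℕ) : EE d := WithLp.toLp 2 (fun i => ((c i : ℝ) + 1/2) / 2^j)

lemma atm_apply {d : ℕ} (j : ℕ) (c : Fin d → ℕ) (i : Fin d) : atm j c i = ((c i : ℝ) + 1/2) / 2^j := rfl

lemma atm_mem {d : ℕ} {ρ : ℝ} {j : ℕ} {c : Fin d → ℕ} (h : c ∈ Good d ρ j) : atm j c ∈ unitCube d := by
  intro i
  rw [atm_apply]
  have h1 := (mem_Good h i).1
  have h2 : (c i : ℝ) + 1 ≤ 2^j := by exact_mod_cast h1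
  constructor
  · positivity
  · rw [div_le_one (by positivity)]; linarith

lemma atm_ne_zero {d : ℕ} (hd : 0 < d) (j : ℕ) (c : Fin d → ℕ) : atm j c ≠ 0 := by
  intro h
  have h1 : atm j c ⟨0, hd⟩ = 0 := by rw [h]; rfl
  rw [atm_apply] at h1
  have : 0 < ((c ⟨0, hd⟩ : ℝ) + 1/2) / 2^j := by positivity
  linarith

lemma atm_scale {d : ℕ} (j : ℕ) (c : Fin d → ℕ) (i : Fin d) :
    ((2:ℝ)^j • atm j c - cv c) i = 1/2 := by
  rw [PiLp.sub_apply, PiLp.smul_apply, atm_apply, cv_apply, smul_eq_mul]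
  have : (2:ℝ)^j ≠ 0 := by positivity
  field_simp; ring

lemma atm_cell {d : ℕ} (j : ℕ) (c : Fin d → ℕ) : (2:ℝ)^j • atm j c - cv c ∈ oc d := by
  intro i
  rw [atm_scale]; norm_num

lemma atm_fine {d : ℕ} (hd : 0 < d) (j k : ℕ) (hjk : j < k) (c c' : Fin d → ℕ) :
    (2:ℝ)^k • atm j c' - cv c ∉ oc d := by
  intro h
  have := h ⟨0, hd⟩
  rw [PiLp.sub_apply, PiLp.smul_apply, atm_apply, cv_apply, smul_eq_mul] at this
  obtain ⟨l, rfl⟩ : ∃ l, k = j + 1 + l := ⟨k - (j+1), by omega⟩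
  have e : (2:ℝ)^(j+1+l) * (((c' ⟨0, hd⟩ : ℝ) + 1/2) / 2^j) = ((2^l * (2 * c' ⟨0, hd⟩ + 1) : ℕ) : ℝ) := by
    have : (2:ℝ)^j ≠ 0 := by positivity
    rw [pow_add, pow_add]; push_cast; field_simp
  rw [e] at this
  obtain ⟨a, b⟩ := this
  generalize 2^l * (2 * c' ⟨0, hd⟩ + 1) = A at a b
  have a' : c ⟨0, hd⟩ < A := by have : ((c ⟨0, hd⟩ : ℕ) : ℝ) < A := by linarith
                                exact_mod_cast this
  have b' : A < c ⟨0, hd⟩ + 1 := by have : (A : ℝ) < (c ⟨0, hd⟩ : ℕ) + 1 := by linarith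
                                    exact_mod_cast this
  omega

lemma atm_coarse {d : ℕ} (ρ : ℝ) (h0 : 0 < ρ) (h1 : ρ < 1) (j k : ℕ) (hjk : k ≤ j) (c c' : Fin d → ℕ)
    (hc' : c' ∈ Good d ρ j) (h : (2:ℝ)^k • atm j c' - cv c ∈ oc d) (p : ℕ) :
    (((1-ρ)/8 * ρ^(j-k)) ^ p) ^ d ≤ phi d p ((2:ℝ)^k • atm j c' - cv c) := by
  refine phi_lower d p _ _ (by have : 0 < 1 - ρ := by linarith
                               positivity) fun i => ?_
  have hi := h i
  obtain ⟨l, rfl⟩ : ∃ l, j = k + l := ⟨j - k, by omega⟩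
  rw [Nat.add_sub_cancel_left]
  obtain ⟨g1, g2⟩ := (mem_Good hc' i).2 l (by omega)
  rw [PiLp.sub_apply, PiLp.smul_apply, atm_apply, cv_apply, smul_eq_mul] at hi ⊢
  have hdm : ((c' i : ℕ) : ℝ) = ((c' i % 2^l : ℕ) : ℝ) + 2^l * ((c' i / 2^l : ℕ) : ℝ) := by
    exact_mod_cast (Nat.mod_add_div (c' i) (2^l)).symm
  have hlt : ((c' i % 2^l : ℕ) : ℝ) + 1 ≤ 2^l := by
    exact_mod_cast Nat.mod_lt (c' i) (by positivity : 0 < 2^l)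
  have hP : (0:ℝ) < 2^l := by positivity
  have e : (2:ℝ)^k * (((c' i : ℝ) + 1/2) / 2^(k+l))
      = (((c' i % 2^l : ℕ) : ℝ) + 1/2) / 2^l + ((c' i / 2^l : ℕ) : ℝ) := by
    have : (2:ℝ)^k ≠ 0 := by positivity
    rw [pow_add, hdm]; field_simp; ring
  rw [e] at hi ⊢
  set f := (((c' i % 2^l : ℕ) : ℝ) + 1/2) / 2^l with hf
  have f0 : 0 < f := by positivity
  have f1 : f < 1 := by rw [hf, div_lt_one hP]; linarith
  have hq : c i = c' i / 2^l := by
    generalize c' i / 2^l = A at hi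
    have a' : c i < A + 1 := by have : ((c i : ℕ) : ℝ) < A + 1 := by linarith [hi.1]
                                exact_mod_cast this
    have b' : A < c i + 1 := by have : (A : ℝ) < (c i : ℕ) + 1 := by linarith [hi.2]
                                exact_mod_cast this
    omega
  rw [hq, add_sub_cancel_right]
  constructor
  · rw [hf, le_div_iff₀ hP]; exact g1
  · rw [hf, div_le_iff₀ hP]; exact g2

/-- Key evaluation at the atoms. -/
lemma atm_eval {d : ℕ} (hd : 0 < d) (m : ℕ) (β a q ρ : ℝ) (hq : q = 2^(-β)) (h0 : 0 < ρ) (h1 : ρ < 1)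
    (hρ : (ρ^(m+2))^d = q) (ha : 0 < a) (j k : ℕ) (c') (hc' : c' ∈ Good d ρ j) (s : (Fin d → ℕ) → ℝ)
    (hs : ∀ c, |s c| = 1) (I) (hne : 0 < |eta d m β a (2^k) I s (atm j c') - 1/2|) :
    k ≤ j ∧ a * (((1-ρ)/8) ^ (m+2)) ^ d * q ^ j ≤ |eta d m β a (2^k) I s (atm j c') - 1/2| := by
  have e : eta d m β a (2^k) I s (atm j c') - 1/2 = a * q^k * GG d (m+2) (2^k) I s (atm j c') := by
    have : ((2:ℝ)^k) ^ (-β) = q^k := by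
      rw [hq, ← Real.rpow_natCast, ← Real.rpow_natCast, ← Real.rpow_mul (by norm_num), ← Real.rpow_mul (by norm_num), mul_comm]
    unfold eta; rw [this]; ring
  have q0 : 0 < q := by rw [hq]; positivity
  rw [e] at hne ⊢
  by_cases h : ∃ c ∈ I, (2:ℝ)^k • atm j c' - cv c ∈ oc d
  · obtain ⟨c, hc, h⟩ := h
    have hkj : k ≤ j := by
      by_contra! hlt
      exact atm_fine hd j k hlt c c' h
    refine ⟨hkj, ?_⟩
    rw [GG_cell d m _ I s _ c hc h, abs_mul, abs_mul (s c), hs c, one_mul, abs_of_nonneg (by positivity),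
      abs_of_nonneg (phi_nonneg _ _ _)]
    have := atm_coarse ρ h0 h1 j k hkj c c' hc' h (m+2)
    calc _ = a * q^k * ((((1-ρ)/8) ^ (m+2)) ^ d * q^(j-k)) := by
          have : q^j = q^k * q^(j-k) := by rw [← pow_add, Nat.add_sub_cancel' hkj]
          rw [this]; ring
      _ = a * q^k * ((((1-ρ)/8 * ρ^(j-k)) ^ (m+2)) ^ d) := by
          rw [← hρ, mul_pow, mul_pow]; congr 2
          rw [← pow_mul, ← pow_mul, ← pow_mul, ← pow_mul]; congr 1; ring
      _ ≤ _ := by gcongr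
  · push Not at h
    rw [GG_out d m _ I s _ h] at hne
    simp at hne

lemma eta_zero {d : ℕ} (hd : 0 < d) (m : ℕ) (β a N : ℝ) (I) (s : (Fin d → ℕ) → ℝ) :
    eta d m β a N I s 0 = 1/2 := by
  unfold eta
  rw [GG_out d m, mul_zero, add_zero]
  intro c _ h
  have := (h ⟨0, hd⟩).1
  rw [smul_zero, zero_sub, PiLp.neg_apply, cv_apply] at this
  have : (0:ℝ) ≤ c ⟨0, hd⟩ := by positivity
  linarith


def UU (d : ℕ) (ρ : ℝ) (j : ℕ) : Measure (EE d) :=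
  ∑ c ∈ Good d ρ j, ((Good d ρ j).card : ℝ≥0∞)⁻¹ • Measure.dirac (atm j c)

def mu (d : ℕ) (ρ r c0 : ℝ) : Measure (EE d) :=
  ENNReal.ofReal c0 • Measure.sum (fun j : ℕ => ENNReal.ofReal ((1-r) * r^j) • UU d ρ j)
    + ENNReal.ofReal (1-c0) • Measure.dirac 0

open Classical in
lemma UU_apply (d : ℕ) (ρ : ℝ) (j : ℕ) (T : Set (EE d)) (hT : MeasurableSet T) :
    UU d ρ j T = ∑ c ∈ Good d ρ j, if atm j c ∈ T then ((Good d ρ j).card : ℝ≥0∞)⁻¹ else 0 := by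
  unfold UU
  rw [Measure.finset_sum_apply]
  refine Finset.sum_congr rfl fun c _ => ?_
  rw [Measure.smul_apply, Measure.dirac_apply' _ hT, smul_eq_mul]
  by_cases h : atm j c ∈ T <;> simp [h]

lemma UU_full (d : ℕ) (ρ : ℝ) (h0 : 0 < ρ) (h1 : ρ < 1) (j : ℕ) (T : Set (EE d)) (hT : MeasurableSet T)
    (h : ∀ c ∈ Good d ρ j, atm j c ∈ T) : UU d ρ j T = 1 := by
  classical
  rw [UU_apply d ρ j T hT, Finset.sum_congr rfl fun c hc => if_pos (h c hc), Finset.sum_const, nsmul_eq_mul]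
  refine ENNReal.mul_inv_cancel ?_ (by simp)
  have := Good_pos d ρ h0 h1 j
  exact_mod_cast this.ne'

lemma UU_le (d : ℕ) (ρ : ℝ) (h0 : 0 < ρ) (h1 : ρ < 1) (j : ℕ) (T : Set (EE d)) : UU d ρ j T ≤ 1 := by
  rw [← UU_full d ρ h0 h1 j univ .univ (fun _ _ => mem_univ _)]
  exact measure_mono (subset_univ _)

lemma UU_zero (d : ℕ) (ρ : ℝ) (j : ℕ) (T : Set (EE d)) (hT : MeasurableSet T)
    (h : ∀ c ∈ Good d ρ j, atm j c ∉ T) : UU d ρ j T = 0 := by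
  classical
  rw [UU_apply d ρ j T hT]
  exact Finset.sum_eq_zero fun c hc => if_neg (h c hc)

lemma UU_ge (d : ℕ) (ρ : ℝ) (j : ℕ) (T : Set (EE d)) (hT : MeasurableSet T) (S) (hS : S ⊆ Good d ρ j)
    (h : ∀ c ∈ S, atm j c ∈ T) : (S.card : ℝ≥0∞) * ((Good d ρ j).card : ℝ≥0∞)⁻¹ ≤ UU d ρ j T := by
  classical
  rw [UU_apply d ρ j T hT]
  refine le_trans ?_ (Finset.sum_le_sum_of_subset hS)
  rw [Finset.sum_congr rfl fun c hc => if_pos (h c hc), Finset.sum_const, nsmul_eq_mul]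

lemma mu_apply (d : ℕ) (ρ r c0 : ℝ) (T : Set (EE d)) (hT : MeasurableSet T) :
    mu d ρ r c0 T = ENNReal.ofReal c0 * (∑' j : ℕ, ENNReal.ofReal ((1-r) * r^j) * UU d ρ j T)
      + ENNReal.ofReal (1-c0) * T.indicator 1 0 := by
  unfold mu
  rw [Measure.add_apply, Measure.smul_apply, Measure.smul_apply, Measure.sum_apply _ hT, Measure.dirac_apply' _ hT]
  simp only [Measure.smul_apply, smul_eq_mul]

lemma geo (r : ℝ) (h0 : 0 < r) (h1 : r < 1) : ∑' j : ℕ, ENNReal.ofReal ((1-r) * r^j) = 1 := by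
  rw [← ENNReal.ofReal_tsum_of_nonneg (fun j => by have : 0 < 1 - r := by linarith
                                                   positivity)
    ((summable_geometric_of_lt_one h0.le h1).mul_left _), tsum_mul_left, tsum_geometric_of_lt_one h0.le h1,
    mul_inv_cancel₀ (by linarith), ENNReal.ofReal_one]

lemma mu_full (d : ℕ) (ρ r c0 : ℝ) (h0 : 0 < ρ) (h1 : ρ < 1) (r0 : 0 < r) (r1 : r < 1) (hc : 0 < c0) (hc1 : c0 ≤ 1)
    (T : Set (EE d)) (hT : MeasurableSet T) (h : ∀ j, ∀ c ∈ Good d ρ j, atm j c ∈ T) (hz : 0 ∈ T) :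
    mu d ρ r c0 T = 1 := by
  rw [mu_apply _ _ _ _ T hT]
  simp_rw [fun j => UU_full d ρ h0 h1 j T hT (h j), mul_one]
  rw [geo r r0 r1, Set.indicator_of_mem hz, Pi.one_apply, mul_one, mul_one, ← ENNReal.ofReal_add hc.le (by linarith)]
  simp

lemma mu_prob (d : ℕ) (ρ r c0 : ℝ) (h0 : 0 < ρ) (h1 : ρ < 1) (r0 : 0 < r) (r1 : r < 1) (hc : 0 < c0) (hc1 : c0 ≤ 1) :
    IsProbabilityMeasure (mu d ρ r c0) :=
  ⟨mu_full d ρ r c0 h0 h1 r0 r1 hc hc1 univ .univ (fun _ _ _ => mem_univ _) (mem_univ _)⟩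

lemma mu_cube (d : ℕ) (ρ r c0 : ℝ) (h0 : 0 < ρ) (h1 : ρ < 1) (r0 : 0 < r) (r1 : r < 1) (hc : 0 < c0) (hc1 : c0 ≤ 1) :
    mu d ρ r c0 (unitCube d) = 1 :=
  mu_full d ρ r c0 h0 h1 r0 r1 hc hc1 _ (isClosed_cube d).measurableSet (fun _ _ h => atm_mem h)
    (fun i => by simp)

lemma mu_le (d : ℕ) (ρ r c0 : ℝ) (h0 : 0 < ρ) (h1 : ρ < 1) (r0 : 0 < r) (r1 : r < 1) (hc : 0 < c0)
    (T : Set (EE d)) (hT : MeasurableSet T) (j0 : ℕ) (h : ∀ j, ∀ c ∈ Good d ρ j, atm j c ∈ T → j0 ≤ j)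
    (hz : 0 ∉ T) : mu d ρ r c0 T ≤ ENNReal.ofReal (c0 * r^j0) := by
  rw [mu_apply _ _ _ _ T hT, Set.indicator_of_notMem hz, mul_zero, add_zero, ENNReal.ofReal_mul hc.le]
  gcongr
  rw [← (ENNReal.summable (f := fun i => ENNReal.ofReal ((1-r) * r^(i + j0)) * UU d ρ (i+j0) T)).sum_add_tsum_nat_add'
    (f := fun j => ENNReal.ofReal ((1-r) * r^j) * UU d ρ j T)]
  rw [Finset.sum_eq_zero, zero_add]
  · calc _ ≤ ∑' j : ℕ, ENNReal.ofReal (r^j0) * ENNReal.ofReal ((1-r) * r^j) := by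
          refine ENNReal.tsum_le_tsum fun j => ?_
          refine (mul_le_mul_right (UU_le d ρ h0 h1 _ T) _).trans ?_
          rw [mul_one, ← ENNReal.ofReal_mul (by positivity)]
          refine ENNReal.ofReal_le_ofReal (le_of_eq ?_)
          rw [pow_add]; ring
      _ = _ := by rw [ENNReal.tsum_mul_left, geo r r0 r1, mul_one]
  · intro j hj
    rw [UU_zero d ρ j T hT, mul_zero]
    intro c hc hm
    have := h j c hc hm
    simp only [Finset.mem_range] at hj; omega

lemma mu_ge (d : ℕ) (ρ r c0 : ℝ) (h0 : 0 < ρ) (h1 : ρ < 1) (r0 : 0 < r) (r1 : r < 1) (hc : 0 < c0)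
    (k : ℕ) (T : Set (EE d)) (hT : MeasurableSet T) (S) (hS : S ⊆ Good d ρ k)
    (h : ∀ c ∈ S, atm k c ∈ T) :
    ENNReal.ofReal (c0 * ((1-r) * r^k * (S.card / (Good d ρ k).card))) ≤ mu d ρ r c0 T := by
  rw [mu_apply _ _ _ _ T hT, ENNReal.ofReal_mul hc.le]
  refine le_trans ?_ le_self_add
  gcongr
  refine le_trans ?_ (ENNReal.le_tsum k)
  have : 0 < 1 - r := by linarith
  rw [ENNReal.ofReal_mul (by positivity)]
  gcongr
  refine le_trans ?_ (UU_ge d ρ k T hT S hS h)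
  rw [ENNReal.ofReal_div_of_pos (Good_pos d ρ h0 h1 k), ENNReal.ofReal_natCast, ENNReal.ofReal_natCast, div_eq_mul_inv]

lemma eta_margin {d : ℕ} (hd : 0 < d) (m : ℕ) (α β a q ρ c0 Cm : ℝ) (hα : 0 < α) (hq : q = 2^(-β)) (h0 : 0 < ρ) (h1 : ρ < 1)
    (q0 : 0 < q) (q1 : q < 1) (hc : 0 < c0) (hCm : 0 < Cm)
    (hρ : (ρ^(m+2))^d = q) (ha : 0 < a) (hcm : c0 ≤ Cm * (a * (((1-ρ)/8) ^ (m+2)) ^ d) ^ α)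
    (k : ℕ) (s : (Fin d → ℕ) → ℝ) (hs : ∀ c, |s c| = 1) (I) :
    MarginCond (mu d ρ (q^α) c0) (eta d m β a (2^k) I s) α Cm := by
  intro t ht _
  set A := a * (((1-ρ)/8) ^ (m+2)) ^ d with hA
  have A0 : 0 < A := by have : 0 < 1 - ρ := by linarith
                        positivity
  rcases ht.eq_or_lt with h | h
  · have : {x | 0 < |eta d m β a (2^k) I s x - 1/2| ∧ |eta d m β a (2^k) I s x - 1/2| ≤ t} = ∅ := by
      ext x; simp only [mem_setOf_eq, mem_empty_iff_false, iff_false, not_and, not_le]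
      intro hx; rw [← h]; exact hx
    rw [this]; simp; positivity
  · have hex : ∃ j, q^j ≤ t / A := by
      obtain ⟨j, hj⟩ := exists_pow_lt_of_lt_one (div_pos h A0) q1
      exact ⟨j, hj.le⟩
    classical
    have hmeas : Measurable fun x => |eta d m β a (2^k) I s x - 1/2| :=
      ((eta_meas d m β a (2^k) I s).sub_const _).abs
    have := mu_le d ρ (q^α) c0 h0 h1 (by positivity) (Real.rpow_lt_one q0.le q1 hα) hc
      {x | 0 < |eta d m β a (2^k) I s x - 1/2| ∧ |eta d m β a (2^k) I s x - 1/2| ≤ t}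
      ((measurableSet_lt measurable_const hmeas).inter (measurableSet_le hmeas measurable_const))
      (Nat.find hex) (by
        intro j c hc' hm
        refine Nat.find_min' hex ?_
        have := (atm_eval hd m β a q ρ hq h0 h1 hρ ha j k c hc' s hs I hm.1).2.trans hm.2
        rw [le_div_iff₀ A0]; linarith)
      (by simp [eta_zero hd])
    refine (ENNReal.toReal_le_of_le_ofReal (by positivity) this).trans ?_
    have e : (q^α)^(Nat.find hex) = (q^(Nat.find hex))^α := by
      rw [← Real.rpow_natCast, ← Real.rpow_natCast, ← Real.rpow_mul q0.le, ← Real.rpow_mul q0.le, mul_comm]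
    rw [e]
    calc _ ≤ (Cm * A^α) * (t/A)^α := by
          gcongr
          exact Nat.find_spec hex
      _ = Cm * t^α := by
          rw [mul_assoc, ← Real.mul_rpow A0.le (by positivity)]; congr 2; field_simp

def cell (d k : ℕ) (c : Fin d → ℕ) : Set (EE d) := {x | (2:ℝ)^k • x - cv c ∈ oc d}

lemma cell_meas (d k : ℕ) (c) : MeasurableSet (cell d k c) :=
  ((isOpen_oc d).preimage (by fun_prop : Continuous fun x : EE d => (2:ℝ)^k • x - cv c)).measurableSet

lemma cells_le {d : ℕ} (hd : 0 < d) (ρ r c0 : ℝ) (h0 : 0 < ρ) (h1 : ρ < 1) (r0 : 0 < r) (r1 : r < 1) (hc : 0 < c0)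
    (k : ℕ) (I : Finset (Fin d → ℕ)) : mu d ρ r c0 (⋃ c ∈ I, cell d k c) ≤ ENNReal.ofReal (c0 * r^k) := by
  refine mu_le d ρ r c0 h0 h1 r0 r1 hc _ (Finset.measurableSet_biUnion _ fun c _ => cell_meas d k c) k ?_ ?_
  · intro j c' hc' hm
    simp only [mem_iUnion] at hm
    obtain ⟨c, _, hm⟩ := hm
    by_contra! hlt
    exact atm_fine hd j k hlt c c' hm
  · intro hm
    simp only [mem_iUnion] at hm
    obtain ⟨c, _, hm⟩ := hm
    have := (hm ⟨0, hd⟩).1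
    rw [smul_zero, zero_sub, PiLp.neg_apply, cv_apply] at this
    have : (0:ℝ) ≤ c ⟨0, hd⟩ := by positivity
    linarith

lemma cells_sum {d : ℕ} (hd : 0 < d) (ρ r c0 : ℝ) (h0 : 0 < ρ) (h1 : ρ < 1) (r0 : 0 < r) (r1 : r < 1) (hc : 0 < c0)
    (k : ℕ) (I : Finset (Fin d → ℕ)) : ∑ c ∈ I, (mu d ρ r c0 (cell d k c)).toReal ≤ c0 * r^k := by
  have h := cells_le hd ρ r c0 h0 h1 r0 r1 hc k I
  rw [measure_biUnion_finset (f := fun c => cell d k c) (fun c _ c' _ hne => Set.disjoint_left.2 fun x hx hx' => hne (cell_unique _ c c' hx hx'))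
    (fun c _ => cell_meas d k c)] at h
  rw [← ENNReal.toReal_sum]
  · exact ENNReal.toReal_le_of_le_ofReal (by positivity) h
  · intro c hcI
    exact ((Finset.single_le_sum (f := fun c => mu d ρ r c0 (cell d k c)) (fun _ _ => bot_le) hcI).trans h).trans_lt ENNReal.ofReal_lt_top |>.ne


structure Par (d m : ℕ) (α β a q ρ c0 : ℝ) : Prop where
  hd : 0 < d
  hα : 0 < α
  hβ : 0 < β
  hq : q = 2^(-β)
  q0 : 0 < q
  q1 : q < 1
  h0 : 0 < ρ
  h1 : ρ < 1
  hρ : (ρ^(m+2))^d = q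
  ha : 0 < a
  ha4 : a ≤ 1/4
  hc : 0 < c0
  hc4 : c0 ≤ 1/4
  hcd : c0 ≤ (1/2)^d

lemma Par.r0 {d m : ℕ} {α β a q ρ c0 : ℝ} (h : Par d m α β a q ρ c0) : 0 < q^α :=
  Real.rpow_pos_of_pos h.q0 _
lemma Par.r1 {d m : ℕ} {α β a q ρ c0 : ℝ} (h : Par d m α β a q ρ c0) : q^α < 1 :=
  Real.rpow_lt_one h.q0.le h.q1 h.hα
lemma Par.prob {d m : ℕ} {α β a q ρ c0 : ℝ} (h : Par d m α β a q ρ c0) :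
    IsProbabilityMeasure (mu d ρ (q^α) c0) :=
  mu_prob d ρ _ c0 h.h0 h.h1 h.r0 h.r1 h.hc (by linarith [h.hc4])
lemma Par.N {d m : ℕ} {α β a q ρ c0 : ℝ} (h : Par d m α β a q ρ c0) (k : ℕ) : ((2:ℝ)^k) ^ (-β) = q^k := by
  rw [h.hq, ← Real.rpow_natCast, ← Real.rpow_natCast, ← Real.rpow_mul (by norm_num),
    ← Real.rpow_mul (by norm_num), mul_comm]

def sg {d : ℕ} (τ : (Fin d → ℕ) → Bool) (c : Fin d → ℕ) : ℝ := if τ c then 1 else -1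

lemma sg_abs {d : ℕ} (τ : (Fin d → ℕ) → Bool) (c : Fin d → ℕ) : |sg τ c| = 1 := by
  unfold sg; split_ifs <;> simp

/-- the regression functions -/
def et (d m : ℕ) (β a ρ : ℝ) (k : ℕ) (τ : (Fin d → ℕ) → Bool) : EE d → ℝ :=
  eta d m β a (2^k) (Good d ρ k) (sg τ)

lemma et_meas (d m : ℕ) (β a ρ : ℝ) (k : ℕ) (τ) : Measurable (et d m β a ρ k τ) := eta_meas _ _ _ _ _ _ _

lemma et_01 {d m : ℕ} {α β a q ρ c0 : ℝ} (h : Par d m α β a q ρ c0) (k τ) (x) :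
    et d m β a ρ k τ x ∈ Icc (0:ℝ) 1 :=
  eta_01 d m β a (2^k) h.hβ (one_le_pow₀ (by norm_num)) h.ha.le h.ha4 _ _ (fun c => (sg_abs τ c).le) x

lemma et_atm {d m : ℕ} {α β a q ρ c0 : ℝ} (h : Par d m α β a q ρ c0) (k τ) (c) (hc : c ∈ Good d ρ k) :
    et d m β a ρ k τ (atm k c) = 1/2 + a * q^k * sg τ c := by
  unfold et eta
  rw [h.N, GG_cell d m _ _ _ _ c hc (atm_cell k c), phi_half d _ _ (atm_scale k c), mul_one]

lemma excess {d m : ℕ} {α β a q ρ c0 : ℝ} (h : Par d m α β a q ρ c0) (k τ) (f : EE d → Bool)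
    (S) (hS : S ⊆ Good d ρ k) (hf : ∀ c ∈ S, f (atm k c) ≠ τ c) :
    2 * a * q^k * (c0 * ((1-q^α) * (q^α)^k * (S.card / (Good d ρ k).card)))
      ≤ risk (PP (mu d ρ (q^α) c0) (et d m β a ρ k τ)) f
        - risk (PP (mu d ρ (q^α) c0) (et d m β a ρ k τ)) (bayes (et d m β a ρ k τ)) := by
  classical
  have := h.prob
  have q0 := h.q0
  have ha := h.ha
  have hV : MeasurableSet ((S.image (atm k) : Finset (EE d)) : Set (EE d)) := Finset.measurableSet _
  refine le_trans ?_ (PP_excess (mu d ρ (q^α) c0) (et_meas d m β a ρ k τ) (et_01 h k τ) f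
    (S.image (atm k) : Finset (EE d)) hV (2 * a * q^k) (by positivity) ?_)
  · gcongr
    have hge := mu_ge d ρ (q^α) c0 h.h0 h.h1 h.r0 h.r1 h.hc k _ hV S hS
      (fun c hc => by simpa using ⟨c, hc, rfl⟩)
    exact (ENNReal.ofReal_le_iff_le_toReal (measure_ne_top _ _)).1 hge
  · intro x hx
    obtain ⟨c, hc, rfl⟩ := Finset.mem_image.1 (Finset.mem_coe.1 hx)
    have he := et_atm h k τ c (hS hc)
    have hp : 0 < a * q^k := by positivity
    constructor
    · have : bayes (et d m β a ρ k τ) (atm k c) = τ c := by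
        unfold bayes
        rw [he]
        cases hτ : τ c
        · simp [sg, hτ, hp]
        · simp [sg, hτ, hp.le]
      rw [this]
      exact hf c hc
    · rw [he]
      have : 2 * (1/2 + a * q^k * sg τ c) - 1 = (2 * a * q^k) * sg τ c := by ring
      rw [this, abs_mul, sg_abs, mul_one]
      exact le_abs_self _

lemma et_abs {d m : ℕ} {α β a q ρ c0 : ℝ} (h : Par d m α β a q ρ c0) (k τ) (x) :
    |2 * et d m β a ρ k τ x - 1| ≤ 2 * a * q^k := by
  rw [← h.N]
  exact eta_bound d m β a (2^k) (by positivity) h.ha.le _ _ (fun c => (sg_abs τ c).le) x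

lemma ofReal_pow_sum {ι : Type*} [Fintype ι] (z : ι → ℝ) (hz1 : ∀ c, z c ≤ 1) (n : ℕ) (B : ℝ)
    (hB : B ≤ ∑ c, (1 - z c)^(2*n)) :
    ENNReal.ofReal B ≤ ∑ c, ENNReal.ofReal (1 - z c) ^ (2*n) := by
  calc _ ≤ ENNReal.ofReal (∑ c, (1 - z c)^(2*n)) := ENNReal.ofReal_le_ofReal hB
    _ = _ := by
      rw [ENNReal.ofReal_sum_of_nonneg (fun c _ => pow_nonneg (by linarith [hz1 c]) _)]
      exact Finset.sum_congr rfl fun c _ => ENNReal.ofReal_pow (by linarith [hz1 c]) _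

lemma conv_real (B T M : ℝ) (hT : 0 ≤ T) (hM : 0 ≤ M) (P : ℝ≥0∞) (hP : P ≤ 1)
    (h : ENNReal.ofReal B ≤ 4 * (ENNReal.ofReal T + ENNReal.ofReal M * P)) : B ≤ 4 * (T + M * P.toReal) := by
  have hPt : P = ENNReal.ofReal P.toReal := (ENNReal.ofReal_toReal (ne_top_of_le_ne_top ENNReal.one_ne_top hP)).symm
  rw [hPt, ← ENNReal.ofReal_mul hM, ← ENNReal.ofReal_add hT (by positivity),
    show (4:ℝ≥0∞) = ENNReal.ofReal 4 by simp, ← ENNReal.ofReal_mul (by norm_num)] at h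
  exact (ENNReal.ofReal_le_ofReal_iff (by positivity)).1 h

open Classical in
def ext1 (d : ℕ) (I : Finset (Fin d → ℕ)) (σ : {c // c ∈ I} → Bool) (c : Fin d → ℕ) : Bool :=
  if h : c ∈ I then σ ⟨c, h⟩ else true

lemma partA {d m : ℕ} {α β a q ρ c0 : ℝ} (h : Par d m α β a q ρ c0) (k n : ℕ)
    (hn : n * ((q^k)^2 * (q^α)^k) ≤ ((2:ℝ)^k)^d) (lam : ℝ)
    (hl : lam ≤ c0 * (1-q^α) * a / 8 * (q^k * (q^α)^k))
    (fhat : (Fin n → EE d × Bool) → EE d → Bool) :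
    ∃ τ, ENNReal.ofReal (1/16) ≤ Measure.pi (fun _ : Fin n => PP (mu d ρ (q^α) c0) (et d m β a ρ k τ))
      {D | lam ≤ risk (PP (mu d ρ (q^α) c0) (et d m β a ρ k τ)) (fhat D)
        - risk (PP (mu d ρ (q^α) c0) (et d m β a ρ k τ)) (bayes (et d m β a ρ k τ))} := by
  classical
  have hpr := h.prob
  have q0 := h.q0
  have ha := h.ha
  have r0 := h.r0
  have hc0 := h.hc
  have hqk : q^k ≤ 1 := pow_le_one₀ q0.le h.q1.le
  set I := Good d ρ k with hI
  set M : ℝ := (I.card : ℝ) with hM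
  have M0 : 0 < M := Good_pos d ρ h.h0 h.h1 k
  have hε1 : 2 * a * q^k ≤ 1/2 := by
    have := mul_le_mul h.ha4 hqk (by positivity) (by norm_num)
    linarith
  have hst := stat_lower (ι := {c // c ∈ I}) (mu d ρ (q^α) c0) (fun σ => et d m β a ρ k (ext1 d I σ))
    (fun σ => et_meas _ _ _ _ _ _ _) (fun σ => et_01 h k _) (fun c => cell d k c.1) (fun c => cell_meas d k c.1)
    (2 * a * q^k) (by positivity) (by linarith) (fun σ => et_abs h k _) ?_ ?_ n
    (fun D c => fhat D (atm k c.1))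
    (fun σ => {D | lam ≤ risk (PP (mu d ρ (q^α) c0) (et d m β a ρ k (ext1 d I σ))) (fhat D)
        - risk (PP (mu d ρ (q^α) c0) (et d m β a ρ k (ext1 d I σ))) (bayes (et d m β a ρ k (ext1 d I σ)))})
    (ENNReal.ofReal (M/16)) ?_
  · obtain ⟨σ, hσ⟩ := hst
    refine ⟨ext1 d I σ, ?_⟩
    set P := Measure.pi (fun _ : Fin n => PP (mu d ρ (q^α) c0) (et d m β a ρ k (ext1 d I σ)))
      {D | lam ≤ risk (PP (mu d ρ (q^α) c0) (et d m β a ρ k (ext1 d I σ))) (fhat D)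
        - risk (PP (mu d ρ (q^α) c0) (et d m β a ρ k (ext1 d I σ))) (bayes (et d m β a ρ k (ext1 d I σ)))} with hP
    have hPP := PP_prob (mu d ρ (q^α) c0) (et_meas d m β a ρ k (ext1 d I σ)) (et_01 h k _)
    have hP1 : P ≤ 1 := prob_le_one
    have hcard : (Fintype.card {c // c ∈ I} : ℝ≥0∞) = ENNReal.ofReal M := by
      rw [Fintype.card_coe, hM, ENNReal.ofReal_natCast]
    have hsum : M/2 ≤ ∑ c : {c // c ∈ I}, (1 - (2 * a * q^k)^2 * (mu d ρ (q^α) c0 (cell d k c.1)).toReal)^(2*n) := by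
      have hcs := cells_sum h.hd ρ (q^α) c0 h.h0 h.h1 h.r0 h.r1 h.hc k I
      have hb : ∀ c : {c // c ∈ I}, 1 - (2*n) * ((2 * a * q^k)^2 * (mu d ρ (q^α) c0 (cell d k c.1)).toReal)
          ≤ (1 - (2 * a * q^k)^2 * (mu d ρ (q^α) c0 (cell d k c.1)).toReal)^(2*n) := by
        intro c
        have hz : (2 * a * q^k)^2 * (mu d ρ (q^α) c0 (cell d k c.1)).toReal ≤ 1 := by
          refine mul_le_one₀ (pow_le_one₀ (by positivity) (by linarith)) ENNReal.toReal_nonneg ?_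
          exact ENNReal.toReal_le_of_le_ofReal zero_le_one (by simpa using prob_le_one)
        have := one_add_mul_le_pow (a := - ((2 * a * q^k)^2 * (mu d ρ (q^α) c0 (cell d k c.1)).toReal)) (by linarith) (2*n)
        push_cast at this
        calc _ = 1 + (2 * n) * - ((2 * a * q^k)^2 * (mu d ρ (q^α) c0 (cell d k c.1)).toReal) := by ring
          _ ≤ _ := this
          _ = _ := by rw [← sub_eq_add_neg]
      refine le_trans ?_ (Finset.sum_le_sum fun c _ => hb c)
      rw [Finset.sum_sub_distrib, ← Finset.mul_sum, ← Finset.mul_sum]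
      rw [Finset.sum_coe_sort I (fun c => (mu d ρ (q^α) c0 (cell d k c)).toReal)]
      simp only [Finset.sum_const, Finset.card_univ, Fintype.card_coe, nsmul_eq_mul, mul_one]
      have hMl : ((2:ℝ)^k / 2)^d ≤ M := card_Good d ρ h.h0 h.h1 k
      have e1 : (2*n) * ((2 * a * q^k)^2 * ∑ c ∈ I, (mu d ρ (q^α) c0 (cell d k c)).toReal)
          ≤ (2*n) * ((2 * a * q^k)^2 * (c0 * (q^α)^k)) := by gcongr
      have e2 : (2*n) * ((2 * a * q^k)^2 * (c0 * (q^α)^k)) = 8 * a^2 * c0 * (n * ((q^k)^2 * (q^α)^k)) := by ring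
      have e3 : 8 * a^2 * c0 * (n * ((q^k)^2 * (q^α)^k)) ≤ 8 * (1/4)^2 * (1/2)^d * ((2:ℝ)^k)^d := by
        gcongr
        · exact h.ha4
        · exact h.hcd
      have e4 : 8 * (1/4)^2 * (1/2)^d * ((2:ℝ)^k)^d = (1/2) * ((2:ℝ)^k / 2)^d := by
        rw [div_eq_mul_one_div ((2:ℝ)^k) 2, mul_pow]; ring
      have : M - M/2 = M/2 := by ring
      rw [← hM]
      linarith
    have hs := ofReal_pow_sum (fun c : {c // c ∈ I} => (2 * a * q^k)^2 * (mu d ρ (q^α) c0 (cell d k c.1)).toReal) (by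
        intro c
        refine mul_le_one₀ (pow_le_one₀ (by positivity) (by linarith)) ENNReal.toReal_nonneg ?_
        exact ENNReal.toReal_le_of_le_ofReal zero_le_one (by simpa using prob_le_one)) n _ hsum
    have := hs.trans hσ
    rw [hcard] at this
    have := conv_real (M/2) (M/16) M (by positivity) M0.le P hP1 this
    refine ENNReal.ofReal_le_of_le_toReal ?_
    have : M * (1/16) ≤ M * P.toReal := by linarith
    exact le_of_mul_le_mul_left this M0
  · intro σ c x hx
    have e1 : ∀ τ, et d m β a ρ k τ x = 1/2 + (a * (2^k)^(-β)) * (sg τ c.1 * phi d (m+2) ((2:ℝ)^k • x - cv c.1)) := by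
      intro τ
      unfold et eta
      rw [GG_cell d m _ _ _ _ c.1 c.2 hx]
    have e2 : sg (ext1 d I (flipC c σ)) c.1 = - sg (ext1 d I σ) c.1 := by
      unfold sg ext1 flipC
      cases hb : σ c <;> simp [hb]
    simp only [e1, e2]; ring
  · intro σ c x hx
    show eta _ _ _ _ _ _ _ _ = eta _ _ _ _ _ _ _ _
    unfold eta GG
    congr 2
    refine Finset.sum_congr rfl fun c' hc' => ?_
    by_cases hcc : c' = c.1
    · subst hcc
      rw [phi_zero d _ (by omega) _ hx, mul_zero, mul_zero]
    · have : sg (ext1 d I (flipC c σ)) c' = sg (ext1 d I σ) c' := by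
        have hI' : c' ∈ I := hc'
        have : (⟨c', hI'⟩ : {c // c ∈ I}) ≠ c := fun h => hcc (congrArg Subtype.val h)
        unfold sg ext1 flipC
        simp [hI', Function.update_of_ne this]
      rw [this]
  · intro σ D hT
    show lam ≤ _
    set F := Finset.univ.filter fun c : {c // c ∈ I} => fhat D (atm k c.1) ≠ σ c with hF
    have hcS : ((F.image Subtype.val).card : ℝ) = F.card := by
      rw [Finset.card_image_of_injective _ Subtype.val_injective]
    have hFc : M/16 ≤ F.card := by
      rw [← ENNReal.ofReal_natCast] at hT
      exact (ENNReal.ofReal_le_ofReal_iff (by positivity)).1 hT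
    have hex := excess h k (ext1 d I σ) (fhat D) (F.image Subtype.val) (by
        intro c hc
        obtain ⟨c, _, rfl⟩ := Finset.mem_image.1 hc
        exact c.2) (by
        intro c hc
        obtain ⟨c', hc', rfl⟩ := Finset.mem_image.1 hc
        have := (Finset.mem_filter.1 hc').2
        simpa [ext1] using this)
    refine le_trans (hl.trans ?_) hex
    rw [hcS]
    have hr : 0 < 1 - q^α := by linarith [h.r1]
    have : (1:ℝ)/16 ≤ F.card / (Good d ρ k).card := by
      rw [le_div_iff₀ M0]; linarith
    calc _ = 2 * a * q^k * (c0 * ((1-q^α) * (q^α)^k * (1/16))) := by ring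
      _ ≤ _ := by gcongr

set_option maxHeartbeats 400000 in
lemma partB {d m : ℕ} {α β a q ρ c0 : ℝ} (h : Par d m α β a q ρ c0) (k n : ℕ) (lam : ℝ)
    (hl : lam ≤ c0 * (1-q^α) * a * (q^k * (q^α)^k))
    (fhat : (Fin n → EE d × Bool) → EE d → Bool) :
    ∃ τ, ENNReal.ofReal (1/8 * (1 - c0 * ((q^k)^2 * (q^α)^k))^(2*n)) ≤
      Measure.pi (fun _ : Fin n => PP (mu d ρ (q^α) c0) (et d m β a ρ k τ))
      {D | lam ≤ risk (PP (mu d ρ (q^α) c0) (et d m β a ρ k τ)) (fhat D)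
        - risk (PP (mu d ρ (q^α) c0) (et d m β a ρ k τ)) (bayes (et d m β a ρ k τ))} := by
  classical
  have hpr := h.prob
  have q0 := h.q0
  have ha := h.ha
  have r0 := h.r0
  have hc0 := h.hc
  have hqk : q^k ≤ 1 := pow_le_one₀ q0.le h.q1.le
  have hrk : (q^α)^k ≤ 1 := pow_le_one₀ r0.le h.r1.le
  set I := Good d ρ k with hI
  have M0 : (0:ℝ) < I.card := Good_pos d ρ h.h0 h.h1 k
  have hε1 : 2 * a * q^k ≤ 1/2 := by
    have := mul_le_mul h.ha4 hqk (by positivity) (by norm_num)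
    linarith
  set z := c0 * ((q^k)^2 * (q^α)^k) with hz
  have z1 : z ≤ 1/4 := by
    have : (q^k)^2 * (q^α)^k ≤ 1 := mul_le_one₀ (pow_le_one₀ (by positivity) hqk) (by positivity) hrk
    calc z ≤ (1/4) * 1 := mul_le_mul h.hc4 this (by positivity) (by norm_num)
      _ = _ := by norm_num
  set A : (Unit → Bool) → Set (Fin n → EE d × Bool) := fun σ =>
    {D | lam ≤ risk (PP (mu d ρ (q^α) c0) (et d m β a ρ k (fun _ => σ ()))) (fhat D)
        - risk (PP (mu d ρ (q^α) c0) (et d m β a ρ k (fun _ => σ ()))) (bayes (et d m β a ρ k (fun _ => σ ())))} with hA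
  have hr : 0 < 1 - q^α := by linarith [h.r1]
  have key : ∀ D (σ : Unit → Bool), (1:ℝ)/2 ≤ ((I.filter fun c => fhat D (atm k c) ≠ σ ()).card : ℝ) / I.card → D ∈ A σ := by
    intro D σ hh
    have hex := excess h k (fun _ => σ ()) (fhat D) (I.filter fun c => fhat D (atm k c) ≠ σ ()) (Finset.filter_subset _ _)
      (fun c hc => (Finset.mem_filter.1 hc).2)
    refine le_trans (hl.trans ?_) hex
    calc _ = 2 * a * q^k * (c0 * ((1-q^α) * (q^α)^k * (1/2))) := by ring
      _ ≤ _ := by gcongr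
  have dich : ∀ D, D ∉ A (fun _ => true) → D ∈ A (fun _ => false) := by
    intro D hD
    refine key D (fun _ => false) ?_
    have h1 : ¬ ((1:ℝ)/2 ≤ ((I.filter fun c => fhat D (atm k c) ≠ true).card : ℝ) / I.card) := fun hh => hD (key D (fun _ => true) hh)
    have h2 := Finset.card_filter_add_card_filter_not (s := I) (fun c => fhat D (atm k c) ≠ true)
    have h3 : (I.filter fun c => ¬ (fhat D (atm k c) ≠ true)) = I.filter fun c => fhat D (atm k c) ≠ false := by
      refine Finset.filter_congr fun c _ => by simp
    rw [h3] at h2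
    have h4 : ((I.filter fun c => fhat D (atm k c) ≠ true).card : ℝ) + (I.filter fun c => fhat D (atm k c) ≠ false).card = I.card := by
      exact_mod_cast h2
    rw [not_le, div_lt_iff₀ M0] at h1
    rw [le_div_iff₀ M0]
    linarith
  have hT0 : 0 < 1/8 * (1 - z)^(2*n) := by
    have : 0 < 1 - z := by linarith
    positivity
  have hst := stat_lower (ι := Unit) (mu d ρ (q^α) c0) (fun σ => et d m β a ρ k (fun _ => σ ()))
    (fun σ => et_meas _ _ _ _ _ _ _) (fun σ => et_01 h k _) (fun _ => ⋃ c ∈ I, cell d k c)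
    (fun _ => Finset.measurableSet_biUnion _ fun c _ => cell_meas d k c)
    (2 * a * q^k) (by positivity) (by linarith) (fun σ => et_abs h k _) ?_ ?_ n
    (fun D _ => if D ∈ A (fun _ => true) then false else true) A
    (ENNReal.ofReal (1/8 * (1 - z)^(2*n))) ?_
  · obtain ⟨σ, hσ⟩ := hst
    refine ⟨fun _ => σ (), ?_⟩
    change _ ≤ Measure.pi (fun _ : Fin n => PP (mu d ρ (q^α) c0) (et d m β a ρ k (fun _ => σ ()))) (A σ)
    set P := Measure.pi (fun _ : Fin n => PP (mu d ρ (q^α) c0) (et d m β a ρ k (fun _ => σ ()))) (A σ) with hP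
    have hPP := PP_prob (mu d ρ (q^α) c0) (et_meas d m β a ρ k (fun _ => σ ())) (et_01 h k _)
    have hP1 : P ≤ 1 := prob_le_one
    have hcl : (mu d ρ (q^α) c0 (⋃ c ∈ I, cell d k c)).toReal ≤ c0 * (q^α)^k :=
      ENNReal.toReal_le_of_le_ofReal (by positivity) (cells_le h.hd ρ (q^α) c0 h.h0 h.h1 h.r0 h.r1 h.hc k I)
    have hzz : (2 * a * q^k)^2 * (mu d ρ (q^α) c0 (⋃ c ∈ I, cell d k c)).toReal ≤ z := by
      calc _ ≤ (1 * q^k)^2 * (c0 * (q^α)^k) := by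
            gcongr; linarith [h.ha4]
        _ = z := by rw [hz]; ring
    have hs := ofReal_pow_sum (fun _ : Unit => (2 * a * q^k)^2 * (mu d ρ (q^α) c0 (⋃ c ∈ I, cell d k c)).toReal)
      (fun _ => by linarith) n ((1-z)^(2*n)) (by
        simp only [Finset.univ_unique, Finset.sum_singleton]
        exact pow_le_pow_left₀ (by linarith) (by linarith) _)
    have := hs.trans hσ
    rw [show ((Fintype.card Unit : ℕ) : ℝ≥0∞) = ENNReal.ofReal 1 by simp] at this
    have := conv_real _ _ 1 hT0.le zero_le_one P hP1 this
    refine ENNReal.ofReal_le_of_le_toReal ?_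
    linarith
  · intro σ _ x _
    show eta _ _ _ _ _ _ _ _ = 1 - eta _ _ _ _ _ _ _ _
    have : GG d (m+2) (2^k) (Good d ρ k) (sg fun _ => flipC () σ ()) x = - GG d (m+2) (2^k) (Good d ρ k) (sg fun _ => σ ()) x := by
      unfold GG
      rw [← Finset.sum_neg_distrib]
      refine Finset.sum_congr rfl fun c _ => ?_
      unfold sg flipC
      cases hb : σ () <;> simp [hb]
    unfold eta
    rw [this]; ring
  · intro σ _ x hx
    show eta _ _ _ _ _ _ _ _ = eta _ _ _ _ _ _ _ _
    have hx' : ∀ c ∈ Good d ρ k, (2:ℝ)^k • x - cv c ∉ oc d := by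
      intro c hc hm
      exact hx (mem_iUnion₂.2 ⟨c, hc, hm⟩)
    unfold eta
    rw [GG_out d m _ _ _ _ hx', GG_out d m _ _ _ _ hx']
  · intro σ D hT
    have hne : (Finset.univ.filter fun c : Unit => (if D ∈ A (fun _ => true) then false else true) ≠ σ c).Nonempty := by
      rw [← Finset.card_pos]
      by_contra! h0
      rw [Nat.le_zero.1 h0] at hT
      simp at hT
      linarith
    obtain ⟨⟨⟩, hu⟩ := hne
    have hu := (Finset.mem_filter.1 hu).2
    by_cases hD : D ∈ A (fun _ => true)
    · rw [if_pos hD] at hu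
      have : σ = fun _ => true := by funext u; cases hb : σ u <;> simp_all
      rw [this]; exact hD
    · rw [if_neg hD] at hu
      have : σ = fun _ => false := by funext u; cases hb : σ u <;> simp_all
      rw [this]; exact dich D hD


lemma exp_lower (z : ℝ) (h0 : 0 ≤ z) (h1 : z ≤ 1/4) (n : ℕ) : Real.exp (-(4 * n * z)) ≤ (1 - z)^(2*n) := by
  have h : Real.exp (-(2*z)) ≤ 1 - z := by
    rw [Real.exp_neg, inv_le_comm₀ (Real.exp_pos _) (by linarith)]
    refine le_trans ?_ (Real.add_one_le_exp _)
    rw [inv_le_iff_one_le_mul₀ (by linarith)]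
    nlinarith
  calc _ = Real.exp (-(2*z)) ^ (2*n) := by rw [← Real.exp_nat_mul]; congr 1; push_cast; ring
    _ ≤ _ := pow_le_pow_left₀ (Real.exp_pos _).le h _

lemma pow_rpow_comm (q α : ℝ) (q0 : 0 ≤ q) (k : ℕ) : (q^α)^k = (q^k)^α := by
  rw [← Real.rpow_natCast, ← Real.rpow_natCast, ← Real.rpow_mul q0, ← Real.rpow_mul q0, mul_comm]

lemma choose_a (α β q : ℝ) (hα : 0 < α) (hβ : 0 < β) (hq : q = 2^(-β)) (d n : ℕ) (hn : 0 < n) :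
    ∃ k : ℕ, n * ((q^k)^2 * (q^α)^k) ≤ ((2:ℝ)^k)^d ∧
      (n:ℝ) ^ (-((1+α)/(2+α+(d:ℝ)/β))) * (q * q^α) ≤ q^k * (q^α)^k := by
  have hn1 : (1:ℝ) ≤ n := by exact_mod_cast hn
  have hn0 : (0:ℝ) < n := by linarith
  set e := β * (2+α) + d with he
  have e0 : 0 < e := by positivity
  set y : ℝ := (n:ℝ)^(-(1/e)) with hy
  have y0 : 0 < y := by positivity
  have y1 : y ≤ 1 := Real.rpow_le_one_of_one_le_of_nonpos hn1 (by simp; positivity)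
  obtain ⟨k', hk1, hk2⟩ := exists_nat_pow_near_of_lt_one y0 y1 (by norm_num : (0:ℝ) < 1/2) (by norm_num)
  set h : ℝ := (1/2)^(k'+1) with hh
  have h0 : 0 < h := by positivity
  have hqh : q^(k'+1) = h^β := by
    have : q = (1/2)^β := by
      rw [hq, one_div, Real.inv_rpow (by norm_num), Real.rpow_neg (by norm_num)]
    rw [this, hh, pow_rpow_comm _ _ (by norm_num)]
  have q0 : 0 < q := by rw [hq]; positivity
  have hyn : n * y^e = 1 := by
    rw [hy, ← Real.rpow_mul hn0.le]
    have : -(1/e) * e = -1 := by field_simp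
    rw [this, Real.rpow_neg_one, mul_inv_cancel₀ hn0.ne']
  refine ⟨k'+1, ?_, ?_⟩
  · rw [pow_rpow_comm q α q0.le, hqh, ← Real.rpow_mul h0.le, ← Real.rpow_natCast (h^β), ← Real.rpow_mul h0.le, ← Real.rpow_add h0]
    have e1 : ((2:ℝ)^(k'+1))^d = h^(-(d:ℝ)) := by
      rw [Real.rpow_neg h0.le, Real.rpow_natCast, hh, ← inv_pow, ← inv_pow]; norm_num
    have e2 : h^(β * (2:ℕ) + β * α) = h^e * h^(-(d:ℝ)) := by
      rw [← Real.rpow_add h0]; congr 1; rw [he]; push_cast; ring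
    rw [e1, e2, ← mul_assoc]
    refine mul_le_of_le_one_left (by positivity) ?_
    rw [← hyn]
    gcongr
  · have e1 : (n:ℝ) ^ (-((1+α)/(2+α+(d:ℝ)/β))) = y^(β*(1+α)) := by
      rw [hy, ← Real.rpow_mul hn0.le]; congr 1; rw [he]; field_simp
    have e2 : q^(k'+1) * (q^α)^(k'+1) = ((1/2)^k')^(β*(1+α)) * (q * q^α) := by
      have : q = (1/2)^β := by
        rw [hq, one_div, Real.inv_rpow (by norm_num), Real.rpow_neg (by norm_num)]
      have h3 : ((1/2:ℝ)^k')^(β*(1+α)) = q^k' * (q^α)^k' := by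
        rw [pow_rpow_comm q α q0.le, this, pow_rpow_comm _ _ (by norm_num), ← Real.rpow_mul (by positivity), ← Real.rpow_add (by positivity)]
        congr 1; ring
      rw [h3]; ring
    rw [e1, e2]
    gcongr

theorem mainT (d : ℕ) (hd : 0 < d) (α β L Cm : ℝ)
    (hα : 0 < α) (hβ : 0 < β) (hL : 0 < L) (hCm : 0 < Cm) :
    ∃ μstar : Measure (EuclideanSpace ℝ (Fin d)),
      IsProbabilityMeasure μstar ∧ μstar (unitCube d) = 1 ∧
      ∃ C1 : ℝ, 0 < C1 ∧ ∃ C2 : ℝ, 0 < C2 ∧ ∃ c' : ℝ, 0 < c' ∧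
      ∃ d1 : ℝ, 0 < d1 ∧ ∃ d2 : ℝ, 0 < d2 ∧ ∃ lam0 : ℝ, 0 < lam0 ∧
      ∀ n : ℕ, 0 < n →
      ∀ fhat : (Fin n → EuclideanSpace ℝ (Fin d) × Bool) → EuclideanSpace ℝ (Fin d) → Bool,
        (∀ lam : ℝ, 0 < lam → lam ≤ d1 * (n : ℝ) ^ (-((1+α)/(2+α+(d:ℝ)/β))) →
          ∃ P : Measure (EuclideanSpace ℝ (Fin d) × Bool), ∃ η,
            IsProbabilityMeasure P ∧ IsRegFun P η ∧ P.map Prod.fst = μstar ∧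
            MarginCond μstar η α Cm ∧ η ∈ holderClass d β L ∧
            ENNReal.ofReal C1
              ≤ Measure.pi (fun _ : Fin n => P)
                  {D | lam ≤ risk P (fhat D) - risk P (bayes η)}) ∧
        (∀ lam : ℝ, d2 * (n : ℝ) ^ (-((1+α)/(2+α+(d:ℝ)/β))) ≤ lam → lam ≤ lam0 →
          ∃ P : Measure (EuclideanSpace ℝ (Fin d) × Bool), ∃ η,
            IsProbabilityMeasure P ∧ IsRegFun P η ∧ P.map Prod.fst = μstar ∧
            MarginCond μstar η α Cm ∧ η ∈ holderClass d β L ∧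
            ENNReal.ofReal (C2 * Real.exp (-(c' * n * lam ^ ((2+α)/(1+α)))))
              ≤ Measure.pi (fun _ : Fin n => P)
                  {D | lam ≤ risk P (fhat D) - risk P (bayes η)}) := by
  obtain ⟨m, hm⟩ : ∃ m, ⌈β⌉₊ - 1 = m := ⟨_, rfl⟩
  have hcp : 0 < ⌈β⌉₊ := Nat.ceil_pos.2 hβ
  have hceil : ⌈β⌉₊ = m + 1 := by omega
  have hm1 : (m:ℝ) ≤ β := by
    have : (⌈β⌉₊ : ℝ) < β + 1 := Nat.ceil_lt_add_one hβ.le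
    rw [hceil] at this; push_cast at this; linarith
  have hm2 : β ≤ m + 1 := by
    have : β ≤ (⌈β⌉₊ : ℝ) := Nat.le_ceil β
    rw [hceil] at this; push_cast at this; linarith
  obtain ⟨C, hC, hrem⟩ := rem_bound d m β hm1 hm2
  obtain ⟨a, ha, ha4, haL⟩ : ∃ a : ℝ, 0 < a ∧ a ≤ 1/4 ∧ 2 * a * C ≤ L := by
    refine ⟨min (1/4) (L / (2*C+1)), lt_min (by norm_num) (by positivity), min_le_left _ _, ?_⟩
    calc _ ≤ 2 * (L / (2*C+1)) * C := by gcongr; exact min_le_right _ _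
      _ = L * (2*C / (2*C+1)) := by ring
      _ ≤ L * 1 := by gcongr; rw [div_le_one (by positivity)]; linarith
      _ = L := mul_one _
  obtain ⟨q, hq⟩ : ∃ q : ℝ, q = 2^(-β) := ⟨_, rfl⟩
  have q0 : 0 < q := by rw [hq]; positivity
  have q1 : q < 1 := by rw [hq]; exact Real.rpow_lt_one_of_one_lt_of_neg (by norm_num) (by linarith)
  obtain ⟨ρ, h0, h1, hρ⟩ : ∃ ρ : ℝ, 0 < ρ ∧ ρ < 1 ∧ (ρ^(m+2))^d = q := by
    have hD : (0:ℝ) < ((m+2) * d : ℕ) := by exact_mod_cast Nat.mul_pos (by omega) hd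
    refine ⟨q^(1 / (((m+2)*d : ℕ) : ℝ)), by positivity, Real.rpow_lt_one q0.le q1 (by positivity), ?_⟩
    rw [← pow_mul, ← Real.rpow_natCast, ← Real.rpow_mul q0.le, one_div_mul_cancel hD.ne', Real.rpow_one]
  have hκ : 0 < a * (((1-ρ)/8) ^ (m+2)) ^ d := by
    have : 0 < 1 - ρ := by linarith
    positivity
  obtain ⟨c0, hc, hc4, hcd, hcm⟩ : ∃ c0 : ℝ, 0 < c0 ∧ c0 ≤ 1/4 ∧ c0 ≤ (1/2)^d ∧
      c0 ≤ Cm * (a * (((1-ρ)/8) ^ (m+2)) ^ d) ^ α := by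
    refine ⟨min (min (1/4) ((1/2)^d)) (Cm * (a * (((1-ρ)/8) ^ (m+2)) ^ d) ^ α),
      lt_min (lt_min (by norm_num) (by positivity)) (by positivity), ?_, ?_, min_le_right _ _⟩
    · exact (min_le_left _ _).trans (min_le_left _ _)
    · exact (min_le_left _ _).trans (min_le_right _ _)
  have h : Par d m α β a q ρ c0 := ⟨hd, hα, hβ, hq, q0, q1, h0, h1, hρ, ha, ha4, hc, hc4, hcd⟩
  have r0 := h.r0
  have r1 := h.r1
  have hpr := h.prob
  have hr : 0 < 1 - q^α := by linarith
  have hmem : ∀ k τ, IsProbabilityMeasure (PP (mu d ρ (q^α) c0) (et d m β a ρ k τ)) ∧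
      IsRegFun (PP (mu d ρ (q^α) c0) (et d m β a ρ k τ)) (et d m β a ρ k τ) ∧
      (PP (mu d ρ (q^α) c0) (et d m β a ρ k τ)).map Prod.fst = mu d ρ (q^α) c0 ∧
      MarginCond (mu d ρ (q^α) c0) (et d m β a ρ k τ) α Cm ∧ et d m β a ρ k τ ∈ holderClass d β L := by
    intro k τ
    refine ⟨PP_prob _ (et_meas d m β a ρ k τ) (et_01 h k τ), PP_reg _ (et_meas d m β a ρ k τ) (et_01 h k τ),
      PP_map _ (et_meas d m β a ρ k τ) (et_01 h k τ), ?_, ?_⟩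
    · exact eta_margin hd m α β a q ρ c0 Cm hα hq h0 h1 q0 q1 hc hCm hρ ha hcm k _ (sg_abs τ) _
    · exact eta_holder d m β C (2^k) L hm (by positivity) hC hrem _ _ (fun c => (sg_abs τ c).le) a ha.le haL
  obtain ⟨K, hK⟩ : ∃ K, K = c0 * (1 - q^α) * a := ⟨_, rfl⟩
  have K0 : 0 < K := by rw [hK]; positivity
  obtain ⟨γ, hγ⟩ : ∃ γ, γ = (2+α)/(1+α) := ⟨_, rfl⟩
  have γ0 : 0 < γ := by rw [hγ]; positivity
  refine ⟨mu d ρ (q^α) c0, hpr, mu_cube d ρ _ c0 h0 h1 r0 r1 hc (by linarith), 1/16, by norm_num, 1/8, by norm_num,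
    4 * c0 * (q^2 * q^α)⁻¹ * (K^γ)⁻¹, by positivity, K / 8 * (q * q^α), by positivity, 1, one_pos, K, K0, ?_⟩
  intro n hn fhat
  constructor
  · intro lam _ hlam
    obtain ⟨k, hk1, hk2⟩ := choose_a α β q hα hβ hq d n hn
    obtain ⟨τ, hτ⟩ := partA h k n hk1 lam (by
      refine hlam.trans ?_
      rw [← hK]
      calc _ = K / 8 * ((n:ℝ) ^ (-((1+α)/(2+α+(d:ℝ)/β))) * (q * q^α)) := by ring
        _ ≤ _ := by gcongr) fhat
    obtain ⟨m1, m2, m3, m4, m5⟩ := hmem k τ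
    exact ⟨_, _, m1, m2, m3, m4, m5, hτ⟩
  · intro lam hlam1 hlam2
    have hn0 : (0:ℝ) < n := by exact_mod_cast hn
    have lam0 : 0 < lam := lt_of_lt_of_le (by positivity) hlam1
    have w1 : q * q^α < 1 := by nlinarith
    obtain ⟨k, hk1, hk2⟩ := exists_nat_pow_near_of_lt_one (x := lam / K) (y := q * q^α) (by positivity)
      ((div_le_one K0).2 hlam2) (by positivity) w1
    obtain ⟨τ, hτ⟩ := partB h k n lam (by
      rw [← hK, ← mul_pow]
      rwa [div_le_iff₀' K0] at hk2) fhat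
    obtain ⟨m1, m2, m3, m4, m5⟩ := hmem k τ
    refine ⟨_, _, m1, m2, m3, m4, m5, le_trans ?_ hτ⟩
    refine ENNReal.ofReal_le_ofReal ?_
    have z1 : c0 * ((q^k)^2 * (q^α)^k) ≤ 1/4 := by
      have : (q^k)^2 * (q^α)^k ≤ 1 := mul_le_one₀ (pow_le_one₀ (by positivity) (pow_le_one₀ q0.le q1.le))
        (by positivity) (pow_le_one₀ r0.le r1.le)
      calc _ ≤ (1/4:ℝ) * 1 := mul_le_mul hc4 this (by positivity) (by norm_num)
        _ = _ := by norm_num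
    have hv : (q * q^α)^γ = q^2 * q^α := by
      have e1 : q * q^α = q^(1+α) := by rw [Real.rpow_add q0, Real.rpow_one]
      have e2 : q^2 * q^α = q^(2+α) := by rw [Real.rpow_add q0, Real.rpow_ofNat]
      rw [e1, e2, ← Real.rpow_mul q0.le, hγ]; congr 1; field_simp
    have hz : (q^k)^2 * (q^α)^k ≤ (q^2 * q^α)⁻¹ * ((K^γ)⁻¹ * lam^γ) := by
      rw [inv_mul_eq_div, le_div_iff₀ (by positivity)]
      calc (q^k)^2 * (q^α)^k * (q^2 * q^α) = (q^2 * q^α)^(k+1) := by ring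
        _ = ((q * q^α)^(k+1))^γ := by rw [← hv, pow_rpow_comm _ _ (by positivity)]
        _ ≤ (lam / K)^γ := by gcongr
        _ = _ := by rw [Real.div_rpow lam0.le K0.le]; field_simp
    refine mul_le_mul_of_nonneg_left ?_ (by norm_num)
    refine le_trans ?_ (exp_lower _ (by positivity) z1 n)
    refine Real.exp_le_exp.2 (neg_le_neg ?_)
    rw [← hγ]
    calc _ = 4 * n * c0 * ((q^k)^2 * (q^α)^k) := by ring
      _ ≤ 4 * n * c0 * ((q^2 * q^α)⁻¹ * ((K^γ)⁻¹ * lam^γ)) := by gcongr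
      _ = _ := by ring


/-- Theorem 5.2 (minimax lower bound over the Hölder–margin class): for fixed
`α, β, L > 0`, `d ≥ 1` and margin constant `C_M`, there exist a marginal distribution
`μ_X^*` on `[0,1]^d` and positive constants `C'₁, C'₂, c', d'₁, d'₂, λ'₀` such that for any
sample size `n ≥ 1` and any classifier `f̂ₙ`:
(a) for every `0 < λ ≤ d'₁ n^{-(1+α)/(2+α+d/β)}`,
`sup_{P ∈ 𝓜'(μ_X^*,α,β)} ℙ(R(f̂ₙ) - R* ≥ λ) ≥ C'₁` — witnessed by some `P` in the class;
(b) for every `d'₂ n^{-(1+α)/(2+α+d/β)} ≤ λ ≤ λ'₀`,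
`sup_{P ∈ 𝓜'(μ_X^*,α,β)} ℙ(R(f̂ₙ) - R* ≥ λ) ≥ C'₂ exp(-c' n λ^{(2+α)/(1+α)})` — again
witnessed by some `P` in the class.  Membership `P ∈ 𝓜'(μ_X^*,α,β)` means: `P` is a
distribution of `(X,Y)` with marginal `μ_X^*`, regression function `η_P` satisfying the
margin condition with exponent `α` and constant `C_M`, and `η_P ∈ Σ(β,L,[0,1]^d)`. -/
theorem statement16 (d : ℕ) (hd : 0 < d) (α β L Cm : ℝ)
    (hα : 0 < α) (hβ : 0 < β) (hL : 0 < L) (hCm : 0 < Cm) :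
    ∃ μstar : Measure (EuclideanSpace ℝ (Fin d)),
      IsProbabilityMeasure μstar ∧ μstar (unitCube d) = 1 ∧
      ∃ C1 : ℝ, 0 < C1 ∧ ∃ C2 : ℝ, 0 < C2 ∧ ∃ c' : ℝ, 0 < c' ∧
      ∃ d1 : ℝ, 0 < d1 ∧ ∃ d2 : ℝ, 0 < d2 ∧ ∃ lam0 : ℝ, 0 < lam0 ∧
      ∀ n : ℕ, 0 < n →
      ∀ fhat : (Fin n → EuclideanSpace ℝ (Fin d) × Bool) → EuclideanSpace ℝ (Fin d) → Bool,
        (∀ lam : ℝ, 0 < lam → lam ≤ d1 * (n : ℝ) ^ (-((1+α)/(2+α+(d:ℝ)/β))) →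
          ∃ P : Measure (EuclideanSpace ℝ (Fin d) × Bool), ∃ η,
            IsProbabilityMeasure P ∧ IsRegFun P η ∧ P.map Prod.fst = μstar ∧
            MarginCond μstar η α Cm ∧ η ∈ holderClass d β L ∧
            ENNReal.ofReal C1
              ≤ Measure.pi (fun _ : Fin n => P)
                  {D | lam ≤ risk P (fhat D) - risk P (bayes η)}) ∧
        (∀ lam : ℝ, d2 * (n : ℝ) ^ (-((1+α)/(2+α+(d:ℝ)/β))) ≤ lam → lam ≤ lam0 →
          ∃ P : Measure (EuclideanSpace ℝ (Fin d) × Bool), ∃ η,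
            IsProbabilityMeasure P ∧ IsRegFun P η ∧ P.map Prod.fst = μstar ∧
            MarginCond μstar η α Cm ∧ η ∈ holderClass d β L ∧
            ENNReal.ofReal (C2 * Real.exp (-(c' * n * lam ^ ((2+α)/(1+α)))))
              ≤ Measure.pi (fun _ : Fin n => P)
                  {D | lam ≤ risk P (fhat D) - risk P (bayes η)}) := by
  exact mainT d hd α β L Cm hα hβ hL hCm

end
end
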